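/- Let Ω ⊆ ℂ^n be a nonempty bounded connected open set with C¹-smooth boundary whose closure Ω̄ is polynomially convex, and let h_1,…,h_N be continuous complex-valued functions on Ω̄ whose restrictions to Ω are pluriharmonic; write h = (h_1,…,h_N). Then the following are equivalent: (1) the graph 𝒢_h(∂Ω) ⊆ ℂ^{n+N} is polynomially convex; (2) the set 𝒢_h(∂Ω)^̂ \ 𝒢_h(∂Ω) contains no analytic disk; (3) there is no nonconstant holomorphic map φ from the open unit disc 𝔻 ⊆ ℂ into Ω such that h_j ∘ φ is holomorphic on 𝔻 for every j = 1,…,N; (4) [z,h]_{Ω̄} = { f ∈ C(Ω̄,ℂ) : f|_{∂Ω} ∈ [z,h]_{∂Ω} }. -/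

import Mathlib

open Metric

noncomputable def polyHull {m : ℕ} (K : Set (Fin m → ℂ)) : Set (Fin m → ℂ) :=
  {z | ∀ p : MvPolynomial (Fin m) ℂ,
    ‖MvPolynomial.eval z p‖ ≤ sSup ((fun w => ‖MvPolynomial.eval w p‖) '' K)}

def NoAnalyticDisk {m : ℕ} (S : Set (Fin m → ℂ)) : Prop :=
  ∀ φ : ℂ → (Fin m → ℂ), DifferentiableOn ℂ φ (ball (0:ℂ) 1) →
    (∀ z ∈ ball (0:ℂ) 1, φ z ∈ S) →
    ∀ z ∈ ball (0:ℂ) 1, ∀ w ∈ ball (0:ℂ) 1, φ z = φ w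

noncomputable def genAlg {X : Type*} [TopologicalSpace X] (S : Set C(X, ℂ)) : Set C(X, ℂ) :=
  closure ((Algebra.adjoin ℂ S : Subalgebra ℂ C(X, ℂ)) : Set C(X, ℂ))

def Pluriharmonic {n : ℕ} (h : (Fin n → ℂ) → ℂ) (Ω : Set (Fin n → ℂ)) : Prop :=
  ∀ z ∈ Ω, ∃ U, IsOpen U ∧ z ∈ U ∧ U ⊆ Ω ∧
    ∃ F G : (Fin n → ℂ) → ℂ, DifferentiableOn ℂ F U ∧ DifferentiableOn ℂ G U ∧
      ∀ w ∈ U, h w = F w + starRingEnd ℂ (G w)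

def C1Boundary {n : ℕ} (Ω : Set (Fin n → ℂ)) : Prop :=
  ∀ p ∈ frontier Ω, ∃ W : Set (Fin n → ℂ), IsOpen W ∧ p ∈ W ∧
    ∃ ρ : (Fin n → ℂ) → ℝ, ContDiffOn ℝ 1 ρ W ∧ (∀ w ∈ W, fderiv ℝ ρ w ≠ 0) ∧
      Ω ∩ W = {w ∈ W | ρ w < 0} ∧ frontier Ω ∩ W = {w ∈ W | ρ w = 0}

def zhGens {n N : ℕ} (M : Set (Fin n → ℂ)) (h : Fin N → (Fin n → ℂ) → ℂ) :
    Set C(M, ℂ) :=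
  {g | (∃ i : Fin n, ∀ z : M, g z = (z : Fin n → ℂ) i) ∨
       (∃ j : Fin N, ∀ z : M, g z = h j (z : Fin n → ℂ))}

def graphSet {n N : ℕ} (h : Fin N → (Fin n → ℂ) → ℂ) (E : Set (Fin n → ℂ)) :
    Set (Fin (n + N) → ℂ) :=
  (fun z => Fin.append z (fun j => h j z)) '' E

theorem circ_in {p : ℂ} {ρ : ℝ} (h : ‖p‖ < ρ) :
    ∫ θ in (0:ℝ)..2 * Real.pi, circleMap 0 ρ θ / (circleMap 0 ρ θ - p) = 2 * Real.pi := by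
  have h1 := circleIntegral.integral_sub_inv_of_mem_ball (c := 0) (w := p) (R := ρ) (by simpa using h)
  rw [circleIntegral] at h1
  have : (∫ θ in (0:ℝ)..2 * Real.pi, deriv (circleMap 0 ρ) θ • (circleMap 0 ρ θ - p)⁻¹)
     = Complex.I * ∫ θ in (0:ℝ)..2 * Real.pi, circleMap 0 ρ θ / (circleMap 0 ρ θ - p) := by
    rw [← intervalIntegral.integral_const_mul]
    congr 1; ext θ
    simp [div_eq_mul_inv]; ring
  rw [this, mul_comm (2 * (Real.pi:ℂ))] at h1
  exact mul_left_cancel₀ Complex.I_ne_zero h1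

theorem circ_out {p : ℂ} {ρ : ℝ} (h0 : 0 < ρ) (h : ρ < ‖p‖) :
    ∫ θ in (0:ℝ)..2 * Real.pi, circleMap 0 ρ θ / (circleMap 0 ρ θ - p) = 0 := by
  have hne : ∀ z ∈ closedBall (0:ℂ) ρ, z - p ≠ 0 := by
    intro z hz h2
    have : z = p := sub_eq_zero.1 h2
    subst this
    simp at hz; linarith
  have h1 := Complex.circleIntegral_eq_zero_of_differentiable_on_off_countable h0.le
    (f := fun z => (z - p)⁻¹) (c := 0) Set.countable_empty
    (ContinuousOn.inv₀ (by fun_prop) hne) (by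
      intro z hz
      have := hne z (ball_subset_closedBall hz.1)
      fun_prop (disch := assumption))
  rw [circleIntegral] at h1
  have : (∫ θ in (0:ℝ)..2 * Real.pi, deriv (circleMap 0 ρ) θ • (circleMap 0 ρ θ - p)⁻¹)
     = Complex.I * ∫ θ in (0:ℝ)..2 * Real.pi, circleMap 0 ρ θ / (circleMap 0 ρ θ - p) := by
    rw [← intervalIntegral.integral_const_mul]
    congr 1; ext θ
    simp [div_eq_mul_inv]; ring
  rw [this] at h1
  simpa using h1

theorem poisson_in {p : ℂ} {ρ : ℝ} (h : ‖p‖ < ρ) :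
    ∫ θ in (0:ℝ)..2 * Real.pi, 1 / ‖circleMap 0 ρ θ - p‖ ^ 2 = 2 * Real.pi / (ρ ^ 2 - ‖p‖ ^ 2) := by
  have hρ : 0 < ρ := (norm_nonneg p).trans_lt h
  have h1 := DiffContOnCl.circleAverage_poissonKernel_smul' (f := fun _ => (1:ℂ)) (c := 0) (R := ρ)
    (w := p) diffContOnCl_const (by simpa using h)
  have h3 : ρ ^ 2 - ‖p‖ ^ 2 > 0 := by nlinarith [norm_nonneg p]
  rw [Real.circleAverage_def] at h1
  simp only [sub_zero, norm_circleMap_zero, sq_abs] at h1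
  have h2 : ∫ θ in (0:ℝ)..2 * Real.pi, ((ρ ^ 2 - ‖p‖ ^ 2) / ‖circleMap 0 ρ θ - p‖ ^ 2) • (1:ℂ)
    = (((ρ ^ 2 - ‖p‖ ^ 2) * ∫ θ in (0:ℝ)..2 * Real.pi, 1 / ‖circleMap 0 ρ θ - p‖ ^ 2 : ℝ) : ℂ) := by
    rw [← intervalIntegral.integral_const_mul, ← intervalIntegral.integral_ofReal]
    congr 1; ext θ; simp [div_eq_mul_inv]
  rw [h2] at h1
  rw [eq_div_iff h3.ne']
  have hpi := Real.pi_pos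
  simp only [Complex.real_smul] at h1
  have h4 : (2 * Real.pi)⁻¹ * ((ρ ^ 2 - ‖p‖ ^ 2) *
    ∫ θ in (0:ℝ)..2 * Real.pi, 1 / ‖circleMap 0 ρ θ - p‖ ^ 2) = 1 := by exact_mod_cast h1
  field_simp at h4 ⊢
  linarith

theorem circ_inv {p : ℂ} {ρ : ℝ} (h0 : 0 < ρ) (h : ρ < ‖p‖) (θ : ℝ) :
    ‖circleMap 0 ρ θ - p‖ = ‖p‖ / ρ * ‖circleMap 0 ρ θ - ρ ^ 2 / (starRingEnd ℂ p)‖ := by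
  set ζ := circleMap 0 ρ θ
  have hp : p ≠ 0 := by intro h2; simp [h2] at h; linarith
  have hp' : starRingEnd ℂ p ≠ 0 := by simpa using hp
  have hz : ζ * starRingEnd ℂ ζ = ρ ^ 2 := by
    rw [Complex.mul_conj']; simp [ζ, norm_circleMap_zero]
    norm_cast; exact sq_abs ρ
  have e : ζ - ρ ^ 2 / (starRingEnd ℂ p) = ζ * starRingEnd ℂ (p - ζ) / starRingEnd ℂ p := by
    field_simp
    rw [map_sub, mul_sub, hz]
  rw [e, norm_div, norm_mul, RCLike.norm_conj, RCLike.norm_conj, norm_sub_rev p]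
  have : ‖ζ‖ = ρ := by simp [ζ, abs_of_pos h0]
  rw [this]
  have : ‖p‖ ≠ 0 := by simpa using hp
  field_simp

theorem poisson_out {p : ℂ} {ρ : ℝ} (h0 : 0 < ρ) (h : ρ < ‖p‖) :
    ∫ θ in (0:ℝ)..2 * Real.pi, 1 / ‖circleMap 0 ρ θ - p‖ ^ 2 = 2 * Real.pi / (‖p‖ ^ 2 - ρ ^ 2) := by
  have hp : 0 < ‖p‖ := h0.trans h
  have hn : ‖ρ ^ 2 / (starRingEnd ℂ p)‖ = ρ ^ 2 / ‖p‖ := by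
    simp [abs_of_pos h0]
  have h1 := poisson_in (p := ρ ^ 2 / (starRingEnd ℂ p)) (ρ := ρ) (by
    rw [hn, div_lt_iff₀ hp]; nlinarith)
  simp_rw [circ_inv h0 h]
  have : ∀ θ : ℝ, 1 / (‖p‖ / ρ * ‖circleMap 0 ρ θ - ρ ^ 2 / (starRingEnd ℂ p)‖) ^ 2 =
    (ρ ^ 2 / ‖p‖ ^ 2) * (1 / ‖circleMap 0 ρ θ - ρ ^ 2 / (starRingEnd ℂ p)‖ ^ 2) := by
    intro θ; rw [mul_pow, div_pow, one_div, mul_inv, inv_div, one_div]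
  simp_rw [this]
  rw [intervalIntegral.integral_const_mul, h1, hn]
  have : ‖p‖ ^ 2 - ρ ^ 2 > 0 := by nlinarith
  have : ρ ^ 2 - (ρ ^ 2 / ‖p‖) ^ 2 = ρ ^ 2 / ‖p‖ ^ 2 * (‖p‖ ^ 2 - ρ ^ 2) := by
    field_simp
  rw [this]
  field_simp

theorem poisson_abs {p : ℂ} {ρ : ℝ} (h0 : 0 < ρ) (h : ‖p‖ ≠ ρ) :
    ∫ θ in (0:ℝ)..2 * Real.pi, 1 / ‖circleMap 0 ρ θ - p‖ ^ 2 = 2 * Real.pi / |ρ ^ 2 - ‖p‖ ^ 2| := by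
  rcases lt_or_gt_of_ne h with h | h
  · rw [poisson_in h, abs_of_pos (by nlinarith [norm_nonneg p])]
  · rw [poisson_out h0 h, abs_of_neg (by nlinarith [norm_nonneg p]), neg_sub]

theorem circ_sub_ne {p : ℂ} {ρ : ℝ} (h0 : 0 < ρ) (h : ‖p‖ ≠ ρ) (θ : ℝ) :
    circleMap 0 ρ θ - p ≠ 0 := by
  intro h2
  apply h
  rw [← sub_eq_zero.1 h2]; simp [abs_of_pos h0]

theorem inv_abs_bound {p : ℂ} {ρ : ℝ} (h0 : 0 < ρ) (h : ‖p‖ ≠ ρ) :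
    ∫ θ in (0:ℝ)..2 * Real.pi, 1 / ‖circleMap 0 ρ θ - p‖ ≤ 2 * Real.pi / √|ρ ^ 2 - ‖p‖ ^ 2| := by
  set D := |ρ ^ 2 - ‖p‖ ^ 2| with hD
  have hDp : 0 < D := by
    rw [hD, abs_pos, sub_ne_zero]
    intro h2
    exact h ((sq_eq_sq₀ h0.le (norm_nonneg p)).1 h2).symm
  have hs : 0 < √D := Real.sqrt_pos.2 hDp
  have hss : √D * √D = D := Real.mul_self_sqrt hDp.le
  have hne := circ_sub_ne h0 h
  have hne' : ∀ θ, ‖circleMap 0 ρ θ - p‖ ≠ 0 := fun θ => by simpa using hne θ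
  have hne2 : ∀ θ, ‖circleMap 0 ρ θ - p‖ ^ 2 ≠ 0 := fun θ => pow_ne_zero _ (hne' θ)
  have c1 : Continuous fun θ : ℝ => 1 / ‖circleMap 0 ρ θ - p‖ := by
    refine Continuous.div continuous_const ?_ hne'
    exact ((continuous_circleMap 0 ρ).sub continuous_const).norm
  have c2 : Continuous fun θ : ℝ => 1 / ‖circleMap 0 ρ θ - p‖ ^ 2 := by
    refine Continuous.div continuous_const ?_ hne2
    exact ((continuous_circleMap 0 ρ).sub continuous_const).norm.pow 2
  calc _ ≤ ∫ θ in (0:ℝ)..2 * Real.pi, ((1 / 2) * (1 / √D) +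
        (√D / 2) * (1 / ‖circleMap 0 ρ θ - p‖ ^ 2)) := by
        apply intervalIntegral.integral_mono_on (by positivity) (c1.intervalIntegrable _ _)
        · exact Continuous.intervalIntegrable (by fun_prop) _ _
        · intro θ _
          have hx : 0 < ‖circleMap 0 ρ θ - p‖ := lt_of_le_of_ne (norm_nonneg _) (hne' θ).symm
          set x := ‖circleMap 0 ρ θ - p‖
          have : (1 / 2) * (1 / √D) + (√D / 2) * (1 / x ^ 2) - 1 / x = (√D - x) ^ 2 / (2 * √D * x ^ 2) := by
            field_simp; ring
          have h5 : 0 ≤ (√D - x) ^ 2 / (2 * √D * x ^ 2) := by positivity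
          linarith
    _ = _ := by
        rw [intervalIntegral.integral_add (Continuous.intervalIntegrable (by fun_prop) _ _)
          (Continuous.intervalIntegrable (by fun_prop) _ _), intervalIntegral.integral_const_mul,
          intervalIntegral.integral_const_mul, poisson_abs h0 h, ← hD]
        simp only [intervalIntegral.integral_const, sub_zero, smul_eq_mul]
        have hsq : √D ^ 2 = D := by rw [sq, hss]
        field_simp
        rw [hsq]; ring

/-- integrable majorant -/
noncomputable def maj (a x : ℝ) : ℝ := (x - a) ^ (-(1/2):ℝ) + (a - x) ^ (-(1/2):ℝ)

theorem rpow_neg_half_nonneg (x : ℝ) : 0 ≤ x ^ (-(1/2):ℝ) := by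
  rcases le_or_gt 0 x with h | h
  · positivity
  · rw [Real.rpow_def_of_neg h]
    have : Real.cos (-(1/2) * Real.pi) = 0 := by
      rw [show -(1/2) * Real.pi = -(Real.pi/2) by ring]; simp
    rw [this, mul_zero]

theorem maj_bound {a x : ℝ} (h : x ≠ a) : 1 / √|x - a| ≤ maj a x := by
  rw [maj]
  have e : ∀ y : ℝ, 0 < y → 1 / √y = y ^ (-(1/2):ℝ) := by
    intro y hy; rw [Real.rpow_neg hy.le, Real.sqrt_eq_rpow, one_div]
  rcases lt_or_gt_of_ne h with h | h
  · rw [abs_of_neg (by linarith), e _ (by linarith), neg_sub]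
    have := rpow_neg_half_nonneg (x - a); linarith
  · rw [abs_of_pos (by linarith), e _ (by linarith)]
    have := rpow_neg_half_nonneg (a - x); linarith

theorem maj_int (a r s : ℝ) : IntervalIntegrable (maj a) MeasureTheory.volume r s := by
  have h1 := (intervalIntegral.intervalIntegrable_rpow' (r := -(1/2)) (by norm_num) (a := r - a) (b := s - a)).comp_sub_right a
  have h2 := (intervalIntegral.intervalIntegrable_rpow' (r := -(1/2)) (by norm_num) (a := a - r) (b := a - s)).comp_sub_left a
  simp only [sub_add_cancel, sub_sub_cancel] at h1 h2
  exact h1.add h2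

theorem rpow_half_le (x y : ℝ) (hxy : |x| ≤ y) : 0 ≤ x ^ (1/2:ℝ) ∧ x ^ (1/2:ℝ) ≤ √y := by
  rcases le_or_gt 0 x with h | h
  · constructor
    · positivity
    · rw [← Real.sqrt_eq_rpow]; exact Real.sqrt_le_sqrt ((le_abs_self x).trans hxy)
  · rw [Real.rpow_def_of_neg h]
    have : Real.cos ((1/2) * Real.pi) = 0 := by
      rw [show (1/2) * Real.pi = (Real.pi/2) by ring]; simp
    rw [this, mul_zero]; exact ⟨le_rfl, Real.sqrt_nonneg _⟩

theorem maj_integral (a r s L : ℝ) (h1 : |r - a| ≤ L) (h2 : |s - a| ≤ L) :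
    ∫ x in r..s, maj a x ≤ 4 * √L := by
  have i1 := (intervalIntegral.intervalIntegrable_rpow' (r := -(1/2)) (by norm_num) (a := r - a) (b := s - a)).comp_sub_right a
  have i2 := (intervalIntegral.intervalIntegrable_rpow' (r := -(1/2)) (by norm_num) (a := a - r) (b := a - s)).comp_sub_left a
  simp only [sub_add_cancel, sub_sub_cancel] at i1 i2
  simp only [maj]
  rw [intervalIntegral.integral_add i1 i2,
    intervalIntegral.integral_comp_sub_right (fun x => x ^ (-(1/2):ℝ)),
    intervalIntegral.integral_comp_sub_left (fun x => x ^ (-(1/2):ℝ)),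
    integral_rpow (Or.inl (by norm_num)), integral_rpow (Or.inl (by norm_num))]
  norm_num
  have e1 := rpow_half_le (s - a) L h2
  have e2 := rpow_half_le (r - a) L h1
  have e3 := rpow_half_le (a - s) L (by rwa [abs_sub_comm])
  have e4 := rpow_half_le (a - r) L (by rwa [abs_sub_comm])
  linarith [e1.1, e1.2, e2.1, e2.2, e3.1, e3.2, e4.1, e4.2]

noncomputable def kap (r1 r2 : ℝ) (p : ℂ) : ℝ := max 0 (r2 - max r1 ‖p‖) / (r2 - r1)

theorem kap_nonneg {r1 r2 : ℝ} (h : r1 < r2) (p : ℂ) : 0 ≤ kap r1 r2 p :=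
  div_nonneg (le_max_left _ _) (by linarith)

theorem kap_le_one {r1 r2 : ℝ} (h : r1 < r2) (p : ℂ) : kap r1 r2 p ≤ 1 := by
  rw [kap, div_le_one (by linarith)]
  exact max_le (by linarith) (by linarith [le_max_left r1 ‖p‖])

theorem kap_one {r1 r2 : ℝ} (h : r1 < r2) {p : ℂ} (hp : ‖p‖ ≤ r1) : kap r1 r2 p = 1 := by
  rw [kap, max_eq_left hp, max_eq_right (by linarith), div_self (by linarith)]

theorem kap_zero {r1 r2 : ℝ} {p : ℂ} (hp : r2 ≤ ‖p‖) : kap r1 r2 p = 0 := by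
  rw [kap, max_eq_left (by linarith [le_max_right r1 ‖p‖]), zero_div]

theorem kap_cont (r1 r2 : ℝ) : Continuous (kap r1 r2) := by
  unfold kap; fun_prop

theorem int_ind {r1 r2 a : ℝ} (h : r1 < r2) (c : ℂ) :
    ∫ ρ in r1..r2, (Set.Ioi a).indicator (fun _ => c) ρ = (max 0 (r2 - max r1 a) : ℝ) * c := by
  rw [intervalIntegral.integral_of_le h.le, MeasureTheory.setIntegral_indicator measurableSet_Ioi,
    MeasureTheory.setIntegral_const, Set.Ioc_inter_Ioi]
  simp only [MeasureTheory.measureReal_def, Real.volume_Ioc, Complex.real_smul]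
  rcases le_total 0 (r2 - max r1 a) with h1 | h1
  · rw [ENNReal.toReal_ofReal h1, max_eq_right h1]
  · rw [ENNReal.ofReal_of_nonpos h1, max_eq_left h1]; simp

theorem core1_pt {E : Type*} [NormedAddCommGroup E] [NormedSpace ℂ E] [CompleteSpace E]
    {r1 r2 R : ℝ} (h1 : 0 < r1) (h2 : r1 < r2) (hR : r2 ≤ R)
    (w : ℝ → ℝ → E) (hw : Continuous (fun x : ℝ × ℝ => w x.1 x.2)) (l : E →L[ℂ] ℂ) (p f : ℂ)
    (hp : ‖p‖ ≤ R) {ε : ℝ}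
    (H : ∀ ρ ∈ Set.Icc r1 r2, ∀ θ : ℝ, ‖f - (p - circleMap 0 ρ θ) * l (w ρ θ)‖ ≤ ε) :
    ‖(kap r1 r2 p : ℂ) * f - l (-(1 / (2 * Real.pi * (r2 - r1)) : ℂ) •
      ∫ ρ in r1..r2, ∫ θ in (0:ℝ)..2 * Real.pi, circleMap 0 ρ θ • w ρ θ)‖ ≤
      (4 * r2 * √R / (√r1 * (r2 - r1))) * ε := by
  have hε : 0 ≤ ε := (norm_nonneg _).trans (H r1 ⟨le_rfl, h2.le⟩ 0)
  have hcm : Continuous (fun x : ℝ × ℝ => circleMap 0 x.1 x.2) := by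
    unfold circleMap; fun_prop
  have hpi := Real.pi_pos
  set I : ℝ → ℂ := fun ρ => ∫ θ in (0:ℝ)..2 * Real.pi, circleMap 0 ρ θ * l (w ρ θ) with hI
  have hIc : Continuous I := by
    apply intervalIntegral.continuous_parametric_intervalIntegral_of_continuous' 
    exact hcm.mul (l.continuous.comp hw)
  have hEc : Continuous (fun ρ => ∫ θ in (0:ℝ)..2 * Real.pi, circleMap 0 ρ θ • w ρ θ) := by
    apply intervalIntegral.continuous_parametric_intervalIntegral_of_continuous' 
    exact hcm.smul hw
  have hcρ : ∀ ρ, Continuous fun θ => w ρ θ := fun ρ => hw.comp (by fun_prop : Continuous fun θ : ℝ => (ρ, θ))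
  have e1 : l (∫ ρ in r1..r2, ∫ θ in (0:ℝ)..2 * Real.pi, circleMap 0 ρ θ • w ρ θ) = ∫ ρ in r1..r2, I ρ := by
    rw [← ContinuousLinearMap.intervalIntegral_comp_comm l (hEc.intervalIntegrable _ _)]
    congr 1; ext ρ
    have hcc : Continuous fun θ => circleMap 0 ρ θ • w ρ θ := (continuous_circleMap 0 ρ).smul (hcρ ρ)
    rw [← ContinuousLinearMap.intervalIntegral_comp_comm l (hcc.intervalIntegrable _ _)]
    simp [hI]
  set J : ℝ → ℂ := (Set.Ioi ‖p‖).indicator (fun _ => 2 * Real.pi * f) with hJ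
  have hJi : IntervalIntegrable J MeasureTheory.volume r1 r2 := by
    rw [intervalIntegrable_iff]
    apply MeasureTheory.IntegrableOn.indicator _ measurableSet_Ioi
    exact MeasureTheory.integrableOn_const (by simp)
  have e2 : ∫ ρ in r1..r2, J ρ = (2 * Real.pi * (r2 - r1)) * (kap r1 r2 p * f) := by
    rw [hJ, int_ind h2, kap]; push_cast
    have : (r2 - r1 : ℂ) ≠ 0 := by
      have : (r2 - r1 : ℝ) ≠ 0 := by linarith
      exact_mod_cast this
    field_simp
  have key : ∀ ρ ∈ Set.Icc r1 r2, ρ ≠ ‖p‖ →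
      ‖J ρ + I ρ‖ ≤ (r2 * ε * (2 * Real.pi) / √r1) * maj ‖p‖ ρ := by
    intro ρ hρ hne
    have hρ0 : 0 < ρ := h1.trans_le hρ.1
    have hnz := circ_sub_ne hρ0 hne.symm
    have c0 : Continuous fun θ : ℝ => circleMap 0 ρ θ / (circleMap 0 ρ θ - p) :=
      (continuous_circleMap 0 ρ).div ((continuous_circleMap 0 ρ).sub continuous_const) hnz
    have c1 : Continuous fun θ : ℝ => 1 / ‖circleMap 0 ρ θ - p‖ := by
      refine Continuous.div continuous_const ?_ (fun θ => by simpa using hnz θ)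
      exact ((continuous_circleMap 0 ρ).sub continuous_const).norm
    have j1 : J ρ = ∫ θ in (0:ℝ)..2 * Real.pi, circleMap 0 ρ θ / (circleMap 0 ρ θ - p) * f := by
      rw [intervalIntegral.integral_mul_const]
      rcases lt_or_gt_of_ne hne with h | h
      · rw [circ_out hρ0 h, hJ, Set.indicator_of_notMem (by simp [h.le])]; simp
      · rw [circ_in h, hJ, Set.indicator_of_mem (by simpa using h)]
    have cl : Continuous fun θ => l (w ρ θ) := l.continuous.comp (hcρ ρ)
    have d1 : Continuous fun θ => circleMap 0 ρ θ / (circleMap 0 ρ θ - p) * f := c0.mul continuous_const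
    have d2 : Continuous fun θ => circleMap 0 ρ θ * l (w ρ θ) := (continuous_circleMap 0 ρ).mul cl
    rw [j1, show I ρ = ∫ θ in (0:ℝ)..2 * Real.pi, circleMap 0 ρ θ * l (w ρ θ) from rfl,
      ← intervalIntegral.integral_add (d1.intervalIntegrable _ _) (d2.intervalIntegrable _ _)]
    have hb : ‖∫ θ in (0:ℝ)..2 * Real.pi, (circleMap 0 ρ θ / (circleMap 0 ρ θ - p) * f + circleMap 0 ρ θ * l (w ρ θ))‖ ≤ ∫ θ in (0:ℝ)..2 * Real.pi, r2 * ε * (1 / ‖circleMap 0 ρ θ - p‖) := by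
      apply intervalIntegral.norm_integral_le_of_norm_le (by positivity)
      · refine Filter.Eventually.of_forall fun θ _ => ?_
        have : circleMap 0 ρ θ / (circleMap 0 ρ θ - p) * f + circleMap 0 ρ θ * l (w ρ θ)
          = circleMap 0 ρ θ * (f - (p - circleMap 0 ρ θ) * l (w ρ θ)) * (1 / (circleMap 0 ρ θ - p)) := by
          have := hnz θ
          field_simp
          ring
        rw [this, norm_mul, norm_mul, norm_div, norm_one]
        gcongr
        · linarith
        · simp [abs_of_pos hρ0]; exact hρ.2
        · exact H ρ hρ θ
      · exact (c1.const_mul _).intervalIntegrable _ _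
    refine hb.trans ?_
    rw [intervalIntegral.integral_const_mul]
    have h3 : √|ρ ^ 2 - ‖p‖ ^ 2| ≥ √r1 * √|ρ - ‖p‖| := by
      rw [← Real.sqrt_mul h1.le]
      apply Real.sqrt_le_sqrt
      rw [show ρ ^ 2 - ‖p‖ ^ 2 = (ρ + ‖p‖) * (ρ - ‖p‖) by ring, abs_mul]
      gcongr
      rw [abs_of_nonneg (by positivity)]
      linarith [hρ.1, norm_nonneg p]
    have h4 : 0 < √|ρ - ‖p‖| := Real.sqrt_pos.2 (abs_pos.2 (sub_ne_zero.2 hne))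
    have h5 : 0 < √r1 := Real.sqrt_pos.2 h1
    calc _ ≤ r2 * ε * (2 * Real.pi / √|ρ ^ 2 - ‖p‖ ^ 2|) := by
            gcongr
            · exact mul_nonneg (by linarith) hε
            exact inv_abs_bound hρ0 hne.symm
      _ ≤ r2 * ε * (2 * Real.pi / (√r1 * √|ρ - ‖p‖|)) := by
            gcongr
            exact mul_nonneg (by linarith) hε
      _ = (r2 * ε * (2 * Real.pi) / √r1) * (1 / √|ρ - ‖p‖|) := by field_simp
      _ ≤ _ := by
            gcongr
            · exact div_nonneg (mul_nonneg (mul_nonneg (by linarith) hε) (by positivity)) h5.le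
            exact maj_bound hne
  have tot : ‖(∫ ρ in r1..r2, J ρ) + ∫ ρ in r1..r2, I ρ‖ ≤
      (r2 * ε * (2 * Real.pi) / √r1) * (4 * √R) := by
    rw [← intervalIntegral.integral_add hJi (hIc.intervalIntegrable _ _)]
    refine (intervalIntegral.norm_integral_le_of_norm_le h2.le ?_ ((maj_int ‖p‖ r1 r2).const_mul
      (r2 * ε * (2 * Real.pi) / √r1))).trans ?_
    · have : ∀ᵐ ρ : ℝ, ρ ≠ ‖p‖ := by simp [MeasureTheory.ae_iff]
      filter_upwards [this] with ρ hρ hm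
      exact key ρ ⟨hm.1.le, hm.2⟩ hρ
    · rw [intervalIntegral.integral_const_mul]
      have h5 : 0 < √r1 := Real.sqrt_pos.2 h1
      gcongr
      · exact div_nonneg (mul_nonneg (mul_nonneg (by linarith) hε) (by positivity)) h5.le
      apply maj_integral
      · rw [abs_le]; constructor <;> linarith [norm_nonneg p]
      · rw [abs_le]; constructor <;> linarith [norm_nonneg p]
  have hpos : 0 < 2 * Real.pi * (r2 - r1) := by
    have : 0 < r2 - r1 := by linarith
    positivity
  have hc : (2 * Real.pi * (r2 - r1) : ℂ) = ((2 * Real.pi * (r2 - r1) : ℝ) : ℂ) := by push_cast; ring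
  have hne : ((2 * Real.pi * (r2 - r1) : ℝ) : ℂ) ≠ 0 := by exact_mod_cast hpos.ne'
  rw [map_smul, e1, hc]
  have e3 : (kap r1 r2 p : ℂ) * f - (-(1 / ((2 * Real.pi * (r2 - r1) : ℝ) : ℂ))) • ∫ ρ in r1..r2, I ρ
     = (1 / ((2 * Real.pi * (r2 - r1) : ℝ) : ℂ)) * ((∫ ρ in r1..r2, J ρ) + ∫ ρ in r1..r2, I ρ) := by
    rw [e2, hc, smul_eq_mul]; field_simp; ring
  rw [e3, norm_mul, norm_div, norm_one, Complex.norm_real, Real.norm_of_nonneg hpos.le]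
  calc _ ≤ 1 / (2 * Real.pi * (r2 - r1)) * ((r2 * ε * (2 * Real.pi) / √r1) * (4 * √R)) := by gcongr
    _ = _ := by
      have h5 : 0 < √r1 := Real.sqrt_pos.2 h1
      have : r2 - r1 ≠ 0 := by linarith
      field_simp

section qalg
variable {B : Type*} [NormedCommRing B] [NormedAlgebra ℂ B] [CompleteSpace B]

noncomputable def iotaT (B : Type*) [NormedCommRing B] [NormedAlgebra ℂ B] (T : Set ℂ) : C(T, B) :=
  ⟨fun z => algebraMap ℂ B z, by fun_prop⟩

noncomputable def constT (B : Type*) [NormedCommRing B] [NormedAlgebra ℂ B] (T : Set ℂ) :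
    B →ₐ[ℂ] C(T, B) where
  toFun b := ContinuousMap.const T b
  map_one' := rfl
  map_mul' _ _ := rfl
  map_zero' := rfl
  map_add' _ _ := rfl
  commutes' _ := rfl

variable (P : B) (T : Set ℂ) [CompactSpace T]

noncomputable def QI : Ideal C(T, B) := (Ideal.span {constT B T P - iotaT B T}).closure

instance QI_closed : IsClosed (QI P T : Set C(T, B)) := by
  unfold QI; rw [Ideal.coe_closure]; exact isClosed_closure

abbrev QA := C(T, B) ⧸ (QI P T)

noncomputable def qm : B →ₐ[ℂ] QA P T := (Ideal.Quotient.mkₐ ℂ (QI P T)).comp (constT B T)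

theorem qm_norm_le (b : B) : ‖qm P T b‖ ≤ ‖b‖ := by
  refine (Ideal.Quotient.norm_mk_le (QI P T) (constT B T b)).trans ?_
  rw [ContinuousMap.norm_le _ (norm_nonneg _)]
  intro x; rfl

theorem q_char (L : WeakDual.characterSpace ℂ (QA P T)) : L (qm P T P) ∈ T := by
  set z := L (qm P T P)
  by_contra hz
  have hne : ∀ t : T, (t : ℂ) - z ≠ 0 := by
    intro t ht; apply hz; rw [← sub_eq_zero.1 ht]; exact t.2
  let v : C(T, B) := ⟨fun t => algebraMap ℂ B ((t - z : ℂ)⁻¹), by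
    refine (algebraMapCLM ℂ B).continuous.comp ?_
    exact Continuous.inv₀ (by fun_prop) hne⟩
  have h1 : (iotaT B T - algebraMap ℂ C(T, B) z) * v = 1 := by
    ext t
    simp only [ContinuousMap.mul_apply, ContinuousMap.sub_apply, ContinuousMap.one_apply]
    change (algebraMap ℂ B (t:ℂ) - algebraMap ℂ B z) * algebraMap ℂ B ((t - z : ℂ)⁻¹) = 1
    rw [← map_sub, ← map_mul, mul_inv_cancel₀ (hne t), map_one]
  have h2 : Ideal.Quotient.mkₐ ℂ (QI P T) (iotaT B T) = qm P T P := by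
    refine (Ideal.Quotient.eq.2 ?_).symm
    have : (constT B T P - iotaT B T) ∈ ((QI P T : Ideal _) : Set C(T, B)) := by
      unfold QI; rw [Ideal.coe_closure]; exact subset_closure (Ideal.subset_span rfl)
    exact this
  have h3 := congrArg (fun x => L (Ideal.Quotient.mkₐ ℂ (QI P T) x)) h1
  simp only [map_mul, map_sub, map_one, h2, AlgHom.commutes] at h3
  rw [AlgHomClass.commutes] at h3
  simp [z] at h3

theorem q_lift (b : B) {ε : ℝ} (h : ‖qm P T b‖ < ε) :
    ∃ w : C(T, B), ∀ t : T, ‖b - (P - algebraMap ℂ B t) * w t‖ < ε := by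
  obtain ⟨m, hm, hmε⟩ := QuotientAddGroup.norm_lt_iff.1 h
  have h1 : constT B T b - m ∈ QI P T := by
    have : (Ideal.Quotient.mk (QI P T)) m = Ideal.Quotient.mk (QI P T) (constT B T b) := hm
    exact Ideal.Quotient.eq.1 this.symm
  have h2 : constT B T b - m ∈ closure ((Ideal.span {constT B T P - iotaT B T} : Ideal C(T,B)) : Set C(T, B)) := by
    rw [← Ideal.coe_closure]; exact h1
  obtain ⟨g, hg, hd⟩ := Metric.mem_closure_iff.1 h2 (ε - ‖m‖) (by linarith)
  obtain ⟨w, rfl⟩ := Ideal.mem_span_singleton'.1 hg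
  refine ⟨w, fun t => ?_⟩
  rw [dist_eq_norm] at hd
  have h3 := ContinuousMap.norm_coe_le_norm (constT B T b - m - w * (constT B T P - iotaT B T)) t
  have h4 := ContinuousMap.norm_coe_le_norm m t
  have : b - (P - algebraMap ℂ B t) * w t = (constT B T b - m - w * (constT B T P - iotaT B T)) t + m t := by
    change _ = (b - m t - w t * (P - algebraMap ℂ B t)) + m t
    ring
  rw [this]
  linarith [norm_add_le ((constT B T b - m - w * (constT B T P - iotaT B T)) t) (m t)]
end qalg

theorem pow_bound {Q : Type*} [NormedCommRing Q] [NormedAlgebra ℂ Q] [CompleteSpace Q] (a : Q)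
    {r : ℝ} (hr : 0 < r) (h : ∀ L : WeakDual.characterSpace ℂ Q, ‖L a‖ < r) :
    ∃ M > 0, ∀ k : ℕ, ‖a ^ k‖ ≤ M * r ^ k := by
  rcases subsingleton_or_nontrivial Q with hQ | hQ
  · exact ⟨1, one_pos, fun k => by rw [Subsingleton.elim (a ^ k) 0]; simp; positivity⟩
  lift r to NNReal using hr.le
  have h1 : spectralRadius ℂ a < r := by
    apply spectrum.spectralRadius_lt_of_forall_lt
    intro z hz
    obtain ⟨L, rfl⟩ := WeakDual.CharacterSpace.mem_spectrum_iff_exists.1 hz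
    exact_mod_cast h L
  have h2 := (spectrum.pow_nnnorm_pow_one_div_tendsto_nhds_spectralRadius a).eventually (gt_mem_nhds h1)
  obtain ⟨k0, hk0⟩ := Filter.eventually_atTop.1 h2
  have h3 : ∀ k ≥ k0 + 1, ‖a ^ k‖ ≤ r ^ k := by
    intro k hk
    have h4 := hk0 k (by omega)
    have hk' : (k:ℝ) ≠ 0 := by norm_cast; omega
    have h5 := ENNReal.rpow_le_rpow h4.le (z := k) (by positivity)
    rw [← ENNReal.rpow_mul, one_div, inv_mul_cancel₀ hk', ENNReal.rpow_one, ENNReal.rpow_natCast] at h5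
    exact_mod_cast h5
  refine ⟨1 + ∑ k ∈ Finset.range (k0 + 1), ‖a ^ k‖ / r ^ k, by positivity, fun k => ?_⟩
  by_cases hk : k < k0 + 1
  · have : ‖a ^ k‖ / r ^ k ≤ ∑ k ∈ Finset.range (k0 + 1), ‖a ^ k‖ / (r:ℝ) ^ k :=
      Finset.single_le_sum (f := fun k => ‖a ^ k‖ / (r:ℝ) ^ k) (fun i _ => by positivity) (Finset.mem_range.2 hk)
    rw [← div_le_iff₀ (by positivity)]
    linarith
  · have : 0 ≤ ∑ k ∈ Finset.range (k0 + 1), ‖a ^ k‖ / (r:ℝ) ^ k := Finset.sum_nonneg (fun i _ => by positivity)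
    have h6 := h3 k (by omega)
    have h7 : (0:ℝ) < r ^ k := by positivity
    nlinarith

def Ann (r1 r2 : ℝ) : Set ℂ := {z | r1 ≤ ‖z‖ ∧ ‖z‖ ≤ r2}

theorem Ann_compact (r1 r2 : ℝ) : IsCompact (Ann r1 r2) := by
  apply (isCompact_closedBall (0:ℂ) r2).of_isClosed_subset
  · exact (isClosed_le continuous_const continuous_norm).inter (isClosed_le continuous_norm continuous_const)
  · intro z hz; simpa using hz.2

instance (r1 r2 : ℝ) : CompactSpace (Ann r1 r2) := isCompact_iff_compactSpace.1 (Ann_compact r1 r2)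

theorem core1 {Y : Type*} [TopologicalSpace Y] [CompactSpace Y] (A : Subalgebra ℂ C(Y, ℂ))
    [CompleteSpace A] {r1 r2 : ℝ} (h1 : 0 < r1) (h2 : r1 < r2) (P : A) :
    ∃ C > 0, ∀ (f : A) (ε : ℝ), ‖qm P (Ann r1 r2) f‖ < ε →
      ∃ Φ : A, ∀ y, ‖(kap r1 r2 (P.1 y) : ℂ) * f.1 y - Φ.1 y‖ ≤ C * ε := by
  set R := max r2 ‖P‖
  have hR : 0 < R := by have := le_max_left r2 ‖P‖; simp only [R]; linarith
  refine ⟨4 * r2 * √R / (√r1 * (r2 - r1)), ?_, fun f ε hf => ?_⟩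
  · have : 0 < r2 - r1 := by linarith
    have : 0 < r2 := by linarith
    positivity
  obtain ⟨w, hw⟩ := q_lift P (Ann r1 r2) f hf
  let cl : ℝ → ℝ := fun ρ => max r1 (min r2 ρ)
  have hcl : ∀ ρ, r1 ≤ cl ρ ∧ cl ρ ≤ r2 := fun ρ => ⟨le_max_left _ _, max_le h2.le (min_le_left _ _)⟩
  have hcl2 : ∀ ρ ∈ Set.Icc r1 r2, cl ρ = ρ := fun ρ hρ => by simp [cl, hρ.1, hρ.2]
  let cz : ℝ × ℝ → Ann r1 r2 := fun x => ⟨circleMap 0 (cl x.1) x.2, by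
    have h3 : 0 ≤ cl x.1 := by linarith [(hcl x.1).1]
    simp only [Ann, Set.mem_setOf_eq, norm_circleMap_zero, abs_of_nonneg h3]; exact hcl _⟩
  have hcz : Continuous cz := by
    apply Continuous.subtype_mk
    unfold circleMap; fun_prop
  let l : Y → A →L[ℂ] ℂ := fun y => 
    { toFun := fun a => a.1 y
      map_add' := fun _ _ => rfl
      map_smul' := fun _ _ => rfl
      cont := (ContinuousMap.evalCLM ℂ y).continuous.comp continuous_subtype_val }
  refine ⟨-(1 / (2 * Real.pi * (r2 - r1)) : ℂ) • ∫ ρ in r1..r2, ∫ θ in (0:ℝ)..2 * Real.pi, circleMap 0 ρ θ • w (cz (ρ, θ)), fun y => core1_pt h1 h2 (le_max_left r2 ‖P‖) (fun ρ θ => w (cz (ρ, θ)))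
    (w.continuous.comp hcz) (l y) (P.1 y) (f.1 y) ?_ ?_⟩
  · exact (ContinuousMap.norm_coe_le_norm P.1 y).trans (le_max_right _ _)
  · intro ρ hρ θ
    have h3 := (ContinuousMap.norm_coe_le_norm _ y).trans (hw (cz (ρ, θ))).le
    have h4 : ((cz (ρ, θ)) : ℂ) = circleMap 0 ρ θ := by simp [cz, hcl2 ρ hρ]
    rw [h4] at h3
    exact h3

theorem hull_of {m : ℕ} {K : Set (Fin m → ℂ)} (hK : IsCompact K) {z : Fin m → ℂ}
    (h : ∀ (p : MvPolynomial (Fin m) ℂ) (C : ℝ), 0 ≤ C → (∀ w ∈ K, ‖MvPolynomial.eval w p‖ ≤ C) →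
      ‖MvPolynomial.eval z p‖ ≤ C) : z ∈ polyHull K := by
  intro p
  have hb : BddAbove ((fun w => ‖MvPolynomial.eval w p‖) '' K) :=
    (hK.image (MvPolynomial.continuous_eval p).norm).bddAbove
  apply h p
  · apply Real.sSup_nonneg
    rintro _ ⟨w, _, rfl⟩; positivity
  · intro w hw; exact le_csSup hb ⟨w, hw, rfl⟩

theorem hull_le {m : ℕ} {K : Set (Fin m → ℂ)} {z : Fin m → ℂ} (hz : z ∈ polyHull K)
    (p : MvPolynomial (Fin m) ℂ) {C : ℝ} (hC : 0 ≤ C) (h : ∀ w ∈ K, ‖MvPolynomial.eval w p‖ ≤ C) :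
    ‖MvPolynomial.eval z p‖ ≤ C := by
  refine (hz p).trans (Real.sSup_le ?_ hC)
  rintro _ ⟨w, hw, rfl⟩; exact h w hw

theorem subset_hull {m : ℕ} {K : Set (Fin m → ℂ)} (hK : IsCompact K) : K ⊆ polyHull K :=
  fun z hz => hull_of hK fun _ _ _ h => h z hz

theorem hull_closed {m : ℕ} (K : Set (Fin m → ℂ)) : IsClosed (polyHull K) := by
  have : polyHull K = ⋂ p : MvPolynomial (Fin m) ℂ, {z | ‖MvPolynomial.eval z p‖ ≤
    sSup ((fun w => ‖MvPolynomial.eval w p‖) '' K)} := by ext z; simp [polyHull]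
  rw [this]
  exact isClosed_iInter fun p => isClosed_le (MvPolynomial.continuous_eval p).norm continuous_const

theorem hull_compact {m : ℕ} {K : Set (Fin m → ℂ)} (hK : IsCompact K) : IsCompact (polyHull K) := by
  obtain ⟨R, hR⟩ := hK.isBounded.exists_norm_le
  apply (isCompact_closedBall (0 : Fin m → ℂ) (max R 0)).of_isClosed_subset (hull_closed K)
  intro z hz
  rw [mem_closedBall_zero_iff, pi_norm_le_iff_of_nonneg (le_max_right _ _)]
  intro i
  have := hull_le hz (MvPolynomial.X i) (le_max_right R 0) (fun w hw => by
    rw [MvPolynomial.eval_X]; exact (norm_le_pi_norm w i).trans ((hR w hw).trans (le_max_left _ _)))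
  simpa using this

theorem hull_hull {m : ℕ} {K : Set (Fin m → ℂ)} (hK : IsCompact K) :
    polyHull (polyHull K) ⊆ polyHull K := fun z hz =>
  hull_of hK fun p C hC h => hull_le hz p hC fun w hw => hull_le hw p hC h

noncomputable def evP {m : ℕ} (Y : Set (Fin m → ℂ)) : MvPolynomial (Fin m) ℂ →ₐ[ℂ] C(Y, ℂ) :=
  MvPolynomial.aeval (fun i => ⟨fun y => y.1 i, (continuous_apply i).comp continuous_subtype_val⟩)

theorem evP_apply {m : ℕ} (Y : Set (Fin m → ℂ)) (p : MvPolynomial (Fin m) ℂ) (y : Y) :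
    evP Y p y = MvPolynomial.eval y.1 p := by
  induction p using MvPolynomial.induction_on with
  | C a => simp [evP]
  | add p q hp hq => simp [hp, hq]
  | mul_X p i hp => simp [hp]; left; simp [evP]

noncomputable def PA {m : ℕ} (Y : Set (Fin m → ℂ)) [CompactSpace Y] : Subalgebra ℂ C(Y, ℂ) :=
  (evP Y).range.topologicalClosure

theorem mem_PA {m : ℕ} {Y : Set (Fin m → ℂ)} [CompactSpace Y] {f : C(Y, ℂ)} :
    f ∈ PA Y ↔ ∀ ε > 0, ∃ p : MvPolynomial (Fin m) ℂ, ∀ y : Y, ‖f y - MvPolynomial.eval y.1 p‖ < ε := by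
  rw [PA, ← SetLike.mem_coe, Subalgebra.topologicalClosure_coe, Metric.mem_closure_iff]
  refine forall₂_congr fun ε hε => ?_
  constructor
  · rintro ⟨_, ⟨p, rfl⟩, hp⟩
    refine ⟨p, fun y => ?_⟩
    rw [dist_eq_norm] at hp
    rw [← evP_apply]
    exact (ContinuousMap.norm_coe_le_norm (f - evP Y p) y).trans_lt hp
  · rintro ⟨p, hp⟩
    refine ⟨evP Y p, ⟨p, rfl⟩, ?_⟩
    rw [dist_eq_norm, ContinuousMap.norm_lt_iff _ hε]
    intro y
    have := hp y
    rw [← evP_apply] at this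
    exact this

instance {m : ℕ} (Y : Set (Fin m → ℂ)) [CompactSpace Y] : CompleteSpace (PA Y) := by
  have : IsClosed (PA Y : Set C(Y, ℂ)) := Subalgebra.isClosed_topologicalClosure _
  exact this.completeSpace_coe

noncomputable def evA {m : ℕ} (Y : Set (Fin m → ℂ)) [CompactSpace Y] (p : MvPolynomial (Fin m) ℂ) : PA Y :=
  ⟨evP Y p, Subalgebra.le_topologicalClosure _ ⟨p, rfl⟩⟩

theorem evA_apply {m : ℕ} (Y : Set (Fin m → ℂ)) [CompactSpace Y] (p : MvPolynomial (Fin m) ℂ) (y : Y) :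
    (evA Y p).1 y = MvPolynomial.eval y.1 p := evP_apply Y p y

theorem char_PA {m : ℕ} {Y : Set (Fin m → ℂ)} (hY : IsCompact Y) [CompactSpace Y] (hh : polyHull Y ⊆ Y)
    (L : PA Y →ₐ[ℂ] ℂ) : ∃ y : Y, ∀ b : PA Y, L b = b.1 y := by
  have hL : ∀ b : PA Y, ‖L b‖ ≤ ‖b‖ := by
    intro b
    refine (AlgHom.norm_apply_le_self_mul_norm_one L b).trans ?_
    have : ‖(1 : PA Y)‖ ≤ 1 := by
      change ‖(1 : C(Y, ℂ))‖ ≤ 1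
      rw [ContinuousMap.norm_le _ zero_le_one]; intro x; simp
    exact mul_le_of_le_one_right (norm_nonneg _) this
  set y : Fin m → ℂ := fun i => L (evA Y (MvPolynomial.X i)) with hy
  have hev : ∀ p, L (evA Y p) = MvPolynomial.eval y p := by
    intro p
    induction p using MvPolynomial.induction_on with
    | C a =>
      have : evA Y (MvPolynomial.C a) = algebraMap ℂ (PA Y) a := by
        apply Subtype.ext; ext x; rw [evA_apply]; simp
      rw [this, AlgHom.commutes]; simp
    | add p q hp hq =>
      have : evA Y (p + q) = evA Y p + evA Y q := Subtype.ext (map_add (evP Y) p q)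
      rw [this, map_add, hp, hq, map_add]
    | mul_X p i hp =>
      have : evA Y (p * MvPolynomial.X i) = evA Y p * evA Y (MvPolynomial.X i) :=
        Subtype.ext (map_mul (evP Y) _ _)
      rw [this, map_mul, hp, map_mul, MvPolynomial.eval_X]
  have hyY : y ∈ Y := hh <| hull_of hY fun p C hC h => by
    rw [← hev]
    refine (hL _).trans ?_
    change ‖evP Y p‖ ≤ C
    rw [ContinuousMap.norm_le _ hC]
    intro x; rw [evP_apply]; exact h x.1 x.2
  refine ⟨⟨y, hyY⟩, fun b => ?_⟩
  have key : ∀ ε > 0, ‖L b - b.1 ⟨y, hyY⟩‖ ≤ ε := by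
    intro ε hε
    obtain ⟨p, hp⟩ := mem_PA.1 b.2 (ε / 2) (half_pos hε)
    have h1 : ‖L b - L (evA Y p)‖ ≤ ε / 2 := by
      rw [← map_sub]
      refine (hL _).trans ?_
      change ‖b.1 - evP Y p‖ ≤ ε / 2
      rw [ContinuousMap.norm_le _ (by linarith)]
      intro x
      have := (hp x).le
      rw [← evP_apply] at this; exact this
    have h2 := (hp ⟨y, hyY⟩).le
    rw [hev] at h1
    calc ‖L b - b.1 ⟨y, hyY⟩‖ = ‖(L b - MvPolynomial.eval y p) - (b.1 ⟨y, hyY⟩ - MvPolynomial.eval y p)‖ := by congr 1; ring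
      _ ≤ ε / 2 + ε / 2 := (norm_sub_le _ _).trans (add_le_add h1 h2)
      _ = ε := by ring
  exact sub_eq_zero.1 (norm_le_zero_iff.1 (le_of_forall_gt_imp_ge_of_dense key))

/-- characters of the quotient -/
theorem char_QA {m : ℕ} {Y : Set (Fin m → ℂ)} (hY : IsCompact Y) [CompactSpace Y] (hh : polyHull Y ⊆ Y)
    (P : PA Y) (T : Set ℂ) [CompactSpace T] (L : WeakDual.characterSpace ℂ (QA P T)) :
    ∃ y : Y, P.1 y ∈ T ∧ ∀ b : PA Y, L (qm P T b) = b.1 y := by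
  obtain ⟨y, hy⟩ := char_PA hY hh ((WeakDual.CharacterSpace.toAlgHom L).comp (qm P T))
  refine ⟨y, ?_, fun b => hy b⟩
  rw [← hy P]; exact q_char P T L

theorem core2 {m : ℕ} {Y : Set (Fin m → ℂ)} (hY : IsCompact Y) (hh : polyHull Y ⊆ Y)
    (P b : MvPolynomial (Fin m) ℂ) {r1 r2 : ℝ} (h1 : 0 < r1) (h2 : r1 < r2)
    (H : ∀ y ∈ Y, r1 ≤ ‖MvPolynomial.eval y P‖ → ‖MvPolynomial.eval y P‖ ≤ r2 → ‖MvPolynomial.eval y b‖ < 1)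
    {ε : ℝ} (hε : 0 < ε) :
    ∃ k0, ∀ k ≥ k0, ∃ q : MvPolynomial (Fin m) ℂ, ∀ y ∈ Y,
      ‖(kap r1 r2 (MvPolynomial.eval y P) : ℂ) * MvPolynomial.eval y b ^ k - MvPolynomial.eval y q‖ < ε := by
  haveI : CompactSpace Y := isCompact_iff_compactSpace.1 hY
  have hS : IsCompact (Y ∩ (fun y => MvPolynomial.eval y P) ⁻¹' Ann r1 r2) :=
    hY.inter_right ((Ann_compact r1 r2).isClosed.preimage (MvPolynomial.continuous_eval P))
  obtain ⟨r, hr0, hr1, hr⟩ : ∃ r : ℝ, 0 < r ∧ r < 1 ∧ ∀ y ∈ Y, MvPolynomial.eval y P ∈ Ann r1 r2 →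
      ‖MvPolynomial.eval y b‖ < r := by
    rcases (Y ∩ (fun y => MvPolynomial.eval y P) ⁻¹' Ann r1 r2).eq_empty_or_nonempty with he | hne
    · refine ⟨1 / 2, by norm_num, by norm_num, fun y hy hy2 => ?_⟩
      have : y ∈ Y ∩ (fun y => MvPolynomial.eval y P) ⁻¹' Ann r1 r2 := ⟨hy, hy2⟩
      rw [he] at this; exact this.elim
    · obtain ⟨y0, hy0, hm⟩ := hS.exists_isMaxOn hne (MvPolynomial.continuous_eval b).norm.continuousOn
      have h3 := H y0 hy0.1 hy0.2.1 hy0.2.2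
      refine ⟨(‖MvPolynomial.eval y0 b‖ + 1) / 2, by positivity, by linarith, fun y hy hy2 => ?_⟩
      have : ‖MvPolynomial.eval y b‖ ≤ ‖MvPolynomial.eval y0 b‖ := hm ⟨hy, hy2⟩
      linarith
  obtain ⟨C, hC, hcore⟩ := core1 (PA Y) h1 h2 (evA Y P)
  obtain ⟨M, hM, hMk⟩ := pow_bound (qm (evA Y P) (Ann r1 r2) (evA Y b)) hr0 (by
    intro L
    obtain ⟨y, hy, hy2⟩ := char_QA hY hh (evA Y P) (Ann r1 r2) L
    rw [hy2, evA_apply]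
    rw [evA_apply] at hy
    exact hr y.1 y.2 hy)
  have ht : Filter.Tendsto (fun k : ℕ => M * r ^ k) Filter.atTop (nhds 0) := by
    simpa using (tendsto_pow_atTop_nhds_zero_of_lt_one hr0.le hr1).const_mul M
  obtain ⟨k0, hk0⟩ := Filter.eventually_atTop.1 (ht.eventually (gt_mem_nhds (show 0 < ε / (2 * C) by positivity)))
  refine ⟨k0, fun k hk => ?_⟩
  obtain ⟨Φ, hΦ⟩ := hcore ((evA Y b) ^ k) (ε / (2 * C)) (by
    rw [map_pow]; exact (hMk k).trans_lt (hk0 k hk))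
  obtain ⟨q, hq⟩ := mem_PA.1 Φ.2 (ε / 2) (half_pos hε)
  refine ⟨q, fun y hy => ?_⟩
  have h5 := hΦ ⟨y, hy⟩
  have h6 := hq ⟨y, hy⟩
  rw [show C * (ε / (2 * C)) = ε / 2 by field_simp] at h5
  have h7 : ((evA Y b) ^ k : PA Y).1 ⟨y, hy⟩ = MvPolynomial.eval y b ^ k := by
    rw [SubmonoidClass.coe_pow, ContinuousMap.pow_apply, evA_apply]
  rw [h7, evA_apply] at h5
  calc _ = ‖((kap r1 r2 (MvPolynomial.eval y P) : ℂ) * MvPolynomial.eval y b ^ k - Φ.1 ⟨y, hy⟩) + (Φ.1 ⟨y, hy⟩ - MvPolynomial.eval y q)‖ := by congr 1; ring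
    _ ≤ _ := norm_add_le _ _
    _ < ε := by linarith

theorem pos_lb {m : ℕ} {S : Set (Fin m → ℂ)} (hS : IsCompact S) {g : (Fin m → ℂ) → ℝ}
    (hg : Continuous g) (h : ∀ x ∈ S, 0 < g x) : ∃ δ > 0, ∀ x ∈ S, δ ≤ g x := 
  hS.exists_forall_le' hg.continuousOn h

theorem slice_hull {m : ℕ} {Y : Set (Fin m → ℂ)} (hY : IsCompact Y) (hh : polyHull Y ⊆ Y)
    (P : MvPolynomial (Fin m) ℂ) :
    IsCompact (Y ∩ {x | MvPolynomial.eval x P = 0}) ∧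
    polyHull (Y ∩ {x | MvPolynomial.eval x P = 0}) ⊆ Y ∩ {x | MvPolynomial.eval x P = 0} := by
  refine ⟨hY.inter_right (isClosed_eq (MvPolynomial.continuous_eval P) continuous_const), fun z hz => ⟨?_, ?_⟩⟩
  · apply hh
    exact hull_of hY fun p C hC h => hull_le hz p hC fun w hw => h w hw.1
  · have := hull_le hz P le_rfl (fun w hw => by rw [hw.2]; simp)
    simpa using this

theorem iso_step {m : ℕ} {Y : Set (Fin m → ℂ)} (hY : IsCompact Y) (hh : polyHull Y ⊆ Y)
    {y : Fin m → ℂ} {d : ℝ} (hd : 0 < d) (hiso : ∀ x ∈ Y, x ≠ y → d ≤ dist x y)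
    (P : MvPolynomial (Fin m) ℂ) (hP : MvPolynomial.eval y P = 0)
    (a : MvPolynomial (Fin m) ℂ) (ha : MvPolynomial.eval y a = 1)
    (ha2 : ∀ x ∈ Y, MvPolynomial.eval x P = 0 → x ≠ y → ‖MvPolynomial.eval x a‖ < 1 / 4)
    (hy : y ∈ Y) {ε : ℝ} (hε : 0 < ε) :
    ∃ b : MvPolynomial (Fin m) ℂ, MvPolynomial.eval y b = 1 ∧
      ∀ x ∈ Y, x ≠ y → ‖MvPolynomial.eval x b‖ < ε := by
  set S := Y ∩ {x | d ≤ dist x y} ∩ {x | 1 / 2 ≤ ‖MvPolynomial.eval x a‖} with hS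
  have hSc : IsCompact S := (hY.inter_right (isClosed_le continuous_const (by fun_prop))).inter_right
    (isClosed_le continuous_const (MvPolynomial.continuous_eval a).norm)
  obtain ⟨δ, hδ, hδ2⟩ := pos_lb hSc (MvPolynomial.continuous_eval P).norm (by
    rintro x ⟨⟨hx, hx2⟩, hx3⟩
    rw [norm_pos_iff]; intro h0
    have hx2 : d ≤ dist x y := hx2
    have := ha2 x hx h0 (by rintro rfl; simp at hx2; linarith)
    have hx3 : 1 / 2 ≤ ‖MvPolynomial.eval x a‖ := hx3
    linarith)
  have hsmall : ∀ x ∈ Y, x ≠ y → ‖MvPolynomial.eval x P‖ ≤ δ / 2 → ‖MvPolynomial.eval x a‖ < 1 / 2 := by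
    intro x hx hxy hxP
    by_contra hc
    have := hδ2 x ⟨⟨hx, hiso x hx hxy⟩, not_lt.1 hc⟩
    linarith
  set e := min (1 / 2) (ε / 8) with he
  have he0 : 0 < e := by positivity
  have he1 : e ≤ 1 / 2 := min_le_left _ _
  have he2 : e ≤ ε / 8 := min_le_right _ _
  obtain ⟨k0, hk0⟩ := core2 hY hh P a (r1 := δ / 4) (r2 := δ / 2) (by linarith) (by linarith) (by
    intro x hx h1 h2
    have : x ≠ y := by rintro rfl; rw [hP] at h1; simp at h1; linarith
    linarith [hsmall x hx this h2]) he0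
  obtain ⟨k1, hk1⟩ := exists_pow_lt_of_lt_one he0 (show (1 / 2 : ℝ) < 1 by norm_num)
  obtain ⟨q, hq⟩ := hk0 (max k0 k1) (le_max_left _ _)
  have hqy := hq y hy
  rw [hP, ha, one_pow, kap_one (by linarith) (by simp; linarith)] at hqy
  simp only [Complex.ofReal_one, mul_one] at hqy
  have hqn : 1 / 2 ≤ ‖MvPolynomial.eval y q‖ := by
    have h1 := norm_sub_norm_le (1:ℂ) (1 - MvPolynomial.eval y q)
    rw [sub_sub_cancel, norm_one] at h1; linarith
  have hqn0 : MvPolynomial.eval y q ≠ 0 := by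
    intro h; rw [h] at hqn; simp at hqn; linarith
  refine ⟨MvPolynomial.C (MvPolynomial.eval y q)⁻¹ * q, by simp [hqn0], fun x hx hxy => ?_⟩
  have hx1 := hq x hx
  have hx2 : ‖(kap (δ / 4) (δ / 2) (MvPolynomial.eval x P) : ℂ) * MvPolynomial.eval x a ^ max k0 k1‖ < e := by
    rcases le_total (δ / 2) ‖MvPolynomial.eval x P‖ with h | h
    · rw [kap_zero h]; simpa using he0
    · rw [norm_mul, norm_pow, Complex.norm_real, Real.norm_of_nonneg (kap_nonneg (by linarith) _)]
      calc _ ≤ 1 * (1 / 2 : ℝ) ^ max k0 k1 := by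
            gcongr
            · exact kap_le_one (by linarith) _
            · exact (hsmall x hx hxy h).le
        _ ≤ (1 / 2 : ℝ) ^ k1 := by
            rw [one_mul]; exact pow_le_pow_of_le_one (by norm_num) (by norm_num) (le_max_right _ _)
        _ < e := hk1
  have hx3 : ‖MvPolynomial.eval x q‖ < 2 * e := by
    have := norm_sub_norm_le (MvPolynomial.eval x q) ((kap (δ / 4) (δ / 2) (MvPolynomial.eval x P) : ℂ) * MvPolynomial.eval x a ^ max k0 k1)
    rw [norm_sub_rev] at this
    linarith
  rw [map_mul, MvPolynomial.eval_C, norm_mul, norm_inv]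
  have : ‖MvPolynomial.eval y q‖⁻¹ ≤ 2 := by
    rw [inv_le_comm₀ (by linarith) (by norm_num)]; linarith
  calc _ ≤ 2 * (2 * e) := by gcongr
    _ < ε := by linarith

theorem iso_lemma {m : ℕ} {Y : Set (Fin m → ℂ)} (hY : IsCompact Y) (hh : polyHull Y ⊆ Y)
    {y : Fin m → ℂ} (hy : y ∈ Y) {d : ℝ} (hd : 0 < d) (hiso : ∀ x ∈ Y, x ≠ y → d ≤ dist x y)
    {ε : ℝ} (hε : 0 < ε) :
    ∃ b : MvPolynomial (Fin m) ℂ, MvPolynomial.eval y b = 1 ∧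
      ∀ x ∈ Y, x ≠ y → ‖MvPolynomial.eval x b‖ < ε := by
  have key : ∀ s : Finset (Fin m), ∀ Y : Set (Fin m → ℂ), IsCompact Y → polyHull Y ⊆ Y → y ∈ Y →
      (∀ x ∈ Y, x ≠ y → d ≤ dist x y) → (∀ i ∉ s, ∀ x ∈ Y, x i = y i) → ∀ ε : ℝ, 0 < ε →
      ∃ b : MvPolynomial (Fin m) ℂ, MvPolynomial.eval y b = 1 ∧
      ∀ x ∈ Y, x ≠ y → ‖MvPolynomial.eval x b‖ < ε := by
    intro s
    induction s using Finset.induction_on with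
    | empty =>
      intro Y hY hh hy hiso hs ε hε
      refine ⟨1, by simp, fun x hx hxy => ?_⟩
      exact (hxy (funext fun i => hs i (by simp) x hx)).elim
    | insert k s hk ih =>
      intro Y hY hh hy hiso hs ε hε
      set P : MvPolynomial (Fin m) ℂ := MvPolynomial.X k - MvPolynomial.C (y k) with hP
      have hPy : ∀ x, MvPolynomial.eval x P = x k - y k := by intro x; simp [hP]
      obtain ⟨hc, hhc⟩ := slice_hull hY hh P
      obtain ⟨a, ha, ha2⟩ := ih (Y ∩ {x | MvPolynomial.eval x P = 0}) hc hhc ⟨hy, by simp [hPy]⟩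
        (fun x hx => hiso x hx.1) (fun i hi x hx => by
          by_cases hik : i = k
          · subst hik
            have := hx.2; simp only [Set.mem_setOf_eq, hPy] at this
            exact sub_eq_zero.1 this
          · exact hs i (by simp [hi, hik]) x hx.1) (1 / 4) (by norm_num)
      exact iso_step hY hh hd hiso P (by simp [hPy]) a ha (fun x hx h0 hxy => ha2 x ⟨hx, h0⟩ hxy) hy hε
  exact key Finset.univ Y hY hh hy hiso (by simp) ε hε

theorem sum_sq_ge {m : ℕ} (x : Fin m → ℂ) : ‖x‖ ^ 2 ≤ ∑ i, ‖x i‖ ^ 2 := by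
  have h0 : 0 ≤ ∑ i, ‖x i‖ ^ 2 := Finset.sum_nonneg fun i _ => by positivity
  rw [← Real.sqrt_le_sqrt_iff h0, Real.sqrt_sq (norm_nonneg _), pi_norm_le_iff_of_nonneg (Real.sqrt_nonneg _)]
  intro i
  apply Real.le_sqrt_of_sq_le
  exact Finset.single_le_sum (f := fun i => ‖x i‖ ^ 2) (fun i _ => by positivity) (Finset.mem_univ i)

theorem sq_expand (a b : ℂ) : ‖a‖ ^ 2 - ‖b‖ ^ 2 = ‖a - b‖ ^ 2 + 2 * (starRingEnd ℂ b * (a - b)).re := by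
  simp only [← Complex.normSq_eq_norm_sq, Complex.normSq_apply]
  simp; ring

theorem pert {m : ℕ} {Y : Set (Fin m → ℂ)} (hY : IsCompact Y) {y : Fin m → ℂ} (hy : y ∈ Y) {ρ : ℝ}
    (hρ : 0 < ρ) (Q0 : MvPolynomial (Fin m) ℂ)
    (hQ : ∀ x ∈ Y, dist x y = ρ → (MvPolynomial.eval x Q0).re < (MvPolynomial.eval y Q0).re) :
    ∃ y' ∈ Y, dist y' y < ρ ∧ ∃ ε > 0, ∃ Q : MvPolynomial (Fin m) ℂ, MvPolynomial.eval y' Q = 0 ∧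
      ∀ x ∈ Y, dist x y ≤ ρ → (MvPolynomial.eval x Q).re ≤ -ε * dist x y' ^ 2 := by
  set E : (Fin m → ℂ) → ℝ := fun x => ∑ i, ‖x i‖ ^ 2 with hE
  have hEc : Continuous E := by fun_prop
  have hE0 : ∀ x, 0 ≤ E x := fun x => Finset.sum_nonneg fun i _ => by positivity
  have hQc := MvPolynomial.continuous_eval (X := ℂ) Q0
  have hQc2 : Continuous fun x => (MvPolynomial.eval x Q0).re := Complex.continuous_re.comp hQc
  obtain ⟨δ, hδ, hδ2⟩ := pos_lb (S := Y ∩ sphere y ρ) (hY.inter_right isClosed_sphere)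
    (g := fun x => (MvPolynomial.eval y Q0).re - (MvPolynomial.eval x Q0).re) (by fun_prop)
    (fun x hx => sub_pos.2 (hQ x hx.1 hx.2))
  have hSc : IsCompact (Y ∩ closedBall y ρ) := hY.inter_right isClosed_closedBall
  obtain ⟨R, hR⟩ := (hSc.image hEc).bddAbove
  set R' := max R 0 + 1
  have hR' : 0 < R' := by positivity
  set ε := δ / (2 * R') with hεd
  have hε : 0 < ε := by positivity
  obtain ⟨y', hy', hmax⟩ := hSc.exists_isMaxOn ⟨y, hy, by simp [hρ.le]⟩
    (f := fun x => (MvPolynomial.eval x Q0).re + ε * E x) (by fun_prop)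
  have hlt : dist y' y < ρ := by
    refine lt_of_le_of_ne hy'.2 fun heq => ?_
    have h1 := hδ2 y' ⟨hy'.1, heq⟩
    have h2 : (MvPolynomial.eval y Q0).re + ε * E y ≤ (MvPolynomial.eval y' Q0).re + ε * E y' :=
      hmax ⟨hy, by simp [hρ.le]⟩
    have h3 : E y' ≤ R' := by
      have := hR ⟨y', hy', rfl⟩
      have := le_max_left R 0
      simp only [R']; linarith
    have h4 : ε * E y' ≤ δ / 2 := by
      calc ε * E y' ≤ ε * R' := by gcongr
        _ = δ / 2 := by rw [hεd]; field_simp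
    have := mul_nonneg hε.le (hE0 y)
    linarith
  refine ⟨y', hy'.1, hlt, ε, hε, Q0 - MvPolynomial.C (MvPolynomial.eval y' Q0) +
    MvPolynomial.C (2 * ε : ℂ) * ∑ i, MvPolynomial.C (starRingEnd ℂ (y' i)) * (MvPolynomial.X i - MvPolynomial.C (y' i)), ?_, ?_⟩
  · simp
  · intro x hx hxy
    have h1 : (MvPolynomial.eval x Q0).re + ε * E x ≤ (MvPolynomial.eval y' Q0).re + ε * E y' :=
      hmax ⟨hx, hxy⟩
    have h2 : E x - E y' = ∑ i, ‖x i - y' i‖ ^ 2 + 2 * (∑ i, starRingEnd ℂ (y' i) * (x i - y' i)).re := by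
      rw [hE]; simp only []
      rw [← Finset.sum_sub_distrib, Complex.re_sum, Finset.mul_sum, ← Finset.sum_add_distrib]
      exact Finset.sum_congr rfl fun i _ => sq_expand _ _
    have h3 := sum_sq_ge (x - y')
    simp only [Pi.sub_apply] at h3
    rw [dist_eq_norm]
    have h4 : (MvPolynomial.eval x (Q0 - MvPolynomial.C (MvPolynomial.eval y' Q0) +
      MvPolynomial.C (2 * ε : ℂ) * ∑ i, MvPolynomial.C (starRingEnd ℂ (y' i)) * (MvPolynomial.X i - MvPolynomial.C (y' i)))).re = (MvPolynomial.eval x Q0).re - (MvPolynomial.eval y' Q0).re + 2 * ε * (∑ i, starRingEnd ℂ (y' i) * (x i - y' i)).re := by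
      simp only [map_add, map_sub, map_mul, map_sum, MvPolynomial.eval_C, MvPolynomial.eval_X, Complex.add_re, Complex.sub_re]
      congr 1
      rw [show (2 * ε : ℂ) = ((2 * ε : ℝ) : ℂ) by push_cast; ring, Complex.re_ofReal_mul]
    rw [h4]
    have h5 : ε * ‖x - y'‖ ^ 2 ≤ ε * ∑ i, ‖x i - y' i‖ ^ 2 := by gcongr
    have h6 : ε * (E x - E y') = ε * ∑ i, ‖x i - y' i‖ ^ 2 + 2 * ε * (∑ i, starRingEnd ℂ (y' i) * (x i - y' i)).re := by rw [h2]; ring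
    linarith

theorem poly_diff {m : ℕ} (p : MvPolynomial (Fin m) ℂ) :
    Differentiable ℂ (fun x : Fin m → ℂ => MvPolynomial.eval x p) := by
  induction p using MvPolynomial.induction_on with
  | C a => simp
  | add p q hp hq =>
    simp only [map_add]
    exact hp.add hq
  | mul_X p i hp =>
    simp only [map_mul, MvPolynomial.eval_X]
    exact hp.mul (by fun_prop)

theorem poly_lip {m : ℕ} (p : MvPolynomial (Fin m) ℂ) (y : Fin m → ℂ) :
    ∃ C > 0, ∃ d > 0, ∀ x, dist x y < d →
      ‖MvPolynomial.eval x p - MvPolynomial.eval y p‖ ≤ C * dist x y := by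
  obtain ⟨C, hC0, hC⟩ := ((poly_diff p).differentiableAt (x := y)).isBigO_sub.exists_pos
  obtain ⟨d, hd, hd2⟩ := Metric.eventually_nhds_iff.1 hC.bound
  exact ⟨C, hC0, d, hd, fun x hx => by simpa [dist_eq_norm] using hd2 hx⟩

theorem peak {m : ℕ} {Y : Set (Fin m → ℂ)} (hY : IsCompact Y) (hh : polyHull Y ⊆ Y)
    {y : Fin m → ℂ} (hy : y ∈ Y) {d1 ε : ℝ} (hd1 : 0 < d1) (hε : 0 < ε)
    (Q : MvPolynomial (Fin m) ℂ) (hQy : MvPolynomial.eval y Q = 0)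
    (hQ : ∀ x ∈ Y, dist x y ≤ d1 → (MvPolynomial.eval x Q).re ≤ -ε * dist x y ^ 2)
    {d0 η : ℝ} (hd0 : 0 < d0) (hη : 0 < η) :
    ∃ Φ : MvPolynomial (Fin m) ℂ, ‖MvPolynomial.eval y Φ - 1‖ < η ∧
      ∀ x ∈ Y, d0 ≤ dist x y → ‖MvPolynomial.eval x Φ‖ < η := by
  obtain ⟨hc, hhc⟩ := slice_hull hY hh Q
  obtain ⟨a, ha, ha2⟩ := iso_lemma hc hhc ⟨hy, hQy⟩ hd1 (by
    rintro x ⟨hx, hx0⟩ hxy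
    by_contra! hlt
    have h1 := hQ x hx hlt.le
    have hx0 : MvPolynomial.eval x Q = 0 := hx0
    rw [hx0] at h1
    have h2 : 0 < dist x y := dist_pos.2 hxy
    have : 0 < ε * dist x y ^ 2 := by positivity
    simp at h1; linarith) (show (0:ℝ) < 1 / 16 by norm_num)
  set a' := 1 - (1 - a) ^ 3 with ha'
  have ha'e : ∀ x, MvPolynomial.eval x a' = 1 - (1 - MvPolynomial.eval x a) ^ 3 := by intro x; simp [ha']
  have ha'2 : ∀ x ∈ Y, MvPolynomial.eval x Q = 0 → x ≠ y → ‖MvPolynomial.eval x a'‖ < 1 / 4 := by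
    intro x hx h0 hxy
    have h1 := ha2 x ⟨hx, h0⟩ hxy
    rw [ha'e, show 1 - (1 - MvPolynomial.eval x a) ^ 3 = MvPolynomial.eval x a * (3 - 3 * MvPolynomial.eval x a + MvPolynomial.eval x a ^ 2) by ring, norm_mul]
    have h2 : ‖3 - 3 * MvPolynomial.eval x a + MvPolynomial.eval x a ^ 2‖ ≤ 3 + 3 * (1/16) + (1/16) ^ 2 := by
      refine (norm_add_le _ _).trans (add_le_add ((norm_sub_le _ _).trans ?_) ?_)
      · rw [norm_mul]; norm_num; linarith
      · rw [norm_pow]; gcongr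
    calc _ ≤ (1/16) * (3 + 3 * (1/16) + (1/16) ^ 2 : ℝ) := by gcongr
      _ < 1/4 := by norm_num
  obtain ⟨C, hC, dC, hdC, hCl⟩ := poly_lip a y
  obtain ⟨L, hL, dL, hdL, hLl⟩ := poly_lip Q y
  obtain ⟨R, hR⟩ := hY.exists_bound_of_continuousOn (MvPolynomial.continuous_eval (X := ℂ) Q).continuousOn
  set R' := max R 0 + 1
  have hR' : 0 < R' := by positivity
  have hRR : ∀ x ∈ Y, ‖MvPolynomial.eval x Q‖ ≤ R' := fun x hx => (hR x hx).trans (by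
    have := le_max_left R 0; simp only [R']; linarith)
  set τ := min (ε / L ^ 2) (1 / R') with hτd
  have hτ : 0 < τ := by positivity
  have hτ1 : τ * L ^ 2 ≤ ε := by
    rw [← le_div_iff₀ (by positivity)]; exact min_le_left _ _
  have hτ2 : ∀ x ∈ Y, τ * ‖MvPolynomial.eval x Q‖ ≤ 1 := fun x hx => by
    calc _ ≤ 1 / R' * R' := by
          gcongr
          · exact min_le_right _ _
          · exact hRR x hx
      _ = 1 := by field_simp
  set d' := min (min d0 d1) (min (min dC dL) (τ * ε / (4 * C ^ 3))) with hd'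
  have hd'0 : 0 < d' := by positivity
  have hd'1 : d' ≤ d0 := (min_le_left _ _).trans (min_le_left _ _)
  have hd'2 : d' ≤ d1 := (min_le_left _ _).trans (min_le_right _ _)
  have hd'3 : d' ≤ dC := (min_le_right _ _).trans ((min_le_left _ _).trans (min_le_left _ _))
  have hd'4 : d' ≤ dL := (min_le_right _ _).trans ((min_le_left _ _).trans (min_le_right _ _))
  have hd'5 : d' ≤ τ * ε / (4 * C ^ 3) := (min_le_right _ _).trans (min_le_right _ _)
  set b := a' * (1 + MvPolynomial.C (τ : ℂ) * Q) with hb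
  have hbe : ∀ x, MvPolynomial.eval x b = MvPolynomial.eval x a' * (1 + τ * MvPolynomial.eval x Q) := by
    intro x; simp [hb]
  have hby : MvPolynomial.eval y b = 1 := by rw [hbe, ha'e, hQy, ha]; simp
  have near : ∀ x ∈ Y, x ≠ y → dist x y < d' → ‖MvPolynomial.eval x b‖ < 1 := by
    intro x hx hxy hxd
    have hD : 0 < dist x y := dist_pos.2 hxy
    set D := dist x y
    have h1 := hCl x (by linarith)
    have h2 := hLl x (by linarith)
    have h3 := hQ x hx (by linarith)
    rw [ha] at h1; rw [hQy, sub_zero] at h2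
    have h4 : ‖MvPolynomial.eval x a'‖ ≤ 1 + (C * D) ^ 3 := by
      rw [ha'e]
      refine (norm_sub_le _ _).trans ?_
      rw [norm_pow, norm_sub_rev, norm_one]; gcongr
    have h5 : ‖1 + τ * MvPolynomial.eval x Q‖ ≤ 1 - τ * ε * D ^ 2 / 2 := by
      have hv : τ * ε * D ^ 2 ≤ 1 := by
        have := hτ2 x hx
        have h6 : ε * D ^ 2 ≤ ‖MvPolynomial.eval x Q‖ := by
          have := Complex.abs_re_le_norm (MvPolynomial.eval x Q)
          have := neg_abs_le (MvPolynomial.eval x Q).re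
          linarith
        calc _ = τ * (ε * D ^ 2) := by ring
          _ ≤ τ * ‖MvPolynomial.eval x Q‖ := by gcongr
          _ ≤ 1 := this
      have hsq : ‖1 + τ * MvPolynomial.eval x Q‖ ^ 2 = 1 + 2 * τ * (MvPolynomial.eval x Q).re + τ ^ 2 * ‖MvPolynomial.eval x Q‖ ^ 2 := by
        rw [← Complex.normSq_eq_norm_sq, ← Complex.normSq_eq_norm_sq, Complex.normSq_apply, Complex.normSq_apply]
        simp; ring
      have h7 : ‖1 + τ * MvPolynomial.eval x Q‖ ^ 2 ≤ (1 - τ * ε * D ^ 2 / 2) ^ 2 := by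
        rw [hsq]
        have h8 : τ ^ 2 * ‖MvPolynomial.eval x Q‖ ^ 2 ≤ τ * ε * D ^ 2 := by
          calc _ ≤ τ ^ 2 * (L * D) ^ 2 := by gcongr
            _ = τ * (τ * L ^ 2) * D ^ 2 := by ring
            _ ≤ _ := by gcongr
        have h9 : 2 * τ * (MvPolynomial.eval x Q).re ≤ 2 * τ * (-ε * D ^ 2) := by gcongr
        nlinarith [sq_nonneg (τ * ε * D ^ 2)]
      exact le_of_sq_le_sq h7 (by linarith) 
    have h6 : (C * D) ^ 3 < τ * ε * D ^ 2 / 2 := by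
      have : C ^ 3 * D < τ * ε / 2 := by
        have : D < τ * ε / (4 * C ^ 3) := by linarith
        rw [lt_div_iff₀ (by positivity)] at this
        have : 0 < τ * ε := by positivity
        linarith
      calc (C * D) ^ 3 = (C ^ 3 * D) * D ^ 2 := by ring
        _ < (τ * ε / 2) * D ^ 2 := by gcongr
        _ = _ := by ring
    rw [hbe, norm_mul]
    calc _ ≤ (1 + (C * D) ^ 3) * (1 - τ * ε * D ^ 2 / 2) := by gcongr
      _ < 1 := by
        have : 0 < (C * D) ^ 3 := by positivity
        nlinarith [mul_pos this this]
  set S := Y ∩ {x | d' ≤ dist x y} ∩ {x | 1 / 4 ≤ ‖MvPolynomial.eval x a'‖} with hS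
  have hSc : IsCompact S := (hY.inter_right (isClosed_le continuous_const (by fun_prop))).inter_right
    (isClosed_le continuous_const (MvPolynomial.continuous_eval a').norm)
  obtain ⟨δ, hδ, hδ2⟩ := pos_lb hSc (MvPolynomial.continuous_eval Q).norm (by
    rintro x ⟨⟨hx, hx2⟩, hx3⟩
    rw [norm_pos_iff]; intro h0
    have hx2 : d' ≤ dist x y := hx2
    have := ha'2 x hx h0 (by rintro rfl; simp at hx2; linarith)
    have hx3 : 1 / 4 ≤ ‖MvPolynomial.eval x a'‖ := hx3
    linarith)
  have far : ∀ x ∈ Y, d' ≤ dist x y → ‖MvPolynomial.eval x Q‖ ≤ δ / 2 → ‖MvPolynomial.eval x b‖ ≤ 1 / 2 := by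
    intro x hx hxd hxQ
    have h1 : ‖MvPolynomial.eval x a'‖ < 1 / 4 := by
      by_contra hcon
      have := hδ2 x ⟨⟨hx, hxd⟩, not_lt.1 hcon⟩
      linarith
    have h2 : ‖1 + τ * MvPolynomial.eval x Q‖ ≤ 2 := by
      refine (norm_add_le _ _).trans ?_
      rw [norm_mul, Complex.norm_real, Real.norm_of_nonneg hτ.le, norm_one]
      linarith [hτ2 x hx]
    rw [hbe, norm_mul]
    calc _ ≤ (1/4 : ℝ) * 2 := by gcongr
      _ = _ := by norm_num
  obtain ⟨k0, hk0⟩ := core2 hY hh Q b (r1 := δ / 4) (r2 := δ / 2) (by linarith) (by linarith) (by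
    intro x hx h1 h2
    have hne : x ≠ y := by rintro rfl; rw [hQy] at h1; simp at h1; linarith
    rcases lt_or_ge (dist x y) d' with h | h
    · exact near x hx hne h
    · linarith [far x hx h h2]) (half_pos hη)
  obtain ⟨k1, hk1⟩ := exists_pow_lt_of_lt_one (half_pos hη) (show (1 / 2 : ℝ) < 1 by norm_num)
  obtain ⟨q, hq⟩ := hk0 (max k0 k1) (le_max_left _ _)
  refine ⟨q, ?_, fun x hx hxd => ?_⟩
  · have hqy := hq y hy
    rw [hQy, hby, one_pow, kap_one (by linarith) (by simp; linarith)] at hqy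
    simp only [Complex.ofReal_one, mul_one] at hqy
    rw [norm_sub_rev]; linarith
  · have hx1 := hq x hx
    have hx2 : ‖(kap (δ / 4) (δ / 2) (MvPolynomial.eval x Q) : ℂ) * MvPolynomial.eval x b ^ max k0 k1‖ < η / 2 := by
      rcases le_total (δ / 2) ‖MvPolynomial.eval x Q‖ with h | h
      · rw [kap_zero h]; simpa using half_pos hη
      · rw [norm_mul, norm_pow, Complex.norm_real, Real.norm_of_nonneg (kap_nonneg (by linarith) _)]
        calc _ ≤ 1 * (1 / 2 : ℝ) ^ max k0 k1 := by
              gcongr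
              · exact kap_le_one (by linarith) _
              · exact far x hx (by linarith) h
          _ ≤ (1 / 2 : ℝ) ^ k1 := by
              rw [one_mul]; exact pow_le_pow_of_le_one (by norm_num) (by norm_num) (le_max_right _ _)
          _ < _ := hk1
    have := norm_sub_norm_le (MvPolynomial.eval x q) ((kap (δ / 4) (δ / 2) (MvPolynomial.eval x Q) : ℂ) * MvPolynomial.eval x b ^ max k0 k1)
    rw [norm_sub_rev] at this
    linarith

theorem LMP {m : ℕ} {X : Set (Fin m → ℂ)} (hX : IsCompact X) {y : Fin m → ℂ} (hy : y ∈ polyHull X)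
    {ρ : ℝ} (hρ : 0 < ρ) (hXy : ∀ x ∈ X, ρ < dist x y) (Q0 : MvPolynomial (Fin m) ℂ)
    (hQ : ∀ x ∈ polyHull X, dist x y = ρ → (MvPolynomial.eval x Q0).re < (MvPolynomial.eval y Q0).re) :
    False := by
  obtain ⟨y', hy', hd, ε, hε, Q, hQy, hQ2⟩ := pert (hull_compact hX) hy hρ Q0 hQ
  obtain ⟨Φ, h1, h2⟩ := peak (hull_compact hX) (hull_hull hX) hy' (d1 := ρ - dist y' y) (by linarith) hε Q hQy
    (fun x hx hxd => hQ2 x hx (by linarith [dist_triangle x y' y])) (d0 := ρ - dist y' y) (η := 1 / 4) (by linarith) (by norm_num)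
  have h3 := hull_le hy' Φ (show (0:ℝ) ≤ 1/4 by norm_num) fun w hw => (h2 w (subset_hull hX hw) (by
    linarith [hXy w hw, dist_triangle w y' y])).le
  have := norm_sub_norm_le (1:ℂ) (1 - MvPolynomial.eval y' Φ)
  rw [sub_sub_cancel, norm_one, norm_sub_rev] at this
  linarith

section holo
variable {E F : Type} [NormedAddCommGroup E] [NormedSpace ℂ E] [NormedAddCommGroup F] [NormedSpace ℂ F]

theorem line_deriv {f : E → F} {z v : E} {t : ℂ} (hf : DifferentiableAt ℂ f (z + t • v)) :
    HasDerivAt (fun ζ : ℂ => f (z + ζ • v)) (fderiv ℂ f (z + t • v) v) t := by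
  have h1 : HasDerivAt (fun ζ : ℂ => z + ζ • v) v t := by
    simpa using ((hasDerivAt_id t).smul_const v).const_add z
  exact hf.hasFDerivAt.comp_hasDerivAt t h1

theorem cauchy1 {f : E → F} {z : E} {R r M : ℝ} (hf : DifferentiableOn ℂ f (ball z R))
    (hM : ∀ w ∈ ball z R, ‖f w‖ ≤ M) (hr : 0 < r) (hrR : r < R) : ‖fderiv ℂ f z‖ ≤ M / r := by
  have hM0 : 0 ≤ M := (norm_nonneg _).trans (hM z (mem_ball_self (hr.trans hrR)))
  refine ContinuousLinearMap.opNorm_le_bound _ (by positivity) fun v => ?_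
  rcases eq_or_ne v 0 with rfl | hv
  · simp
  have hv : 0 < ‖v‖ := norm_pos_iff.2 hv
  have hin : ∀ ζ : ℂ, ‖ζ‖ ≤ r / ‖v‖ → z + ζ • v ∈ ball z R := by
    intro ζ hζ
    rw [mem_ball, dist_eq_norm, add_sub_cancel_left, norm_smul]
    rw [le_div_iff₀ hv] at hζ; linarith
  have hd : ∀ ζ : ℂ, ‖ζ‖ ≤ r / ‖v‖ → HasDerivAt (fun ζ : ℂ => f (z + ζ • v)) (fderiv ℂ f (z + ζ • v) v) ζ :=
    fun ζ hζ => line_deriv (hf.differentiableAt (isOpen_ball.mem_nhds (hin ζ hζ)))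
  have h0 := (hd 0 (by simp; positivity)).deriv
  have h1 := Complex.norm_deriv_le_of_forall_mem_sphere_norm_le (c := 0) (R := r / ‖v‖) (C := M)
    (f := fun ζ : ℂ => f (z + ζ • v)) (by positivity) (by
      apply DifferentiableOn.diffContOnCl
      intro ζ hζ
      exact (hd ζ (by simpa using closure_ball_subset_closedBall hζ)).differentiableAt.differentiableWithinAt)
    (fun ζ hζ => hM _ (hin ζ (by simpa using (mem_sphere_zero_iff_norm.1 hζ).le)))
  rw [h0] at h1
  simp only [zero_smul, add_zero] at h1
  refine h1.trans_eq ?_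
  field_simp

theorem bdd_ball {f : E → F} {U : Set E} (hU : IsOpen U) (hf : DifferentiableOn ℂ f U) {z : E} (hz : z ∈ U) :
    ∃ r > 0, ∃ M > 0, ball z (4 * r) ⊆ U ∧ (∀ w ∈ ball z (4 * r), ‖f w‖ ≤ M) ∧
      ∀ w ∈ ball z (2 * r), ‖fderiv ℂ f w‖ ≤ M / r := by
  obtain ⟨ε, hε, h1⟩ := Metric.isOpen_iff.1 hU z hz
  have hc : ContinuousAt f z := (hf.differentiableAt (hU.mem_nhds hz)).continuousAt
  have hc2 : ∀ᶠ w in nhds z, ‖f w‖ < ‖f z‖ + 1 := hc.norm.eventually_lt_const (by linarith)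
  obtain ⟨ε', hε', h2⟩ := Metric.eventually_nhds_iff.1 hc2
  have hb : ball z (4 * (min ε ε' / 4)) ⊆ U := fun w hw => h1 (by
    rw [mem_ball] at hw ⊢; linarith [min_le_left ε ε'])
  have hb2 : ∀ w ∈ ball z (4 * (min ε ε' / 4)), ‖f w‖ ≤ ‖f z‖ + 1 := fun w hw =>
    (h2 (by rw [mem_ball] at hw; linarith [min_le_right ε ε'])).le
  refine ⟨min ε ε' / 4, by positivity, ‖f z‖ + 1, by positivity, hb, hb2, fun w hw => ?_⟩
  have hsub : ball w (2 * (min ε ε' / 4)) ⊆ ball z (4 * (min ε ε' / 4)) := by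
    apply ball_subset_ball'; rw [mem_ball] at hw; linarith
  have : 0 < min ε ε' := by positivity
  exact cauchy1 (hf.mono (hsub.trans hb)) (fun u hu => hb2 u (hsub hu)) (by positivity) (by linarith)

theorem fderiv_cont {f : E → F} {U : Set E} (hU : IsOpen U) (hf : DifferentiableOn ℂ f U) :
    ContinuousOn (fderiv ℂ f) U := by
  intro z hz
  refine ContinuousAt.continuousWithinAt ?_
  obtain ⟨r, hr, M, hM, hb, -, hD⟩ := bdd_ball hU hf hz
  have key : ∀ w ∈ ball z (r / 2), ‖fderiv ℂ f w - fderiv ℂ f z‖ ≤ M / r * ‖w - z‖ / (r / 2) := by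
    intro w hw
    rw [mem_ball] at hw
    have hda : ∀ u ∈ ball z (4 * r), DifferentiableAt ℂ f u := fun u hu => hf.differentiableAt (hU.mem_nhds (hb hu))
    have htr : ∀ u ∈ ball z r, u + (w - z) ∈ ball z (2 * r) := by
      intro u hu
      rw [mem_ball, dist_eq_norm] at *
      calc ‖u + (w - z) - z‖ = ‖(u - z) + (w - z)‖ := by congr 1; abel
        _ ≤ ‖u - z‖ + ‖w - z‖ := norm_add_le _ _
        _ < _ := by linarith
    have hsub2 : ball z (2 * r) ⊆ ball z (4 * r) := ball_subset_ball (by linarith)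
    have hsub1 : ball z r ⊆ ball z (2 * r) := ball_subset_ball (by linarith)
    have hd1 : ∀ u ∈ ball z r, HasFDerivAt (fun u => f (u + (w - z)) - f u) (fderiv ℂ f (u + (w - z)) - fderiv ℂ f u) u := by
      intro u hu
      have h1 := (hda _ (hsub2 (htr u hu))).hasFDerivAt
      have h2 : HasFDerivAt (fun u => f (u + (w - z))) (fderiv ℂ f (u + (w - z))) u := by
        have := h1.comp u ((hasFDerivAt_id u).add_const (w - z))
        simpa using! this
      exact h2.sub (hda u (hsub2 (hsub1 hu))).hasFDerivAt
    have := cauchy1 (f := fun u => f (u + (w - z)) - f u) (z := z) (R := r) (r := r / 2) (M := M / r * ‖w - z‖)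
      (fun u hu => (hd1 u hu).differentiableAt.differentiableWithinAt) (fun u hu => by
        have := (convex_ball z (2 * r)).norm_image_sub_le_of_norm_fderiv_le (𝕜 := ℂ) (f := f) (fun x hx => hda x (hsub2 hx)) hD
          (hsub1 hu) (htr u hu)
        simpa using this) (by linarith) (by linarith)
    rw [(hd1 z (mem_ball_self hr)).fderiv] at this
    simpa using this
  have hlim : Filter.Tendsto (fun w => M / r * ‖w - z‖ / (r / 2)) (nhds z) (nhds 0) := by
    have : Continuous (fun w => M / r * ‖w - z‖ / (r / 2)) := by fun_prop
    simpa using this.tendsto z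
  rw [ContinuousAt, tendsto_iff_norm_sub_tendsto_zero]
  exact squeeze_zero' (Filter.Eventually.of_forall fun _ => norm_nonneg _)
    (Filter.eventually_of_mem (ball_mem_nhds z (by linarith)) key) hlim

variable [CompleteSpace F]

theorem fderiv_diff1 {f : E → F} {U : Set E} (hU : IsOpen U) (hf : DifferentiableOn ℂ f U) (v : E) :
    DifferentiableOn ℂ (fun z => fderiv ℂ f z v) U := by
  intro z hz
  refine DifferentiableAt.differentiableWithinAt ?_
  obtain ⟨r, hr, M, hM, hb, hbd, hD⟩ := bdd_ball hU hf hz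
  set s := r / (‖v‖ + 1) with hs
  have hv := norm_nonneg v
  have hs0 : 0 < s := by positivity
  have hsv : s * ‖v‖ < r := by
    rw [hs, div_mul_eq_mul_div, div_lt_iff₀ (by positivity)]; nlinarith
  have hda : ∀ u ∈ ball z (4 * r), DifferentiableAt ℂ f u := fun u hu => hf.differentiableAt (hU.mem_nhds (hb hu))
  have hsub2 : ball z (2 * r) ⊆ ball z (4 * r) := ball_subset_ball (by linarith)
  have hin : ∀ w ∈ ball z r, ∀ ζ : ℂ, ‖ζ‖ ≤ s → w + ζ • v ∈ ball z (2 * r) := by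
    intro w hw ζ hζ
    rw [mem_ball, dist_eq_norm] at *
    calc ‖w + ζ • v - z‖ = ‖(w - z) + ζ • v‖ := by congr 1; abel
      _ ≤ ‖w - z‖ + ‖ζ • v‖ := norm_add_le _ _
      _ < 2 * r := by
        rw [norm_smul]
        have : ‖ζ‖ * ‖v‖ ≤ s * ‖v‖ := by gcongr
        linarith
  have hcm : ∀ θ, ‖circleMap 0 s θ‖ ≤ s := fun θ => by simp [abs_of_pos hs0]
  set c : ℝ → ℂ := fun θ => deriv (circleMap 0 s) θ * ((circleMap 0 s θ - 0) ^ 2)⁻¹ with hc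
  have hcc : Continuous c := by
    have h1 : Continuous (deriv (circleMap 0 s)) := by
      have : deriv (circleMap 0 s) = fun θ => circleMap 0 s θ * Complex.I := by ext θ; simp
      rw [this]; fun_prop
    refine h1.mul (Continuous.inv₀ (by fun_prop) fun θ => ?_)
    rw [sub_zero]
    exact pow_ne_zero 2 (circleMap_ne_center hs0.ne')
  have hfc : ContinuousOn f (ball z (4 * r)) := fun u hu => (hda u hu).continuousAt.continuousWithinAt
  have hfc' : ContinuousOn (fderiv ℂ f) (ball z (4 * r)) := (fderiv_cont hU hf).mono hb
  have hpath : ∀ w : E, Continuous fun θ => w + circleMap 0 s θ • v := fun w => by fun_prop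
  have hcF : ∀ w ∈ ball z r, Continuous fun θ => c θ • f (w + circleMap 0 s θ • v) := fun w hw =>
    hcc.smul (hfc.comp_continuous (hpath w) fun θ => hsub2 (hin w hw _ (hcm θ)))
  have hcF' : ∀ w ∈ ball z r, Continuous fun θ => c θ • fderiv ℂ f (w + circleMap 0 s θ • v) := fun w hw =>
    hcc.smul (hfc'.comp_continuous (hpath w) fun θ => hsub2 (hin w hw _ (hcm θ)))
  have hform : ∀ w ∈ ball z r, fderiv ℂ f w v = (2 * Real.pi * Complex.I : ℂ)⁻¹ • ∫ θ in (0:ℝ)..2 * Real.pi,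
      c θ • f (w + circleMap 0 s θ • v) := by
    intro w hw
    have h1 := Complex.two_pi_I_inv_smul_circleIntegral_sub_sq_inv_smul_of_differentiable
      (U := {ζ : ℂ | w + ζ • v ∈ ball z (2 * r)}) (c := 0) (R := s) (w₀ := 0) (f := fun ζ : ℂ => f (w + ζ • v))
      (isOpen_ball.preimage (by fun_prop)) (fun ζ hζ => hin w hw ζ (by simpa using hζ))
      (fun ζ hζ => (line_deriv (hda _ (hsub2 hζ))).differentiableAt.differentiableWithinAt) (mem_ball_self hs0)
    have h2 := (line_deriv (t := 0) (v := v) (z := w) (f := f) (hda _ (hsub2 (hin w hw 0 (by simpa using hs0.le))))).deriv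
    rw [h2] at h1
    simp only [zero_smul, add_zero] at h1
    rw [← h1, circleIntegral]
    simp only [hc, smul_smul]
  have hmain : HasFDerivAt (fun w => ∫ θ in (0:ℝ)..2 * Real.pi, c θ • f (w + circleMap 0 s θ • v))
      (∫ θ in (0:ℝ)..2 * Real.pi, c θ • fderiv ℂ f (z + circleMap 0 s θ • v)) z := by
    refine intervalIntegral.hasFDerivAt_integral_of_dominated_of_fderiv_le (μ := MeasureTheory.volume)
      (F := fun w θ => c θ • f (w + circleMap 0 s θ • v)) (F' := fun w θ => c θ • fderiv ℂ f (w + circleMap 0 s θ • v))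
      (bound := fun θ => ‖c θ‖ * (M / r))
      (ball_mem_nhds z hr) ?_ ?_ ?_ ?_ ?_ ?_
    · exact Filter.eventually_of_mem (ball_mem_nhds z hr) fun w hw => (hcF w hw).aestronglyMeasurable
    · exact (hcF z (mem_ball_self hr)).intervalIntegrable _ _
    · exact (hcF' z (mem_ball_self hr)).aestronglyMeasurable
    · refine Filter.Eventually.of_forall fun θ _ w hw => ?_
      rw [norm_smul]
      gcongr
      exact hD _ (hin w hw _ (hcm θ))
    · exact (hcc.norm.mul continuous_const).intervalIntegrable _ _
    · refine Filter.Eventually.of_forall fun θ _ w hw => ?_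
      have h1 := (hda _ (hsub2 (hin w hw _ (hcm θ)))).hasFDerivAt
      have := (h1.comp w ((hasFDerivAt_id w).add_const (circleMap 0 s θ • v))).const_smul (c θ)
      simpa using! this
  refine (hmain.const_smul ((2 * Real.pi * Complex.I : ℂ)⁻¹)).differentiableAt.congr_of_eventuallyEq ?_
  exact Filter.eventually_of_mem (ball_mem_nhds z hr) hform

theorem C1_of_diff {F : Type} [NormedAddCommGroup F] [NormedSpace ℂ F] {f : E → F} {U : Set E} (hU : IsOpen U) (hf : DifferentiableOn ℂ f U) : ContDiffOn ℂ 1 f U := by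
  have h := (contDiffOn_succ_iff_fderiv_of_isOpen (𝕜 := ℂ) (f := f) (n := 0) hU).2 ⟨hf, by simp, contDiffOn_zero.2 (fderiv_cont hU hf)⟩
  simpa using h

theorem fderiv_diff [FiniteDimensional ℂ E] {f : E → F} {U : Set E} (hU : IsOpen U) (hf : DifferentiableOn ℂ f U) :
    DifferentiableOn ℂ (fderiv ℂ f) U :=
  (contDiffOn_clm_apply.2 fun v => C1_of_diff hU (fderiv_diff1 hU hf v)).differentiableOn (by norm_num)

end holo

section holo
variable {E : Type} [NormedAddCommGroup E] [NormedSpace ℂ E] [FiniteDimensional ℂ E]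

theorem contDiffOn_nat (k : ℕ) : ∀ {F : Type} [NormedAddCommGroup F] [NormedSpace ℂ F] [CompleteSpace F]
    {f : E → F} {U : Set E} (hU : IsOpen U) (hf : DifferentiableOn ℂ f U), ContDiffOn ℂ k f U := by
  induction k with
  | zero => intro F _ _ _ f U hU hf; exact contDiffOn_zero.2 hf.continuousOn
  | succ k ih =>
    intro F _ _ _ f U hU hf
    push_cast
    exact (contDiffOn_succ_iff_fderiv_of_isOpen (𝕜 := ℂ) (f := f) (n := k) hU).2 ⟨hf, by simp, ih hU (fderiv_diff hU hf)⟩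

variable {F : Type} [NormedAddCommGroup F] [NormedSpace ℂ F] [CompleteSpace F]

theorem smooth {f : E → F} {U : Set E} (hU : IsOpen U) (hf : DifferentiableOn ℂ f U) :
    ContDiffOn ℂ (⊤ : ℕ∞) f U := contDiffOn_infty.2 fun k => contDiffOn_nat k hU hf

theorem iter_diff {f : E → F} {U : Set E} (hU : IsOpen U) (hf : DifferentiableOn ℂ f U) (k : ℕ) :
    DifferentiableOn ℂ (iteratedFDeriv ℂ k f) U := by
  intro z hz
  have h := (contDiffOn_nat (k + 1) hU hf).contDiffAt (hU.mem_nhds hz)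
  exact (h.differentiableAt_iteratedFDeriv (by exact_mod_cast Nat.lt_succ_self k)).differentiableWithinAt

theorem iter_bound {f : E → F} {z : E} {R s M : ℝ} (hf : DifferentiableOn ℂ f (ball z R)) (hs : 0 < s)
    (hM : ∀ w ∈ ball z R, ‖f w‖ ≤ M) (k : ℕ) :
    ∀ w ∈ ball z (R - k * (2 * s)), ‖iteratedFDeriv ℂ k f w‖ ≤ M / s ^ k := by
  induction k with
  | zero => intro w hw; simpa using hM w (by simpa using hw)
  | succ k ih =>
    intro w hw
    rw [← norm_fderiv_iteratedFDeriv, pow_succ, ← div_div]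
    push_cast at hw
    have hsub : ball w (2 * s) ⊆ ball z (R - k * (2 * s)) := by
      apply ball_subset_ball'; rw [mem_ball] at hw; linarith
    have hsub2 : ball z (R - k * (2 * s)) ⊆ ball z R := ball_subset_ball (by
      have : 0 ≤ (k:ℝ) * (2 * s) := by positivity
      linarith)
    exact cauchy1 ((iter_diff isOpen_ball hf k).mono (hsub.trans hsub2)) (fun u hu => ih u (hsub hu)) hs (by linarith)

theorem iter_bound0 {f : E → F} {z : E} {R M : ℝ} (hf : DifferentiableOn ℂ f (ball z R)) (hR : 0 < R)
    (hM : ∀ w ∈ ball z R, ‖f w‖ ≤ M) (k : ℕ) : ‖iteratedFDeriv ℂ k f z‖ / k.factorial ≤ M * (4 * Real.exp 1 / R) ^ k := by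
  have hM0 : 0 ≤ M := (norm_nonneg _).trans (hM z (mem_ball_self hR))
  rcases Nat.eq_zero_or_pos k with rfl | hk
  · simpa using hM z (mem_ball_self hR)
  have hk' : (0:ℝ) < k := by exact_mod_cast hk
  have h1 := iter_bound hf (s := R / (4 * k)) (by positivity) hM k z (by
    rw [mem_ball, dist_self]; field_simp; norm_num; exact hR)
  have h2 := Real.pow_div_factorial_le_exp (x := (k:ℝ)) hk'.le k
  rw [div_pow, div_div_eq_mul_div] at h1
  calc _ ≤ (M * (4 * k) ^ k / R ^ k) / k.factorial := by gcongr
    _ = M * (4 / R) ^ k * ((k:ℝ) ^ k / k.factorial) := by rw [mul_pow, div_pow]; ring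
    _ ≤ M * (4 / R) ^ k * Real.exp k := by gcongr
    _ = _ := by
      rw [← Real.exp_one_pow, mul_assoc, ← mul_pow]; congr 2; ring

theorem iter_line {f : E → F} {U : Set E} (hU : IsOpen U) (hf : DifferentiableOn ℂ f U) (z v : E) (k : ℕ) :
    ∀ t : ℂ, z + t • v ∈ U → iteratedDeriv k (fun ζ : ℂ => f (z + ζ • v)) t = iteratedFDeriv ℂ k f (z + t • v) (fun _ => v) := by
  induction k with
  | zero => intro t _; simp
  | succ k ih =>
    intro t ht
    rw [iteratedDeriv_succ, iteratedFDeriv_succ_apply_left]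
    have hev : iteratedDeriv k (fun ζ : ℂ => f (z + ζ • v)) =ᶠ[nhds t] fun t => iteratedFDeriv ℂ k f (z + t • v) (fun _ => v) := by
      have : ∀ᶠ t' in nhds t, z + t' • v ∈ U :=
        (show Continuous fun t' : ℂ => z + t' • v by fun_prop).continuousAt.eventually_mem (hU.mem_nhds ht)
      filter_upwards [this] with t' ht'
      exact ih t' ht'
    rw [hev.deriv_eq]
    have h1 := line_deriv (f := iteratedFDeriv ℂ k f) ((iter_diff hU hf k).differentiableAt (hU.mem_nhds ht))
    have h2 := ((ContinuousMultilinearMap.apply ℂ (fun _ : Fin k => E) F (fun _ => v)).hasFDerivAt).comp_hasDerivAt t h1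
    exact h2.deriv

theorem taylor_sum {f : E → F} {z v : E} {R : ℝ} (hf : DifferentiableOn ℂ f (ball z R)) (hv : ‖v‖ < R) :
    HasSum (fun k : ℕ => (k.factorial : ℂ)⁻¹ • iteratedFDeriv ℂ k f z (fun _ => v)) (f (z + v)) := by
  have hR : 0 < R := (norm_nonneg v).trans_lt hv
  obtain ⟨ρ, h1, h2⟩ : ∃ ρ : ℝ, 1 < ρ ∧ ρ * ‖v‖ < R := by
    rcases eq_or_ne v 0 with rfl | hv0
    · exact ⟨2, by norm_num, by simpa using hR⟩
    · have hv0 : 0 < ‖v‖ := norm_pos_iff.2 hv0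
      obtain ⟨ρ, h1, h2⟩ := exists_between ((one_lt_div hv0).2 hv)
      exact ⟨ρ, h1, by rwa [lt_div_iff₀ hv0] at h2⟩
  have hin : ∀ t ∈ ball (0:ℂ) ρ, z + t • v ∈ ball z R := by
    intro t ht
    rw [mem_ball_zero_iff] at ht
    rw [mem_ball, dist_eq_norm, add_sub_cancel_left, norm_smul]
    calc ‖t‖ * ‖v‖ ≤ ρ * ‖v‖ := by gcongr
      _ < R := h2
  have := Complex.hasSum_taylorSeries_on_ball (f := fun ζ : ℂ => f (z + ζ • v)) (c := 0) (r := ρ) (z := 1)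
    (fun t ht => (line_deriv (hf.differentiableAt (isOpen_ball.mem_nhds (hin t ht)))).differentiableAt.differentiableWithinAt)
    (by simpa using h1)
  simp only [sub_zero, one_pow, one_smul] at this
  convert this using 3 with k
  rw [iter_line isOpen_ball hf z v k 0 (by simpa using hR)]; simp

/-- if all derivatives vanish at a point then f vanishes nearby -/
theorem zero_of_iter {f : E → F} {z : E} {R : ℝ} (hf : DifferentiableOn ℂ f (ball z R))
    (h : ∀ k, iteratedFDeriv ℂ k f z = 0) : ∀ w ∈ ball z R, f w = 0 := by
  intro w hw
  have := taylor_sum hf (v := w - z) (by rwa [mem_ball, dist_eq_norm] at hw)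
  simp only [h, add_sub_cancel] at this
  simpa using this.unique (by simpa using hasSum_zero)

end holo

/-- homogeneous Taylor polynomial -/
noncomputable def tayP {n : ℕ} (f : (Fin n → ℂ) → ℂ) (z : Fin n → ℂ) (k : ℕ) : MvPolynomial (Fin n) ℂ :=
  ∑ s : Fin k → Fin n, MvPolynomial.C ((k.factorial : ℂ)⁻¹ * iteratedFDeriv ℂ k f z (fun j => Pi.single (s j) 1)) *
    ∏ j, (MvPolynomial.X (s j) - MvPolynomial.C (z (s j)))

theorem tayP_eval {n : ℕ} (f : (Fin n → ℂ) → ℂ) (z : Fin n → ℂ) (k : ℕ) (v : Fin n → ℂ) :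
    MvPolynomial.eval (z + v) (tayP f z k) = (k.factorial : ℂ)⁻¹ * iteratedFDeriv ℂ k f z (fun _ => v) := by
  have hv : (fun _ : Fin k => v) = fun j => ∑ i : Fin n, v i • (Pi.single i (1:ℂ) : Fin n → ℂ) := by
    ext j i; simp [Pi.single_apply]
  rw [hv, ContinuousMultilinearMap.map_sum, Finset.mul_sum, tayP, map_sum]
  refine Finset.sum_congr rfl fun s _ => ?_
  rw [ContinuousMultilinearMap.map_smul_univ]
  simp [map_prod]
  ring

theorem tayP_coeff {n : ℕ} {f : (Fin n → ℂ) → ℂ} {z : Fin n → ℂ} {R M : ℝ}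
    (hf : DifferentiableOn ℂ f (ball z R)) (hR : 0 < R) (hM : ∀ w ∈ ball z R, ‖f w‖ ≤ M) (k : ℕ) (s : Fin k → Fin n) :
    ‖(k.factorial : ℂ)⁻¹ * iteratedFDeriv ℂ k f z (fun j => Pi.single (s j) 1)‖ ≤ M * (4 * Real.exp 1 / R) ^ k := by
  refine le_trans ?_ (iter_bound0 hf hR hM k)
  rw [norm_mul, norm_inv, Complex.norm_natCast, div_eq_inv_mul]
  gcongr
  refine (ContinuousMultilinearMap.le_opNorm _ _).trans ?_
  rw [Finset.prod_eq_one fun j _ => by rw [Pi.norm_single, norm_one], mul_one]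


theorem taylor_unif {n : ℕ} {f : (Fin n → ℂ) → ℂ} {z : Fin n → ℂ} {R M : ℝ}
    (hf : DifferentiableOn ℂ f (ball z R)) (hR : 0 < R) (hM : ∀ w ∈ ball z R, ‖f w‖ ≤ M) (K : ℕ) {w : Fin n → ℂ}
    (hw : dist w z ≤ R / (8 * Real.exp 1)) :
    ‖f w - MvPolynomial.eval w (∑ k ∈ Finset.range K, tayP f z k)‖ ≤ M * 2 * (1 / 2) ^ K := by
  have he : 1 < Real.exp 1 := by simp
  have hM0 : 0 ≤ M := (norm_nonneg _).trans (hM z (mem_ball_self hR))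
  have hlt : ‖w - z‖ < R := by
    rw [dist_eq_norm] at hw
    refine hw.trans_lt ?_
    rw [div_lt_iff₀ (by positivity)]; nlinarith
  have h1 := taylor_sum hf hlt
  rw [add_sub_cancel] at h1
  have hb : ∀ k, ‖(k.factorial : ℂ)⁻¹ • iteratedFDeriv ℂ k f z (fun _ => w - z)‖ ≤ M * (1 / 2) ^ k := by
    intro k
    rw [norm_smul, norm_inv, Complex.norm_natCast]
    calc _ ≤ (k.factorial : ℝ)⁻¹ * (‖iteratedFDeriv ℂ k f z‖ * (R / (8 * Real.exp 1)) ^ k) := by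
          gcongr
          refine (ContinuousMultilinearMap.le_opNorm _ _).trans ?_
          rw [Finset.prod_const, Finset.card_univ, Fintype.card_fin]
          rw [dist_eq_norm] at hw
          gcongr
      _ = (‖iteratedFDeriv ℂ k f z‖ / k.factorial) * (R / (8 * Real.exp 1)) ^ k := by ring
      _ ≤ M * (4 * Real.exp 1 / R) ^ k * (R / (8 * Real.exp 1)) ^ k := by gcongr; exact iter_bound0 hf hR hM k
      _ = M * (1 / 2) ^ k := by
        rw [mul_assoc, ← mul_pow]; congr 2; field_simp; norm_num
  have h2 := (hasSum_nat_add_iff' K).2 h1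
  have h3 : HasSum (fun k => M * (1 / 2 : ℝ) ^ (k + K)) (M * 2 * (1 / 2) ^ K) := by
    have := (hasSum_geometric_two).mul_left (M * (1 / 2 : ℝ) ^ K)
    rw [show M * 2 * (1 / 2) ^ K = M * (1 / 2 : ℝ) ^ K * 2 by ring]
    rw [show (fun k => M * (1 / 2 : ℝ) ^ (k + K)) = fun k => M * (1 / 2 : ℝ) ^ K * (1 / 2) ^ k from
      funext fun k => by rw [pow_add]; ring]
    exact this
  have h4 : MvPolynomial.eval w (∑ k ∈ Finset.range K, tayP f z k) = ∑ k ∈ Finset.range K, (k.factorial : ℂ)⁻¹ • iteratedFDeriv ℂ k f z (fun _ => w - z) := by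
    rw [map_sum]
    refine Finset.sum_congr rfl fun k _ => ?_
    have := tayP_eval f z k (w - z)
    rwa [add_sub_cancel] at this
  rw [h4, ← h2.tsum_eq]
  exact tsum_of_norm_bounded h3 fun k => hb (k + K)

theorem chart {E : Type} [NormedAddCommGroup E] [NormedSpace ℂ E] [FiniteDimensional ℂ E]
    {U : Set E} (hU : IsOpen U) {g : E → ℂ} (hg : DifferentiableOn ℂ g U) {z1 : E} (hz1 : z1 ∈ U)
    (hg0 : g z1 = 0) (hd : fderiv ℂ g z1 ≠ 0) :
    ∃ K : Submodule ℂ E, Module.finrank ℂ K + 1 = Module.finrank ℂ E ∧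
      ∃ (V : Set K) (W : Set E) (σ : K → E) (π : E → K), IsOpen V ∧ IsOpen W ∧ z1 ∈ W ∧ W ⊆ U ∧
        DifferentiableOn ℂ σ V ∧ Continuous π ∧ (∀ x ∈ V, σ x ∈ W ∧ g (σ x) = 0 ∧ π (σ x) = x) ∧
        (∀ z ∈ W, g z = 0 → π z ∈ V ∧ σ (π z) = z) := by
  haveI : CompleteSpace E := FiniteDimensional.complete ℂ E
  set L := fderiv ℂ g z1 with hL
  set K : Submodule ℂ E := LinearMap.ker (L : E →ₗ[ℂ] ℂ) with hK
  obtain ⟨u, hu⟩ : ∃ u, L u ≠ 0 := by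
    by_contra! hcon; exact hd (ContinuousLinearMap.ext hcon)
  have hfr : Module.finrank ℂ K + 1 = Module.finrank ℂ E := by
    have h1 := LinearMap.finrank_range_add_finrank_ker (L : E →ₗ[ℂ] ℂ)
    have h2 : LinearMap.range (L : E →ₗ[ℂ] ℂ) = ⊤ := by
      apply LinearMap.range_eq_top.2
      exact LinearMap.surjective (fun h => hu (by simpa using LinearMap.congr_fun h u))
    rw [h2, finrank_top, Module.finrank_self] at h1
    rw [add_comm]; exact h1
  obtain ⟨p, hp⟩ := Submodule.ClosedComplemented.of_finiteDimensional (𝕜 := ℂ) K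
  have hinj : Function.Injective (L.prod p) := by
    rw [injective_iff_map_eq_zero]
    intro x hx
    have h1 : L x = 0 := (Prod.ext_iff.1 hx).1
    have h2 : p x = 0 := (Prod.ext_iff.1 hx).2
    have h3 := hp ⟨x, h1⟩
    rw [h2] at h3
    exact (congrArg Subtype.val h3).symm
  have hfr2 : Module.finrank ℂ E = Module.finrank ℂ (ℂ × K) := by
    rw [Module.finrank_prod, Module.finrank_self]; omega
  set e : E ≃L[ℂ] ℂ × K := (LinearEquiv.ofInjectiveOfFinrankEq ((L.prod p : E →L[ℂ] ℂ × K) : E →ₗ[ℂ] ℂ × K) hinj hfr2).toContinuousLinearEquiv with he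
  have he2 : (e : E →L[ℂ] ℂ × K) = L.prod p := by ext x <;> rfl
  set Φ : E → ℂ × K := fun z => (g z, p (z - z1)) with hΦ
  have hΦd : ContDiffAt ℂ 1 Φ z1 := by
    refine ContDiffAt.prodMk ((C1_of_diff hU hg).contDiffAt (hU.mem_nhds hz1)) ?_
    exact p.contDiff.contDiffAt.comp z1 (contDiffAt_id.sub contDiffAt_const)
  have hΦf : HasFDerivAt Φ (e : E →L[ℂ] ℂ × K) z1 := by
    rw [he2]
    refine HasFDerivAt.prodMk (hg.differentiableAt (hU.mem_nhds hz1)).hasFDerivAt ?_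
    have := p.hasFDerivAt.comp z1 ((hasFDerivAt_id z1).sub_const z1)
    rw [ContinuousLinearMap.comp_id] at this
    exact this
  set T := hΦd.toOpenPartialHomeomorph Φ hΦf (by norm_num) with hT
  have hTc : ∀ z, T z = Φ z := fun z => rfl
  have hTs := hΦd.mem_toOpenPartialHomeomorph_source hΦf (by norm_num)
  have hTt := hΦd.image_mem_toOpenPartialHomeomorph_target hΦf (by norm_num)
  have hinv : ContDiffAt ℂ 1 T.symm (Φ z1) := hΦd.to_localInverse hΦf (by norm_num)
  have hev : ∀ᶠ y in nhds (Φ z1), DifferentiableAt ℂ T.symm y ∧ y ∈ T.target := by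
    filter_upwards [hinv.eventually (by norm_num), T.open_target.mem_nhds hTt] with y hy hy2
    exact ⟨hy.differentiableAt (by norm_num), hy2⟩
  obtain ⟨O, hO1, hO, hO3⟩ := _root_.eventually_nhds_iff.1 hev
  have hTsU : IsOpen (O ∩ T.symm ⁻¹' U) := by
    apply ContinuousOn.isOpen_inter_preimage _ hO hU
    exact fun y hy => (hO1 y hy).1.continuousAt.continuousWithinAt
  refine ⟨K, hfr, {x | ((0:ℂ), x) ∈ O ∩ T.symm ⁻¹' U}, (T.source ∩ T ⁻¹' O) ∩ U, fun x => T.symm (0, x), fun z => p (z - z1), ?_, ?_, ?_, ?_, ?_, ?_, ?_, ?_⟩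
  · exact hTsU.preimage (by fun_prop)
  · exact (T.continuousOn.isOpen_inter_preimage T.open_source hO).inter hU
  · exact ⟨⟨hTs, hO3⟩, hz1⟩
  · exact fun z hz => hz.2
  · intro x hx
    refine DifferentiableAt.differentiableWithinAt ?_
    exact (hO1 _ hx.1).1.comp x (by fun_prop)
  · fun_prop
  · intro x hx
    have h1 := (hO1 _ hx.1).2
    have h2 := T.right_inv h1
    have h3 : Φ (T.symm (0, x)) = (0, x) := h2
    refine ⟨⟨⟨T.map_target h1, ?_⟩, hx.2⟩, (Prod.ext_iff.1 h3).1, (Prod.ext_iff.1 h3).2⟩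
    show T (T.symm (0,x)) ∈ O
    rw [h2]; exact hx.1
  · intro z hz hz0
    have h1 : T z = (0, p (z - z1)) := by rw [hTc]; simp only [hΦ, hz0]
    have h2 := T.left_inv hz.1.1
    rw [h1] at h2
    refine ⟨⟨?_, ?_⟩, h2⟩
    · rw [← h1]; exact hz.1.2
    · show T.symm _ ∈ U
      rw [h2]; exact hz.2

theorem iter_next {E : Type} [NormedAddCommGroup E] [NormedSpace ℂ E] [FiniteDimensional ℂ E]
    {U : Set E} (hU : IsOpen U) {f : E → ℂ} (hf : DifferentiableOn ℂ f U) {z1 : E} (hz1 : z1 ∈ U) {m : ℕ}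
    (h : iteratedFDeriv ℂ (m + 1) f z1 ≠ 0) : ∃ (u : E) (v : Fin m → E),
      (fderiv ℂ (fun z => iteratedFDeriv ℂ m f z v) z1) u ≠ 0 := by
  by_contra! hcon
  apply h
  ext w
  rw [iteratedFDeriv_succ_apply_left]
  have h1 := ((iter_diff hU hf m).differentiableAt (hU.mem_nhds hz1)).hasFDerivAt
  have h2 := ((ContinuousMultilinearMap.apply ℂ (fun _ : Fin m => E) ℂ (Fin.tail w)).hasFDerivAt).comp z1 h1
  have h3 := hcon (w 0) (Fin.tail w)
  have h4 : fderiv ℂ (fun z => iteratedFDeriv ℂ m f z (Fin.tail w)) z1 = _ := h2.fderiv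
  rw [h4] at h3
  exact h3

theorem iter_app_diff {E : Type} [NormedAddCommGroup E] [NormedSpace ℂ E] [FiniteDimensional ℂ E]
    {U : Set E} (hU : IsOpen U) {f : E → ℂ} (hf : DifferentiableOn ℂ f U) (m : ℕ) (v : Fin m → E) :
    DifferentiableOn ℂ (fun z => iteratedFDeriv ℂ m f z v) U := by
  intro z hz
  have h1 := ((iter_diff hU hf m).differentiableAt (hU.mem_nhds hz))
  exact (((ContinuousMultilinearMap.apply ℂ (fun _ : Fin m => E) ℂ v).differentiableAt).comp z h1).differentiableWithinAt

theorem perf (N : ℕ) (d : ℕ) : ∀ (E : Type) [NormedAddCommGroup E] [NormedSpace ℂ E] [FiniteDimensional ℂ E],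
    Module.finrank ℂ E = d → ∀ (U : Set E), IsOpen U → ∀ (G : Fin N → E → ℂ),
    (∀ j, DifferentiableOn ℂ (G j) U) → ∀ (Z : Set E), Z ⊆ U → Z.Nonempty →
    (∀ z ∈ Z, ∀ r > 0, ∃ z' ∈ Z, z' ≠ z ∧ dist z' z < r) → (∀ z ∈ Z, ∀ j, G j z = 0) →
    ∃ φ : ℂ → E, DifferentiableOn ℂ φ (ball 0 1) ∧ (∀ t ∈ ball (0:ℂ) 1, φ t ∈ U ∧ ∀ j, G j (φ t) = 0) ∧
      ∃ s ∈ ball (0:ℂ) 1, ∃ t ∈ ball (0:ℂ) 1, φ s ≠ φ t := by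
  induction d with
  | zero =>
    intro E _ _ _ hd U hU G hG Z hZU hZne hZ hGZ
    obtain ⟨z, hz⟩ := hZne
    obtain ⟨z', -, h, -⟩ := hZ z hz 1 one_pos
    have := Module.finrank_zero_iff.1 hd
    exact (h (Subsingleton.elim _ _)).elim
  | succ d ih =>
    intro E _ _ _ hd U hU G hG Z hZU hZne hZ hGZ
    by_cases hA : ∃ z ∈ Z, ∀ j, ∀ᶠ w in nhds z, G j w = 0
    · obtain ⟨z, hz, hA⟩ := hA
      obtain ⟨z', -, hne, -⟩ := hZ z hz 1 one_pos
      have hev : ∀ᶠ w in nhds z, w ∈ U ∧ ∀ j, G j w = 0 :=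
        Filter.Eventually.and (hU.mem_nhds (hZU hz)) (Filter.eventually_all.2 hA)
      obtain ⟨r, hr, hrb⟩ := Metric.eventually_nhds_iff.1 hev
      set v := z' - z
      have hv : 0 < ‖v‖ := norm_pos_iff.2 (sub_ne_zero.2 hne)
      have hc : (0:ℝ) < r / ‖v‖ := by positivity
      refine ⟨fun t => z + t • (((r / ‖v‖ : ℝ) : ℂ) • v), by fun_prop, fun t ht => hrb ?_, 0, by simp, 1 / 2, by simp; norm_num, ?_⟩
      · rw [dist_eq_norm, add_sub_cancel_left, norm_smul, norm_smul, Complex.norm_real, Real.norm_of_nonneg hc.le, div_mul_cancel₀ _ hv.ne']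
        rw [mem_ball_zero_iff] at ht
        nlinarith
      · simp only [zero_smul, add_zero, ne_eq, left_eq_add, smul_eq_zero, not_or]
        exact ⟨by norm_num, by exact_mod_cast hc.ne', norm_pos_iff.1 hv⟩
    · push Not at hA
      obtain ⟨z0, hz0⟩ := hZne
      obtain ⟨j, hj⟩ := hA z0 hz0
      have hex : ∃ k, ∃ z ∈ Z, iteratedFDeriv ℂ k (G j) z ≠ 0 := by
        by_contra! hcon
        obtain ⟨R, hR, hRb⟩ := Metric.isOpen_iff.1 hU z0 (hZU hz0)
        have := zero_of_iter ((hG j).mono hRb) (fun k => hcon k z0 hz0)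
        exact hj (Filter.eventually_of_mem (ball_mem_nhds z0 hR) fun w hw => not_not.2 (this w hw))
      classical
      obtain ⟨z1, hz1, hk⟩ := Nat.find_spec hex
      have hmin := fun k => Nat.find_min hex (m := k)
      set k := Nat.find hex
      rcases hkm : k with _ | m
      · rw [hkm] at hk
        exfalso; apply hk
        ext w; simpa using hGZ z1 hz1 j
      rw [hkm] at hk hmin
      obtain ⟨u, v, huv⟩ := iter_next hU (hG j) (hZU hz1) hk
      have hm := hmin m (Nat.lt_succ_self m)
      push Not at hm
      set g := fun z => iteratedFDeriv ℂ m (G j) z v with hgdef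
      have hgZ : ∀ z ∈ Z, g z = 0 := fun z hz => by simp only [hgdef, hm z hz]; rfl
      obtain ⟨K, hK, V, W, σ, π, hV, hW, hz1W, hWU, hσ, hπ, hσV, hWg⟩ := chart hU (iter_app_diff hU (hG j) m v) (hZU hz1) (hgZ z1 hz1)
        (fun h0 => huv (by rw [h0]; rfl))
      obtain ⟨φ, hφ, hφ2, s, hs, t, ht, hst⟩ := ih K (by omega) V hV (fun i x => G i (σ x))
        (fun i => (hG i).comp hσ (fun x hx => hWU (hσV x hx).1)) {x | x ∈ V ∧ σ x ∈ Z} (fun x hx => hx.1)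
        ⟨π z1, (hWg z1 hz1W (hgZ z1 hz1)).1, by
          show σ (π z1) ∈ Z
          rw [(hWg z1 hz1W (hgZ z1 hz1)).2]; exact hz1⟩ (by
          rintro x ⟨hx, hxZ⟩ r hr
          have hc : ∀ᶠ z in nhds (σ x), dist (π z) (π (σ x)) < r ∧ z ∈ W :=
            (hπ.continuousAt.eventually (ball_mem_nhds (π (σ x)) hr)).and (hW.mem_nhds (hσV x hx).1)
          obtain ⟨δ, hδ, hδ2⟩ := Metric.eventually_nhds_iff.1 hc
          obtain ⟨z', hz', hne, hlt⟩ := hZ _ hxZ δ hδ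
          have h1 := hδ2 hlt
          have h2 := hWg z' h1.2 (hgZ z' hz')
          refine ⟨π z', ⟨h2.1, ?_⟩, ?_, ?_⟩
          · show σ (π z') ∈ Z
            rw [h2.2]; exact hz'
          · intro h; apply hne; rw [← h2.2, h]
          · have := h1.1; rwa [(hσV x hx).2.2] at this)
        (fun x hx i => hGZ _ hx.2 i)
      refine ⟨fun t => σ (φ t), hσ.comp hφ fun t ht => (hφ2 t ht).1, fun t ht => ⟨hWU (hσV _ (hφ2 t ht).1).1, (hφ2 t ht).2⟩, s, hs, t, ht, ?_⟩
      intro h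
      apply hst
      rw [← (hσV _ (hφ2 s hs).1).2.2, ← (hσV _ (hφ2 t ht).1).2.2]
      exact congrArg π h

theorem LMPh {m : ℕ} {X : Set (Fin m → ℂ)} (hX : IsCompact X) {y : Fin m → ℂ} (hy : y ∈ polyHull X)
    (hyX : y ∉ X) {U : Set (Fin m → ℂ)} (hU : IsOpen U) (hyU : y ∈ U) {L : (Fin m → ℂ) → ℂ}
    (hL : DifferentiableOn ℂ L U)
    (hQ : ∀ x ∈ polyHull X, x ∈ U → x ≠ y → (L x).re < (L y).re) : False := by
  obtain ⟨r, hr, M, hM, hb, hbd, -⟩ := bdd_ball hU hL hyU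
  obtain ⟨d, hd, hdX⟩ := Metric.isOpen_iff.1 hX.isClosed.isOpen_compl y hyX
  have he : 1 < Real.exp 1 := by simp
  set ρ := min (4 * r / (8 * Real.exp 1)) (d / 2) with hρd
  have hρ : 0 < ρ := by positivity
  have hρ1 : ρ ≤ 4 * r / (8 * Real.exp 1) := min_le_left _ _
  have hρ2 : ρ ≤ d / 2 := min_le_right _ _
  have hρ3 : ρ < 4 * r := by
    refine hρ1.trans_lt ?_
    rw [div_lt_iff₀ (by positivity)]; nlinarith
  have hsub : closedBall y ρ ⊆ U := (closedBall_subset_ball hρ3).trans hb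
  have hS : IsCompact (polyHull X ∩ sphere y ρ) := (hull_compact hX).inter_right isClosed_sphere
  obtain ⟨δ, hδ, hδ2⟩ := hS.exists_forall_le' (f := fun x => (L y).re - (L x).re) (a := 0)
    (continuousOn_const.sub (Complex.continuous_re.comp_continuousOn (hL.continuousOn.mono fun x hx => hsub (sphere_subset_closedBall hx.2))))
    (fun x hx => sub_pos.2 (hQ x hx.1 (hsub (sphere_subset_closedBall hx.2)) (by
      rintro rfl; have := hx.2; simp at this; linarith)))
  obtain ⟨K, hK⟩ := exists_pow_lt_of_lt_one (show 0 < δ / (3 * (M * 2)) by positivity) (show (1 / 2 : ℝ) < 1 by norm_num)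
  have hK2 : M * 2 * (1 / 2) ^ K < δ / 3 := by
    rw [lt_div_iff₀ (by positivity)] at hK; linarith
  have ht : ∀ w, dist w y ≤ ρ → ‖L w - MvPolynomial.eval w (∑ k ∈ Finset.range K, tayP L y k)‖ < δ / 3 := fun w hw =>
    (taylor_unif (hL.mono hb) (by positivity) hbd K (hw.trans hρ1)).trans_lt hK2
  refine LMP hX hy hρ (fun x hx => ?_) (∑ k ∈ Finset.range K, tayP L y k) (fun x hx hxd => ?_)
  · by_contra! hcon
    exact hdX (show x ∈ ball y d by rw [mem_ball]; linarith) hx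
  · have h1 := hδ2 x ⟨hx, hxd⟩
    have h2 := (Complex.abs_re_le_norm _).trans_lt (ht x hxd.le)
    have h3 := (Complex.abs_re_le_norm _).trans_lt (ht y (by simpa using hρ.le))
    rw [Complex.sub_re, abs_lt] at h2 h3
    linarith [h2.1, h2.2, h3.1, h3.2]

theorem local_ph {n N : ℕ} {Ω : Set (Fin n → ℂ)} (hop : IsOpen Ω) {h : Fin N → (Fin n → ℂ) → ℂ}
    (hph : ∀ j, Pluriharmonic (h j) Ω) {z : Fin n → ℂ} (hz : z ∈ Ω) :
    ∃ r > 0, ball z r ⊆ Ω ∧ ∃ F G : Fin N → (Fin n → ℂ) → ℂ, (∀ j, DifferentiableOn ℂ (F j) (ball z r)) ∧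
      (∀ j, DifferentiableOn ℂ (G j) (ball z r)) ∧ ∀ j, ∀ w ∈ ball z r, h j w = F j w + starRingEnd ℂ (G j w) := by
  choose U hUo hzU hUΩ F G hF hG hFG using fun j => hph j z hz
  have : (⋂ j, U j) ∩ Ω ∈ nhds z := Filter.inter_mem (by
    rw [Filter.iInter_mem]; exact fun j => (hUo j).mem_nhds (hzU j)) (hop.mem_nhds hz)
  obtain ⟨r, hr, hb⟩ := Metric.mem_nhds_iff.1 this
  have hbj : ∀ j, ball z r ⊆ U j := fun j w hw => Set.mem_iInter.1 (hb hw).1 j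
  exact ⟨r, hr, fun w hw => (hb hw).2, F, G, fun j => (hF j).mono (hbj j), fun j => (hG j).mono (hbj j), fun j w hw => hFG j w (hbj j hw)⟩

def pr1 {n N : ℕ} (x : Fin (n + N) → ℂ) : Fin n → ℂ := fun i => x (Fin.castAdd N i)
def pr2 {n N : ℕ} (x : Fin (n + N) → ℂ) : Fin N → ℂ := fun i => x (Fin.natAdd n i)

theorem pr1_append {n N : ℕ} (z : Fin n → ℂ) (w : Fin N → ℂ) : pr1 (Fin.append z w) = z := by
  ext i; simp [pr1]
theorem pr2_append {n N : ℕ} (z : Fin n → ℂ) (w : Fin N → ℂ) : pr2 (Fin.append z w) = w := by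
  ext i; simp [pr2]
theorem append_pr {n N : ℕ} (x : Fin (n + N) → ℂ) : Fin.append (pr1 x) (pr2 x) = x := by
  ext i; refine Fin.addCases (fun i => ?_) (fun i => ?_) i <;> simp [pr1, pr2]
theorem pr1_diff {n N : ℕ} : Differentiable ℂ (pr1 : (Fin (n + N) → ℂ) → Fin n → ℂ) := by
  rw [differentiable_pi]; intro i; unfold pr1; fun_prop
theorem pr2_diff {n N : ℕ} (j : Fin N) : Differentiable ℂ (fun x : Fin (n + N) → ℂ => pr2 x j) := by
  unfold pr2; fun_prop
theorem pr1_dist {n N : ℕ} (x y : Fin (n + N) → ℂ) : dist (pr1 x) (pr1 y) ≤ dist x y := by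
  rw [dist_pi_le_iff dist_nonneg]; intro i; exact dist_le_pi_dist x y _

theorem graph_cont {n N : ℕ} {h : Fin N → (Fin n → ℂ) → ℂ} {E : Set (Fin n → ℂ)} (hc : ∀ j, ContinuousOn (h j) E) :
    ContinuousOn (fun z => (Fin.append z (fun j => h j z) : Fin (n + N) → ℂ)) E := by
  rw [continuousOn_pi]
  intro i
  refine Fin.addCases (fun i => ?_) (fun i => ?_) i
  · simp only [Fin.append_left]; exact (continuous_apply i).continuousOn
  · simp only [Fin.append_right]; exact hc i

theorem graph_compact {n N : ℕ} {h : Fin N → (Fin n → ℂ) → ℂ} {E : Set (Fin n → ℂ)} (hE : IsCompact E)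
    (hc : ∀ j, ContinuousOn (h j) E) : IsCompact (graphSet h E) :=
  hE.image_of_continuousOn (graph_cont hc)

theorem mem_graph {n N : ℕ} {h : Fin N → (Fin n → ℂ) → ℂ} {E : Set (Fin n → ℂ)} {x : Fin (n + N) → ℂ} :
    x ∈ graphSet h E ↔ pr1 x ∈ E ∧ ∀ j, pr2 x j = h j (pr1 x) := by
  constructor
  · rintro ⟨z, hz, rfl⟩
    rw [pr1_append, pr2_append]; exact ⟨hz, fun _ => rfl⟩
  · rintro ⟨h1, h2⟩
    refine ⟨pr1 x, h1, ?_⟩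
    conv_rhs => rw [← append_pr x]
    exact congrArg (Fin.append (pr1 x)) (funext fun j => (h2 j).symm)

theorem graph_inj {n N : ℕ} {h : Fin N → (Fin n → ℂ) → ℂ} {E E' : Set (Fin n → ℂ)} {x y : Fin (n + N) → ℂ}
    (hx : x ∈ graphSet h E) (hy : y ∈ graphSet h E') (hxy : pr1 x = pr1 y) : x = y := by
  rw [mem_graph] at hx hy
  rw [← append_pr x, ← append_pr y, hxy]
  congr 1
  ext j; rw [hx.2, hy.2, hxy]

def HDisc {n N : ℕ} (h : Fin N → (Fin n → ℂ) → ℂ) (Ω : Set (Fin n → ℂ)) : Prop :=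
  ∃ φ : ℂ → (Fin n → ℂ), DifferentiableOn ℂ φ (ball (0:ℂ) 1) ∧
            (∀ z ∈ ball (0:ℂ) 1, φ z ∈ Ω) ∧
            (∃ z ∈ ball (0:ℂ) 1, ∃ w ∈ ball (0:ℂ) 1, φ z ≠ φ w) ∧
            (∀ j, DifferentiableOn ℂ (fun z => h j (φ z)) (ball (0:ℂ) 1))

/-- discs from perfect sets of fibres -/
theorem hdisc_of_perf {n N : ℕ} {h : Fin N → (Fin n → ℂ) → ℂ} {Ω : Set (Fin n → ℂ)} {z : Fin n → ℂ} {r : ℝ}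
    (hb : ball z r ⊆ Ω) {F G : Fin N → (Fin n → ℂ) → ℂ} (hF : ∀ j, DifferentiableOn ℂ (F j) (ball z r))
    (hG : ∀ j, DifferentiableOn ℂ (G j) (ball z r)) (hFG : ∀ j, ∀ w ∈ ball z r, h j w = F j w + starRingEnd ℂ (G j w))
    (c : Fin N → ℂ) (Z : Set (Fin n → ℂ)) (hZ : Z ⊆ ball z r) (hne : Z.Nonempty)
    (hacc : ∀ z ∈ Z, ∀ r > 0, ∃ z' ∈ Z, z' ≠ z ∧ dist z' z < r) (hGc : ∀ z ∈ Z, ∀ j, G j z = c j) : HDisc h Ω := by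
  obtain ⟨φ, hφ, hφ2, s, hs, t, ht, hst⟩ := perf N n (Fin n → ℂ) (by simp) (ball z r) isOpen_ball (fun j w => G j w - c j)
    (fun j => (hG j).sub_const _) Z hZ hne hacc (fun z hz j => by simp [hGc z hz j])
  refine ⟨φ, hφ, fun t ht => hb (hφ2 t ht).1, ⟨s, hs, t, ht, hst⟩, fun j => ?_⟩
  have : DifferentiableOn ℂ (fun t => F j (φ t) + starRingEnd ℂ (c j)) (ball 0 1) :=
    ((hF j).comp hφ fun t ht => (hφ2 t ht).1).add_const _
  refine this.congr fun t ht => ?_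
  have h1 := (hφ2 t ht).2 j
  rw [hFG j _ (hφ2 t ht).1, sub_eq_zero.1 h1]

theorem T3 {n N : ℕ} {h : Fin N → (Fin n → ℂ) → ℂ} {Ω : Set (Fin n → ℂ)} (hop : IsOpen Ω)
    (hph : ∀ j, Pluriharmonic (h j) Ω) (hKc : IsCompact (graphSet h (frontier Ω)))
    (hX : polyHull (graphSet h (frontier Ω)) ⊆ graphSet h (closure Ω)) (h3 : ¬ HDisc h Ω) :
    polyHull (graphSet h (frontier Ω)) ⊆ graphSet h (frontier Ω) := by
  intro y0 hy0
  by_contra hy0K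
  have hmem : ∀ y ∈ polyHull (graphSet h (frontier Ω)), pr1 y ∈ Ω → y ∉ graphSet h (frontier Ω) := by
    intro y _ hy2 hy3
    have := (mem_graph.1 hy3).1
    rw [hop.frontier_eq] at this
    exact this.2 hy2
  have hz0 : pr1 y0 ∈ Ω := by
    have h1 := mem_graph.1 (hX hy0)
    by_contra hcon
    exact hy0K (mem_graph.2 ⟨by rw [hop.frontier_eq]; exact ⟨h1.1, hcon⟩, h1.2⟩)
  obtain ⟨r, hr, hb, F, G, hF, hG, hFG⟩ := local_ph hop hph hz0
  refine h3 (hdisc_of_perf hb hF hG hFG (fun j => G j (pr1 y0))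
    {z | z ∈ ball (pr1 y0) r ∧ (∃ y ∈ polyHull (graphSet h (frontier Ω)), pr1 y = z) ∧ ∀ j, G j z = G j (pr1 y0)}
    (fun z hz => hz.1) ⟨pr1 y0, mem_ball_self hr, ⟨y0, hy0, rfl⟩, fun _ => rfl⟩ ?_ (fun z hz => hz.2.2))
  rintro _ ⟨hzb, ⟨y, hy, rfl⟩, hzG⟩ s hs
  by_contra! hcon
  set c := fun j => G j (pr1 y0) with hc
  set U : Set (Fin (n + N) → ℂ) := pr1 ⁻¹' (ball (pr1 y0) r ∩ ball (pr1 y) s)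
  have hU : IsOpen U := (isOpen_ball.inter isOpen_ball).preimage pr1_diff.continuous
  have hmaps : Set.MapsTo (pr1 : (Fin (n + N) → ℂ) → _) U (ball (pr1 y0) r) := fun x hx => hx.1
  set L : (Fin (n + N) → ℂ) → ℂ := fun x => -∑ j, (pr2 x j - F j (pr1 x) - starRingEnd ℂ (c j)) * (G j (pr1 x) - c j) with hL
  have hLd : DifferentiableOn ℂ L U := by
    refine DifferentiableOn.neg (DifferentiableOn.fun_sum fun j _ => ?_)
    refine DifferentiableOn.mul (((pr2_diff j).differentiableOn.sub ((hF j).comp pr1_diff.differentiableOn hmaps)).sub_const _)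
      (((hG j).comp pr1_diff.differentiableOn hmaps).sub_const _)
  have hLv : ∀ x ∈ polyHull (graphSet h (frontier Ω)), x ∈ U → (L x).re = -∑ j, ‖G j (pr1 x) - c j‖ ^ 2 := by
    intro x hx hxU
    have : L x = ((-∑ j, ‖G j (pr1 x) - c j‖ ^ 2 : ℝ) : ℂ) := by
      rw [hL]; push_cast
      congr 1
      refine Finset.sum_congr rfl fun j _ => ?_
      rw [(mem_graph.1 (hX hx)).2 j, hFG j _ (hmaps hxU), ← Complex.conj_mul', map_sub]
      ring
    rw [this, Complex.ofReal_re]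
  refine LMPh hKc hy (hmem y hy (hb hzb)) hU ⟨hzb, mem_ball_self hs⟩ hLd fun x hx hxU hxy => ?_
  have hyU : y ∈ U := ⟨hzb, mem_ball_self hs⟩
  rw [hLv x hx hxU, hLv y hy hyU]
  have h0 : ∑ j, ‖G j (pr1 y) - c j‖ ^ 2 = 0 := Finset.sum_eq_zero fun j _ => by rw [hzG j]; simp [hc]
  rw [h0, neg_zero, neg_lt_zero]
  refine lt_of_le_of_ne (Finset.sum_nonneg fun j _ => by positivity) fun h1 => ?_
  rw [eq_comm, Finset.sum_eq_zero_iff_of_nonneg (fun j _ => by positivity)] at h1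
  have h2 : ∀ j, G j (pr1 x) = G j (pr1 y0) := fun j => by
    have := h1 j (Finset.mem_univ j)
    exact sub_eq_zero.1 (by simpa using this)
  have h4 : pr1 x ≠ pr1 y := fun h5 => hxy (graph_inj (hX hx) (hX hy) h5)
  have := hcon (pr1 x) ⟨hxU.1, ⟨x, hx, rfl⟩, h2⟩ h4
  have h6 := hxU.2
  rw [mem_ball] at h6
  linarith

theorem push {n : ℕ} {Ω : Set (Fin n → ℂ)} (hop : IsOpen Ω) (hC1 : C1Boundary Ω) {p : Fin n → ℂ} (hp : p ∈ closure Ω) :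
    ∃ r > 0, ∃ v : Fin n → ℂ, ∃ e > 0, ∀ z ∈ closure Ω, dist z p ≤ 2 * r → ∀ ε : ℝ, 0 < ε → ε < e → z + ε • v ∈ Ω := by
  by_cases hpΩ : p ∈ Ω
  · obtain ⟨δ, hδ, hb⟩ := Metric.isOpen_iff.1 hop p hpΩ
    refine ⟨δ / 4, by positivity, 0, 1, one_pos, fun z _ hz ε _ _ => ?_⟩
    rw [smul_zero, add_zero]
    exact hb (by rw [mem_ball]; linarith)
  have hpf : p ∈ frontier Ω := by rw [hop.frontier_eq]; exact ⟨hp, hpΩ⟩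
  obtain ⟨W, hW, hpW, ρ, hρ, hd, hW1, hW2⟩ := hC1 p hpf
  obtain ⟨v, hv⟩ : ∃ v, fderiv ℝ ρ p v < 0 := by
    by_contra! hcon
    refine hd p hpW (ContinuousLinearMap.ext fun v => ?_)
    have h1 := hcon v
    have h2 := hcon (-v)
    rw [map_neg] at h2
    rw [ContinuousLinearMap.zero_apply]; linarith
  have hc : ContinuousOn (fun w => fderiv ℝ ρ w v) W := (hρ.continuousOn_fderiv_of_isOpen hW le_rfl).clm_apply continuousOn_const
  have h1 : ∀ᶠ w in nhds p, fderiv ℝ ρ w v < 0 := (hc.continuousAt (hW.mem_nhds hpW)).eventually_lt continuousAt_const hv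
  obtain ⟨δ, hδ, hb⟩ := Metric.mem_nhds_iff.1 (h1.and (hW.mem_nhds hpW))
  refine ⟨δ / 4, by positivity, v, δ / (4 * (‖v‖ + 1)), by positivity, fun z hz hzp ε hε hεe => ?_⟩
  have hin : ∀ t ∈ Set.Icc 0 ε, z + t • v ∈ ball p δ := by
    intro t ht
    rw [lt_div_iff₀ (by positivity)] at hεe
    have h2 : dist (z + t • v) z ≤ ε * ‖v‖ := by
      rw [dist_eq_norm, add_sub_cancel_left, norm_smul, Real.norm_eq_abs, abs_of_nonneg ht.1]
      exact mul_le_mul_of_nonneg_right ht.2 (norm_nonneg _)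
    rw [mem_ball]
    have := dist_triangle (z + t • v) z p
    nlinarith
  have hder : ∀ t ∈ Set.Icc 0 ε, HasDerivAt (fun t : ℝ => ρ (z + t • v)) (fderiv ℝ ρ (z + t • v) v) t := by
    intro t ht
    have h3 : DifferentiableAt ℝ ρ (z + t • v) := (hρ.differentiableOn one_ne_zero).differentiableAt (hW.mem_nhds (hb (hin t ht)).2)
    have h4 : HasDerivAt (fun t : ℝ => z + t • v) v t := by
      simpa using ((hasDerivAt_id t).smul_const v).const_add z
    exact h3.hasFDerivAt.comp_hasDerivAt t h4
  have hanti : StrictAntiOn (fun t : ℝ => ρ (z + t • v)) (Set.Icc 0 ε) := by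
    refine strictAntiOn_of_deriv_neg (convex_Icc _ _) (fun t ht => (hder t ht).continuousAt.continuousWithinAt) fun t ht => ?_
    have ht' := interior_subset ht
    rw [(hder t ht').deriv]
    exact (hb (hin t ht')).1
  have h5 := hanti (Set.left_mem_Icc.2 hε.le) (Set.right_mem_Icc.2 hε.le) hε
  simp only [zero_smul, add_zero] at h5
  have hzW : z ∈ W := by
    have : z + (0 : ℝ) • v ∈ W := (hb (hin 0 (Set.left_mem_Icc.2 hε.le))).2
    rwa [zero_smul, add_zero] at this
  have h6 : ρ z ≤ 0 := by
    by_cases hzΩ : z ∈ Ω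
    · have : z ∈ Ω ∩ W := ⟨hzΩ, hzW⟩
      rw [hW1] at this; exact this.2.le
    · have : z ∈ frontier Ω ∩ W := ⟨by rw [hop.frontier_eq]; exact ⟨hz, hzΩ⟩, hzW⟩
      rw [hW2] at this; exact this.2.le
  have : z + ε • v ∈ {w ∈ W | ρ w < 0} := ⟨(hb (hin ε (Set.right_mem_Icc.2 hε.le))).2, by linarith⟩
  rw [← hW1] at this
  exact this.1

theorem max_fin {ι α : Type} [TopologicalSpace α] (t : Finset ι) (T : ι → Set α) (hT : ∀ i ∈ t, IsCompact (T i))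
    (u : ι → α → ℝ) (hu : ∀ i ∈ t, ContinuousOn (u i) (T i)) (hne : ∃ i ∈ t, (T i).Nonempty) :
    ∃ i ∈ t, ∃ x ∈ T i, ∀ i' ∈ t, ∀ x' ∈ T i', u i' x' ≤ u i x := by
  have hc : IsCompact (⋃ i ∈ t, u i '' T i) := t.isCompact_biUnion fun i hi => (hT i hi).image_of_continuousOn (hu i hi)
  obtain ⟨i, hi, x, hx⟩ := hne
  obtain ⟨a, ha, ha2⟩ := hc.exists_isGreatest ⟨u i x, Set.mem_biUnion hi ⟨x, hx, rfl⟩⟩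
  simp only [Set.mem_iUnion] at ha
  obtain ⟨i, hi, x, hx, rfl⟩ := ha
  exact ⟨i, hi, x, hx, fun i' hi' x' hx' => ha2 (Set.mem_biUnion hi' ⟨x', hx', rfl⟩)⟩

theorem hull_proj {n N : ℕ} {E : Set (Fin n → ℂ)} (hE : IsCompact E) (hpc : polyHull E = E) {h : Fin N → (Fin n → ℂ) → ℂ}
    {x : Fin (n + N) → ℂ} (hx : x ∈ polyHull (graphSet h E)) : pr1 x ∈ E := by
  rw [← hpc]
  intro p
  have h1 := hx (MvPolynomial.rename (Fin.castAdd N) p)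
  rw [MvPolynomial.eval_rename] at h1
  refine h1.trans (le_of_eq ?_)
  congr 1
  rw [graphSet, Set.image_image]
  refine Set.image_congr fun z _ => ?_
  rw [MvPolynomial.eval_rename]
  rw [show (Fin.append z fun j => h j z) ∘ Fin.castAdd N = z from pr1_append z _]

theorem T2 {n N : ℕ} {Ω : Set (Fin n → ℂ)} (hbd : Bornology.IsBounded Ω) (hop : IsOpen Ω)
    (hC1 : C1Boundary Ω) (hpc : polyHull (closure Ω) = closure Ω)
    {h : Fin N → (Fin n → ℂ) → ℂ} (hcont : ∀ j, ContinuousOn (h j) (closure Ω)) (hph : ∀ j, Pluriharmonic (h j) Ω) :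
    polyHull (graphSet h (closure Ω)) ⊆ graphSet h (closure Ω) := by
  intro x0 hx0
  have hcl : IsCompact (closure Ω) := hbd.isCompact_closure
  set X := graphSet h (closure Ω) with hXd
  have hXc : IsCompact X := graph_compact hcl hcont
  have hYc : IsCompact (polyHull X) := hull_compact hXc
  have hproj : ∀ x ∈ polyHull X, pr1 x ∈ closure Ω := fun x hx => hull_proj hcl hpc hx
  rw [hXd, mem_graph]
  refine ⟨hproj x0 hx0, fun j => ?_⟩
  by_contra hne
  obtain ⟨l, hl⟩ : ∃ l : ℂ, 0 < (l * (pr2 x0 j - h j (pr1 x0))).re := by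
    refine ⟨starRingEnd ℂ (pr2 x0 j - h j (pr1 x0)), ?_⟩
    rw [Complex.conj_mul', ← Complex.ofReal_pow, Complex.ofReal_re]
    have := norm_pos_iff.2 (sub_ne_zero.2 hne)
    positivity
  set m := (l * (pr2 x0 j - h j (pr1 x0))).re with hm
  set H : (Fin n → ℂ) → ℝ := fun z => (l * h j z).re with hH
  have hHc : ContinuousOn H (closure Ω) := Complex.continuous_re.comp_continuousOn (continuousOn_const.mul (hcont j))
  have hHu : UniformContinuousOn H (closure Ω) := hcl.uniformContinuousOn_of_continuous hHc
  set D : (Fin n → ℂ) → (Fin n → ℂ) → ℝ := fun z p => ∑ k, ‖z k - p k‖ ^ 2 with hD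
  have hDc : ∀ p, Continuous fun z => D z p := fun p => by rw [hD]; fun_prop
  have hDd : ∀ z p, dist z p ^ 2 ≤ D z p := fun z p => by
    have := sum_sq_ge (z - p); rw [dist_eq_norm]; simpa [hD] using this
  have hP : ∀ p : closure Ω, ∃ r > 0, ∃ v : Fin n → ℂ, ∃ e > 0, ∀ z ∈ closure Ω, dist z p.1 ≤ 2 * r → ∀ ε : ℝ, 0 < ε → ε < e → z + ε • v ∈ Ω :=
    fun p => push hop hC1 p.2
  choose r hr v e he hpush using hP
  obtain ⟨t, ht⟩ := hcl.elim_finite_subcover (fun p : closure Ω => {z | D z p.1 < r p ^ 2})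
    (fun p => isOpen_lt (hDc _) continuous_const) (fun z hz => Set.mem_iUnion.2 ⟨⟨z, hz⟩, by
      have := hr ⟨z, hz⟩; simp [hD]; positivity⟩)
  have ht' : ∀ z ∈ closure Ω, ∃ p ∈ t, D z p.1 < r p ^ 2 := fun z hz => by simpa using ht hz
  obtain ⟨R, hR, hRb⟩ : ∃ R > 0, ∀ x ∈ polyHull X, ∑ k, ‖x k‖ ^ 2 ≤ R := by
    obtain ⟨R, hR⟩ := (hYc.image (f := fun x : Fin (n + N) → ℂ => ∑ k, ‖x k‖ ^ 2) (by fun_prop)).bddAbove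
    exact ⟨max R 1, by positivity, fun x hx => (hR ⟨x, hx, rfl⟩).trans (le_max_left _ _)⟩
  set s := 1 + ∑ p ∈ t, 1 / r p ^ 2 with hs
  have hspos : 0 < s := by
    have : 0 ≤ ∑ p ∈ t, 1 / r p ^ 2 := Finset.sum_nonneg fun p _ => by positivity
    linarith
  obtain ⟨η, hη, hηm⟩ : ∃ η > 0, 3 * η + η * s * R < m := by
    refine ⟨m / (2 * (3 + s * R)), by positivity, ?_⟩
    have : 3 * (m / (2 * (3 + s * R))) + m / (2 * (3 + s * R)) * s * R = m / 2 := by field_simp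
    linarith
  obtain ⟨δ, hδ, hδu⟩ := Metric.uniformContinuousOn_iff.1 hHu η hη
  obtain ⟨ε, hε, hεe, hεv⟩ : ∃ ε > 0, (∀ p ∈ t, ε < e p) ∧ ∀ p ∈ t, ε * ‖v p‖ < δ := by
    have h1 : ∀ᶠ ε in nhdsWithin (0 : ℝ) (Set.Ioi 0), ∀ p ∈ t, ε < e p ∧ ε * ‖v p‖ < δ := by
      rw [Filter.eventually_all_finset]
      intro p _
      refine nhdsWithin_le_nhds (((continuous_id.tendsto 0).eventually_lt_const (he p)).and ?_)
      have : Continuous fun ε : ℝ => ε * ‖v p‖ := by fun_prop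
      exact (this.tendsto 0).eventually_lt_const (by simpa using hδ)
    obtain ⟨ε, h2, h3⟩ := (h1.and self_mem_nhdsWithin).exists
    exact ⟨ε, h3, fun p hp => (h2 p hp).1, fun p hp => (h2 p hp).2⟩
  have hin : ∀ p ∈ t, ∀ z ∈ closure Ω, D z p.1 ≤ 4 * r p ^ 2 → z + ε • v p ∈ Ω := by
    intro p hp z hz hD4
    refine hpush p z hz ?_ ε hε (hεe p hp)
    have := hDd z p.1
    have hrp := hr p
    exact abs_le_of_sq_le_sq' (by nlinarith) (by positivity) |>.2
  have hmod : ∀ p ∈ t, ∀ z ∈ closure Ω, D z p.1 ≤ 4 * r p ^ 2 → |H (z + ε • v p) - H z| < η := by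
    intro p hp z hz hD4
    refine hδu _ (subset_closure (hin p hp z hz hD4)) z hz ?_
    rw [dist_eq_norm, add_sub_cancel_left, norm_smul, Real.norm_eq_abs, abs_of_pos hε]
    exact hεv p hp
  set u : closure Ω → (Fin (n + N) → ℂ) → ℝ := fun p x =>
    (l * pr2 x j).re - H (pr1 x + ε • v p) + η * (2 - D (pr1 x) p.1 / r p ^ 2) + η * s * ∑ k, ‖x k‖ ^ 2 with hu
  obtain ⟨p, hp, y, ⟨hyY, hyD⟩, hmax⟩ := max_fin t (fun p => polyHull X ∩ {x | D (pr1 x) p.1 ≤ 4 * r p ^ 2})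
    (fun p _ => hYc.inter_right (isClosed_le ((hDc _).comp pr1_diff.continuous) continuous_const)) u
    (fun p hp => by
      have h1 : ContinuousOn (fun x : Fin (n + N) → ℂ => H (pr1 x + ε • v p)) (polyHull X ∩ {x | D (pr1 x) p.1 ≤ 4 * r p ^ 2}) :=
        hHc.comp ((pr1_diff.continuous.add continuous_const).continuousOn)
          fun x hx => subset_closure (hin p hp _ (hproj x hx.1) hx.2)
      have h2 : Continuous fun x : Fin (n + N) → ℂ => (l * pr2 x j).re :=
        Complex.continuous_re.comp (continuous_const.mul (pr2_diff j).continuous)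
      have h3 : Continuous fun x : Fin (n + N) → ℂ => η * (2 - D (pr1 x) p.1 / r p ^ 2) :=
        continuous_const.mul (continuous_const.sub (((hDc _).comp pr1_diff.continuous).div_const _))
      have h4 : Continuous fun x : Fin (n + N) → ℂ => η * s * ∑ k, ‖x k‖ ^ 2 := by fun_prop
      exact ((h2.continuousOn.sub h1).add h3.continuousOn).add h4.continuousOn)
    (by
      obtain ⟨p, hp, hlt⟩ := ht' _ (hproj x0 hx0)
      exact ⟨p, hp, x0, hx0, by have := hr p; show D _ _ ≤ _; nlinarith⟩)
  have hlow : ∀ x ∈ polyHull X, (l * pr2 x j).re - H (pr1 x) + η * s * ∑ k, ‖x k‖ ^ 2 < u p y := by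
    intro x hx
    obtain ⟨q, hq, hlt⟩ := ht' _ (hproj x hx)
    have hrq := hr q
    have h4 : D (pr1 x) q.1 ≤ 4 * r q ^ 2 := by nlinarith
    have h1 := hmax q hq x ⟨hx, h4⟩
    have h2 := (abs_lt.1 (hmod q hq _ (hproj x hx) h4)).2
    have h3 : D (pr1 x) q.1 / r q ^ 2 < 1 := by rw [div_lt_one (by positivity)]; exact hlt
    have h5 : η < η * (2 - D (pr1 x) q.1 / r q ^ 2) := by nlinarith
    refine lt_of_lt_of_le ?_ h1
    simp only [hu]; linarith
  have hrp := hr p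
  have hmy := abs_lt.1 (hmod p hp _ (hproj y hyY) hyD)
  have hlt4 : D (pr1 y) p.1 < 4 * r p ^ 2 := by
    refine lt_of_le_of_ne hyD fun heq => ?_
    have h1 := hlow y hyY
    simp only [hu, heq] at h1
    rw [mul_div_assoc, div_self (by positivity)] at h1
    linarith [hmy.1]
  have hD0 : ∀ z q, 0 ≤ D z q := fun z q => Finset.sum_nonneg fun k _ => by positivity
  have hyX : y ∉ X := by
    intro hyX
    have h1 := hlow x0 hx0
    have h2 := (mem_graph.1 hyX).2 j
    have h3 : (l * pr2 x0 j).re - H (pr1 x0) = m := by rw [hm, hH]; simp only [mul_sub, Complex.sub_re]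
    have h4 : (l * pr2 y j).re = H (pr1 y) := by rw [h2]
    have h5 : 0 ≤ η * s * ∑ k, ‖x0 k‖ ^ 2 := by positivity
    have h6 : η * s * ∑ k, ‖y k‖ ^ 2 ≤ η * s * R := mul_le_mul_of_nonneg_left (hRb y hyY) (by positivity)
    have h7 : 0 ≤ η * (D (pr1 y) p.1 / r p ^ 2) := mul_nonneg hη.le (div_nonneg (hD0 _ _) (by positivity))
    simp only [hu] at h1
    linarith [hmy.1]
  obtain ⟨U, hU, hyU, hUΩ, F, G, hF, hG, hFG⟩ := hph j _ (hin p hp _ (hproj y hyY) hyD)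
  set τ := η * s with hτ
  set κ := η / r p ^ 2 with hκ
  have hκτ : κ < τ := by
    have h1 : 1 / r p ^ 2 ≤ ∑ p ∈ t, 1 / r p ^ 2 := Finset.single_le_sum (f := fun p => 1 / r p ^ 2) (fun p _ => by positivity) hp
    rw [hκ, hτ, div_eq_mul_one_div]
    exact mul_lt_mul_of_pos_left (by linarith) hη
  set V : Set (Fin (n + N) → ℂ) := {x | pr1 x + ε • v p ∈ U ∧ D (pr1 x) p.1 < 4 * r p ^ 2} with hV
  have hsc : Continuous fun x : Fin (n + N) → ℂ => pr1 x + ε • v p := pr1_diff.continuous.add continuous_const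
  have hVo : IsOpen V := (hU.preimage hsc).inter (isOpen_lt ((hDc _).comp pr1_diff.continuous) continuous_const)
  set L : (Fin (n + N) → ℂ) → ℂ := fun x => l * pr2 x j - (l * F (pr1 x + ε • v p) + starRingEnd ℂ l * G (pr1 x + ε • v p))
    - κ * ∑ k, 2 * (starRingEnd ℂ (pr1 y k - p.1 k) * (pr1 x k - pr1 y k)) + τ * ∑ k, 2 * (starRingEnd ℂ (y k) * (x k - y k)) with hL
  have hLd : DifferentiableOn ℂ L V := by
    have hmaps : Set.MapsTo (fun x : Fin (n + N) → ℂ => pr1 x + ε • v p) V U := fun x hx => hx.1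
    have hd : DifferentiableOn ℂ (fun x : Fin (n + N) → ℂ => pr1 x + ε • v p) V := (pr1_diff.add_const _).differentiableOn
    have hp2 := (pr2_diff (n := n) j).differentiableOn (s := V)
    have hF2 : DifferentiableOn ℂ (fun x => F (pr1 x + ε • v p)) V := hF.comp hd hmaps
    have hG2 : DifferentiableOn ℂ (fun x => G (pr1 x + ε • v p)) V := hG.comp hd hmaps
    have h5 : Differentiable ℂ fun x : Fin (n + N) → ℂ => ∑ k, 2 * (starRingEnd ℂ (pr1 y k - p.1 k) * (pr1 x k - pr1 y k)) := by
      unfold pr1; fun_prop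
    have h6 : Differentiable ℂ fun x : Fin (n + N) → ℂ => ∑ k, 2 * (starRingEnd ℂ (y k) * (x k - y k)) := by fun_prop
    exact (((hp2.const_mul _).sub ((hF2.const_mul _).add (hG2.const_mul _))).sub (h5.differentiableOn.const_mul _)).add (h6.differentiableOn.const_mul _)
  have hHre : ∀ x ∈ V, (l * F (pr1 x + ε • v p) + starRingEnd ℂ l * G (pr1 x + ε • v p)).re = H (pr1 x + ε • v p) := by
    intro x hx
    rw [hH]; simp only; rw [hFG _ hx.1, mul_add, Complex.add_re, Complex.add_re]
    congr 1
    rw [← Complex.conj_re, map_mul, Complex.conj_conj]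
  have hkey : ∀ x ∈ V, (L x).re = u p x - 2 * η + κ * D (pr1 y) p.1 - τ * ∑ k, ‖y k‖ ^ 2 + κ * ∑ k, ‖pr1 x k - pr1 y k‖ ^ 2 - τ * ∑ k, ‖x k - y k‖ ^ 2 := by
    intro x hx
    have h1 : (∑ k, 2 * (starRingEnd ℂ (pr1 y k - p.1 k) * (pr1 x k - pr1 y k))).re = D (pr1 x) p.1 - D (pr1 y) p.1 - ∑ k, ‖pr1 x k - pr1 y k‖ ^ 2 := by
      rw [hD]; simp only; rw [Complex.re_sum, ← Finset.sum_sub_distrib, ← Finset.sum_sub_distrib]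
      refine Finset.sum_congr rfl fun k _ => ?_
      rw [sq_expand, sub_sub_sub_cancel_right]
      simp
    have h2 : (∑ k, 2 * (starRingEnd ℂ (y k) * (x k - y k))).re = ∑ k, ‖x k‖ ^ 2 - ∑ k, ‖y k‖ ^ 2 - ∑ k, ‖x k - y k‖ ^ 2 := by
      rw [Complex.re_sum, ← Finset.sum_sub_distrib, ← Finset.sum_sub_distrib]
      refine Finset.sum_congr rfl fun k _ => ?_
      rw [sq_expand]; simp
    simp only [hL]
    rw [Complex.add_re, Complex.sub_re, Complex.sub_re, hHre x hx, Complex.re_ofReal_mul, Complex.re_ofReal_mul, h1, h2]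
    simp only [hu]
    have : η * (2 - D (pr1 x) p.1 / r p ^ 2) = 2 * η - κ * D (pr1 x) p.1 := by rw [hκ]; ring
    rw [this]; ring
  have hyV : y ∈ V := ⟨hyU, hlt4⟩
  refine LMPh hXc hyY hyX hVo hyV hLd fun x hx hxV hxy => ?_
  rw [hkey x hxV, hkey y hyV]
  have h1 := hmax p hp x ⟨hx, hxV.2.le⟩
  simp only [sub_self, norm_zero]
  have h2 : ∑ k, ‖pr1 x k - pr1 y k‖ ^ 2 ≤ ∑ k, ‖x k - y k‖ ^ 2 := by
    rw [Fin.sum_univ_add]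
    exact le_add_of_nonneg_right (Finset.sum_nonneg fun k _ => by positivity)
  have h3 : 0 < ∑ k, ‖x k - y k‖ ^ 2 := by
    have := sum_sq_ge (x - y)
    have h4 := norm_pos_iff.2 (sub_ne_zero.2 hxy)
    exact lt_of_lt_of_le (by positivity) this
  have hκ0 : 0 ≤ κ := by positivity
  have h4 : κ * ∑ k, ‖pr1 x k - pr1 y k‖ ^ 2 ≤ κ * ∑ k, ‖x k - y k‖ ^ 2 := mul_le_mul_of_nonneg_left h2 hκ0
  have h5 : κ * ∑ k, ‖x k - y k‖ ^ 2 < τ * ∑ k, ‖x k - y k‖ ^ 2 := mul_lt_mul_of_pos_right hκτ h3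
  simp
  linarith

def DI {E : Type} [PseudoMetricSpace E] (Z : Set E) : Prop := ∀ z ∈ Z, ∀ r > 0, ∃ z' ∈ Z, z' ≠ z ∧ dist z' z < r

def Ker {E : Type} [PseudoMetricSpace E] {N : ℕ} (U : Set E) (G : Fin N → E → ℂ) : Set E :=
  {z | ∃ Z ⊆ U, (∀ w ∈ Z, ∀ j, G j w = 0) ∧ DI Z ∧ z ∈ Z}

theorem DI_inter {E : Type} [PseudoMetricSpace E] {Z V : Set E} (hZ : DI Z) (hV : IsOpen V) : DI (Z ∩ V) := by
  rintro z ⟨hz, hzV⟩ r hr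
  obtain ⟨s, hs, hb⟩ := Metric.isOpen_iff.1 hV z hzV
  obtain ⟨z', h1, h2, h3⟩ := hZ z hz (min r s) (lt_min hr hs)
  exact ⟨z', ⟨h1, hb (h3.trans_le (min_le_right _ _))⟩, h2, h3.trans_le (min_le_left _ _)⟩

theorem Ker_sub {E : Type} [PseudoMetricSpace E] {N : ℕ} {U : Set E} {G : Fin N → E → ℂ} : Ker U G ⊆ U :=
  fun _ ⟨_, h, _, _, hz⟩ => h hz

theorem Ker_zero {E : Type} [PseudoMetricSpace E] {N : ℕ} {U : Set E} {G : Fin N → E → ℂ} {z : E} (hz : z ∈ Ker U G) (j) : G j z = 0 := by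
  obtain ⟨Z, -, h, -, hz⟩ := hz; exact h z hz j

theorem Ker_DI {E : Type} [PseudoMetricSpace E] {N : ℕ} (U : Set E) (G : Fin N → E → ℂ) : DI (Ker U G) := by
  rintro z ⟨Z, h1, h2, h3, hz⟩ r hr
  obtain ⟨z', h4, h5⟩ := h3 z hz r hr
  exact ⟨z', ⟨Z, h1, h2, h3, h4⟩, h5⟩

theorem Ker_closed {E : Type} [MetricSpace E] {N : ℕ} {U : Set E} (hU : IsOpen U) {G : Fin N → E → ℂ} (hG : ∀ j, ContinuousOn (G j) U)
    {z : E} (hz : z ∈ closure (Ker U G)) (hzU : z ∈ U) : z ∈ Ker U G := by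
  by_cases hzK : z ∈ Ker U G
  · exact hzK
  refine ⟨insert z (Ker U G), Set.insert_subset hzU Ker_sub, ?_, ?_, Set.mem_insert _ _⟩
  · rintro w (rfl | hw) j
    · by_contra hne
      have h1 : ∀ᶠ x in nhds w, G j x ≠ 0 := ((hG j).continuousAt (hU.mem_nhds hzU)).eventually_ne hne
      obtain ⟨x, hx, hxK⟩ := mem_closure_iff_nhds.1 hz _ h1
      exact hx (Ker_zero hxK j)
    · exact Ker_zero hw j
  · rintro w (rfl | hw) r hr
    · obtain ⟨x, hx, hd⟩ := Metric.mem_closure_iff.1 hz r hr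
      exact ⟨x, Or.inr hx, fun h => hzK (h ▸ hx), by rwa [dist_comm]⟩
    · obtain ⟨x, hx, h⟩ := Ker_DI U G w hw r hr
      exact ⟨x, Or.inr hx, h⟩

noncomputable def Psi {E : Type} {M : ℕ} (q : E → ℂ) (e : Fin M → E → ℂ) (z : E) : ℝ := ‖q z‖ * Real.exp (∑ i, ‖e i z‖ ^ 2)

theorem Psi_cont {E : Type} [TopologicalSpace E] {M : ℕ} {q : E → ℂ} {e : Fin M → E → ℂ} {U : Set E} (hq : ContinuousOn q U) (he : ∀ i, ContinuousOn (e i) U) :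
    ContinuousOn (Psi q e) U := by
  unfold Psi
  exact hq.norm.mul (Real.continuous_exp.comp_continuousOn (continuousOn_finsetSum _ fun i _ => (he i).norm.pow 2))

/-- rewriting the weight around a base point -/
theorem Psi_base {E : Type} {M : ℕ} (q : E → ℂ) (e : Fin M → E → ℂ) (z0 z : E) :
    ‖q z * Complex.exp (∑ i, 2 * (starRingEnd ℂ (e i z0) * (e i z - e i z0)))‖ * Real.exp (∑ i, ‖e i z - e i z0‖ ^ 2) * Real.exp (∑ i, ‖e i z0‖ ^ 2) = Psi q e z := by
  rw [Psi, norm_mul, Complex.norm_exp, mul_assoc, mul_assoc, ← Real.exp_add, ← Real.exp_add, Complex.re_sum, ← Finset.sum_add_distrib, ← Finset.sum_add_distrib]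
  congr 2
  refine Finset.sum_congr rfl fun i _ => ?_
  have := sq_expand (e i z) (e i z0)
  have h2 : (2 * (starRingEnd ℂ (e i z0) * (e i z - e i z0))).re = 2 * (starRingEnd ℂ (e i z0) * (e i z - e i z0)).re := by simp
  rw [h2]; linarith

theorem Psi_str {E : Type} {M : ℕ} (q : E → ℂ) (e : Fin M → E → ℂ) (d : E → ℂ) (z0 z : E) (k : ℕ) :
    Psi (fun z => (q z * Complex.exp (∑ i, starRingEnd ℂ (e i z0) * (e i z - e i z0))) ^ k * d z)
      (fun i z => ((√(k / 2) : ℝ) : ℂ) * e i z) z =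
    (Psi q e z * Real.exp (-(∑ i, ‖e i z - e i z0‖ ^ 2) / 2)) ^ k * ‖d z‖ * Real.exp (-(k / 2 * ∑ i, ‖e i z0‖ ^ 2)) := by
  rw [Psi, ← Psi_base q e z0 z]
  have h1 : ∀ i, ‖((√(k / 2) : ℝ) : ℂ) * e i z‖ ^ 2 = k / 2 * ‖e i z‖ ^ 2 := fun i => by
    rw [norm_mul, mul_pow, Complex.norm_real, Real.norm_eq_abs, sq_abs, Real.sq_sqrt (by positivity)]
  have h2 : ∀ i, ‖e i z‖ ^ 2 = ‖e i z0‖ ^ 2 + ‖e i z - e i z0‖ ^ 2 + 2 * (starRingEnd ℂ (e i z0) * (e i z - e i z0)).re := fun i => by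
    linarith [sq_expand (e i z) (e i z0)]
  set A := ∑ i, (starRingEnd ℂ (e i z0) * (e i z - e i z0)).re with hA
  set B := ∑ i, ‖e i z - e i z0‖ ^ 2 with hB
  set C := ∑ i, ‖e i z0‖ ^ 2 with hC
  have h3 : ∑ i, ‖((√(k / 2) : ℝ) : ℂ) * e i z‖ ^ 2 = k / 2 * (C + B + 2 * A) := by
    rw [Finset.sum_congr rfl fun i _ => h1 i, ← Finset.mul_sum, Finset.sum_congr rfl fun i _ => h2 i, Finset.sum_add_distrib, Finset.sum_add_distrib, ← Finset.mul_sum]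
  have h4 : (∑ i, starRingEnd ℂ (e i z0) * (e i z - e i z0)).re = A := Complex.re_sum _ _
  have h5 : (∑ i, 2 * (starRingEnd ℂ (e i z0) * (e i z - e i z0))).re = 2 * A := by
    rw [← Finset.mul_sum]; simp [← h4]
  rw [h3, norm_mul, norm_pow, norm_mul, norm_mul, Complex.norm_exp, Complex.norm_exp, h4, h5]
  simp only [mul_pow, ← Real.exp_nat_mul]
  have : Real.exp (k * A) * Real.exp (k / 2 * (C + B + 2 * A)) = Real.exp (k * (2 * A)) * Real.exp (k * B) * Real.exp (k * C) * Real.exp (k * (-B / 2)) * Real.exp (-(k / 2 * C)) := by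
    simp only [← Real.exp_add]; congr 1; ring
  linear_combination ‖q z‖ ^ k * ‖d z‖ * this

theorem Qmax (N M : ℕ) (d : ℕ) : ∀ (E : Type) [NormedAddCommGroup E] [NormedSpace ℂ E] [FiniteDimensional ℂ E],
    Module.finrank ℂ E = d → ∀ (U : Set E), IsOpen U → ∀ (G : Fin N → E → ℂ), (∀ j, DifferentiableOn ℂ (G j) U) →
    ∀ q : E → ℂ, DifferentiableOn ℂ q U → ∀ e : Fin M → E → ℂ, (∀ i, DifferentiableOn ℂ (e i) U) →
    (∀ x ∈ U, ∀ y ∈ U, (∀ i, e i x = e i y) → x = y) → ∀ z0 ∈ Ker U G, q z0 ≠ 0 →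
    ∃ z ∈ Ker U G, Psi q e z0 < Psi q e z := by
  induction d with
  | zero =>
    intro E _ _ _ hd U hU G hG q hq e he hinj z0 hz0 hq0
    obtain ⟨z', -, h, -⟩ := Ker_DI U G z0 hz0 1 one_pos
    have := Module.finrank_zero_iff.1 hd
    exact (h (Subsingleton.elim _ _)).elim
  | succ d ih =>
    intro E _ _ _ hd U hU G hG q hq e he hinj z0 hz0 hq0
    by_contra! hmax
    have hz0U := Ker_sub hz0
    have : Nontrivial E := Module.nontrivial_of_finrank_pos (R := ℂ) (by omega)
    have hne : ∀ z ∈ U, z ≠ z0 → 0 < ∑ i, ‖e i z - e i z0‖ ^ 2 := fun z hz hzz => by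
      refine lt_of_le_of_ne (Finset.sum_nonneg fun i _ => by positivity) fun h0 => hzz (hinj z hz z0 hz0U fun i => ?_)
      rw [eq_comm, Finset.sum_eq_zero_iff_of_nonneg (fun j _ => by positivity)] at h0
      have := h0 i (Finset.mem_univ i)
      exact sub_eq_zero.1 (by simpa using this)
    have hPpos : 0 < Psi q e z0 := mul_pos (norm_pos_iff.2 hq0) (Real.exp_pos _)
    by_cases hA : ∀ j, ∀ᶠ w in nhds z0, G j w = 0
    · have hev : ∀ᶠ w in nhds z0, w ∈ U ∧ ∀ j, G j w = 0 :=
        Filter.Eventually.and (hU.mem_nhds hz0U) (Filter.eventually_all.2 hA)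
      obtain ⟨r, hr, hrb⟩ := Metric.eventually_nhds_iff.1 hev
      have hDI : DI (ball z0 r) := by
        have : DI (Set.univ : Set E) := fun z _ s hs => by
          obtain ⟨x, hx⟩ := (inferInstance : (nhdsWithin z {z}ᶜ).NeBot).nonempty_of_mem (inter_mem_nhdsWithin _ (ball_mem_nhds z hs))
          exact ⟨x, trivial, hx.1, hx.2⟩
        simpa using DI_inter this (isOpen_ball (x := z0) (ε := r))
      have hK : ball z0 r ⊆ Ker U G := fun z hz => ⟨ball z0 r, fun w hw => (hrb hw).1, fun w hw => (hrb hw).2, hDI, hz⟩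
      set k : E → ℂ := fun z => q z * Complex.exp (∑ i, 2 * (starRingEnd ℂ (e i z0) * (e i z - e i z0))) with hk
      have hkd : DifferentiableOn ℂ k U :=
        hq.mul (DifferentiableOn.cexp (DifferentiableOn.fun_sum fun i _ => (((he i).sub_const _).const_mul _).const_mul _))
      have hb : ∀ z ∈ ball z0 r, ‖k z‖ * Real.exp (∑ i, ‖e i z - e i z0‖ ^ 2) ≤ ‖k z0‖ := by
        intro z hz
        have h1 := hmax z (hK hz)
        rw [← Psi_base q e z0 z, ← Psi_base q e z0 z0, mul_le_mul_iff_left₀ (Real.exp_pos _)] at h1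
        simpa [hk] using h1
      have hloc : IsLocalMax (norm ∘ k) z0 := by
        filter_upwards [ball_mem_nhds z0 hr] with z hz
        refine le_trans ?_ (hb z hz)
        exact le_mul_of_one_le_right (norm_nonneg _) (Real.one_le_exp (Finset.sum_nonneg fun i _ => by positivity))
      have hconst := Complex.norm_eventually_eq_of_isLocalMax (Filter.eventually_of_mem (hU.mem_nhds hz0U) fun z hz => hkd.differentiableAt (hU.mem_nhds hz)) hloc
      obtain ⟨x, ⟨hx1, hx2⟩, hx3⟩ := (Filter.Eventually.and (nhdsWithin_le_nhds (hconst.and (ball_mem_nhds z0 hr))) (self_mem_nhdsWithin (a := z0) (s := {z0}ᶜ))).exists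
      have h1 := hb x hx2
      rw [hx1] at h1
      have hk0 : 0 < ‖k z0‖ := norm_pos_iff.2 (mul_ne_zero hq0 (Complex.exp_ne_zero _))
      have h2 : Real.exp (∑ i, ‖e i x - e i z0‖ ^ 2) ≤ 1 := by
        by_contra! h3; nlinarith
      rw [Real.exp_le_one_iff] at h2
      linarith [hne x (Ker_sub (hK hx2)) hx3]
    · push Not at hA
      obtain ⟨j, hj⟩ := hA
      set T := Ker U G with hT
      have hex : ∃ k, ∃ᶠ z in nhdsWithin z0 T, iteratedFDeriv ℂ k (G j) z ≠ 0 := by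
        by_contra! hcon
        obtain ⟨R, hR, hRb⟩ := Metric.isOpen_iff.1 hU z0 hz0U
        have := zero_of_iter ((hG j).mono hRb) (fun k => by
          exact (hcon k).self_of_nhdsWithin hz0)
        exact hj (Filter.eventually_of_mem (ball_mem_nhds z0 hR) fun w hw => not_not.2 (this w hw))
      classical
      have hk := Nat.find_spec hex
      have hmin := fun k => Nat.find_min hex (m := k)
      set k := Nat.find hex
      rcases hkm : k with _ | m
      · rw [hkm] at hk
        obtain ⟨z, hz1, hz2⟩ := (hk.and_eventually self_mem_nhdsWithin).exists
        apply hz1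
        ext w; simpa using Ker_zero hz2 j
      rw [hkm] at hk hmin
      have hm := hmin m (Nat.lt_succ_self m)
      rw [Filter.not_frequently] at hm
      simp only [not_not] at hm
      rw [eventually_nhdsWithin_iff, _root_.eventually_nhds_iff] at hm
      obtain ⟨O, hO, hOo, hzO⟩ := hm
      obtain ⟨R', hR', hRb⟩ := Metric.isOpen_iff.1 (hU.inter hOo) z0 ⟨hz0U, hzO⟩
      set R := R' / 2 with hRdef
      have hR : 0 < R := by positivity
      have hcb : closedBall z0 R ⊆ U ∩ O := (closedBall_subset_ball (by linarith)).trans hRb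
      have hcT : IsCompact (T ∩ closedBall z0 R) := by
        have : T ∩ closedBall z0 R = closure T ∩ closedBall z0 R :=
          Set.Subset.antisymm (Set.inter_subset_inter_left _ subset_closure)
            fun z hz => ⟨Ker_closed hU (fun j => (hG j).continuousOn) hz.1 (hcb hz.2).1, hz.2⟩
        rw [this]
        exact (isCompact_closedBall _ _).inter_left isClosed_closure
      have hec : ContinuousOn (fun z => ∑ i, ‖e i z - e i z0‖ ^ 2) U :=
        continuousOn_finsetSum _ fun i _ => ((he i).continuousOn.sub continuousOn_const).norm.pow 2
      obtain ⟨c, hc, hcs⟩ := (isCompact_sphere z0 R).exists_forall_le' (f := fun z => ∑ i, ‖e i z - e i z0‖ ^ 2) (a := 0)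
        (hec.mono fun z hz => (hcb (sphere_subset_closedBall hz)).1)
        (fun z hz => hne z (hcb (sphere_subset_closedBall hz)).1 (by rintro rfl; simp at hz; linarith))
      set P : E → ℝ := fun z => Psi q e z * Real.exp (-(∑ i, ‖e i z - e i z0‖ ^ 2) / 2) with hP
      have hPc : ContinuousOn P U := (Psi_cont hq.continuousOn fun i => (he i).continuousOn).mul
        (Real.continuous_exp.comp_continuousOn (hec.neg.div_const _))
      have hP0 : P z0 = Psi q e z0 := by simp [hP]
      set θ := Real.exp (-c / 2) * Psi q e z0 with hθ
      have hθ0 : 0 < θ := mul_pos (Real.exp_pos _) hPpos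
      have hPs : ∀ z ∈ T, z ∈ sphere z0 R → P z ≤ θ := fun z hz hzs => by
        rw [hP, hθ, mul_comm (Real.exp _)]
        have := hcs z hzs
        exact mul_le_mul (hmax z hz) (Real.exp_le_exp.2 (by linarith)) (Real.exp_pos _).le hPpos.le
      have hev1 : ∀ᶠ z in nhds z0, θ < P z := (hPc.continuousAt (hU.mem_nhds hz0U)).eventually_const_lt (by
        rw [hP0, hθ]
        have : Real.exp (-c / 2) < 1 := Real.exp_lt_one_iff.2 (by linarith)
        nlinarith)
      obtain ⟨z1, hz1, ⟨hz1T, hz1b⟩, hz1P⟩ := (hk.and_eventually ((Filter.Eventually.and self_mem_nhdsWithin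
        (nhdsWithin_le_nhds (ball_mem_nhds z0 hR))).and (nhdsWithin_le_nhds hev1))).exists
      obtain ⟨u, v, huv⟩ := iter_next hU (hG j) (Ker_sub hz1T) hz1
      set g := fun z => iteratedFDeriv ℂ m (G j) z v with hgdef
      have hgd : DifferentiableOn ℂ g U := iter_app_diff hU (hG j) m v
      have hgT : ∀ z ∈ T, z ∈ closedBall z0 R → g z = 0 := fun z hz hzb => by
        simp only [hgdef, hO z (hcb hzb).2 hz]; rfl
      set δ : E → ℂ := fun z => fderiv ℂ g z u with hδ
      have hδd : DifferentiableOn ℂ δ U := (fderiv_diff hU hgd).clm_apply (differentiableOn_const _)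
      obtain ⟨Mδ, hMδ⟩ := (isCompact_closedBall z0 R).exists_bound_of_continuousOn (hδd.continuousOn.mono fun z hz => (hcb hz).1)
      have hδ1 : 0 < ‖δ z1‖ := norm_pos_iff.2 huv
      have hMpos : 0 < Mδ := hδ1.trans_le (hMδ z1 (ball_subset_closedBall hz1b))
      have hPz1 : 0 < P z1 := hθ0.trans hz1P
      obtain ⟨k', hk'⟩ := exists_pow_lt_of_lt_one (show 0 < ‖δ z1‖ / Mδ by positivity) (show θ / P z1 < 1 by rwa [div_lt_one hPz1])
      set s := k' + 1 with hs
      have hs' : θ ^ s * Mδ < P z1 ^ s * ‖δ z1‖ := by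
        have h1 : (θ / P z1) ^ s < ‖δ z1‖ / Mδ := lt_of_le_of_lt (pow_le_pow_of_le_one (by positivity) ((div_lt_one hPz1).2 hz1P).le (Nat.le_succ k')) hk'
        rw [div_pow, div_lt_div_iff₀ (by positivity) hMpos] at h1
        linarith
      set Ξ : E → ℝ := fun z => P z ^ s * ‖δ z‖ with hΞ
      obtain ⟨z2, ⟨hz2T, hz2b⟩, hz2⟩ := hcT.exists_isMaxOn ⟨z1, hz1T, ball_subset_closedBall hz1b⟩
        (f := Ξ) (((hPc.pow s).mul hδd.continuousOn.norm).mono fun z hz => (hcb hz.2).1)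
      have hz2' : ∀ z ∈ T, z ∈ closedBall z0 R → Ξ z ≤ Ξ z2 := fun z h1 h2 => hz2 ⟨h1, h2⟩
      have h21 := hz2' z1 hz1T (ball_subset_closedBall hz1b)
      have hP0' : ∀ z, 0 ≤ P z := fun z => mul_nonneg (mul_nonneg (norm_nonneg _) (Real.exp_pos _).le) (Real.exp_pos _).le
      have hz2ball : z2 ∈ ball z0 R := by
        by_contra hcon
        have hsp : z2 ∈ sphere z0 R := le_antisymm hz2b (not_lt.1 hcon)
        have : Ξ z2 ≤ θ ^ s * Mδ := mul_le_mul (pow_le_pow_left₀ (hP0' _) (hPs z2 hz2T hsp) s) (hMδ z2 hz2b) (norm_nonneg _) (by positivity)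
        linarith
      have hΞ2 : 0 < Ξ z2 := lt_of_lt_of_le (by positivity) h21
      have hδ2 : δ z2 ≠ 0 := fun h0 => by simp [hΞ, h0] at hΞ2
      have hq2 : q z2 ≠ 0 := fun h0 => by simp [hΞ, hP, Psi, h0, hs] at hΞ2
      have hbU : ball z0 R ⊆ U := fun z hz => (hcb (ball_subset_closedBall hz)).1
      obtain ⟨K, hK, V, W, σ, π, hV, hW, hz2W, hWb, hσ, hπ, hσV, hWg⟩ := chart isOpen_ball (hgd.mono hbU) hz2ball (hgT z2 hz2T hz2b)
        (fun h0 => hδ2 (by rw [hδ]; simp only; rw [h0]; rfl))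
      have hgW : ∀ z ∈ T, z ∈ W → g z = 0 := fun z hz hzW => hgT z hz (ball_subset_closedBall (hWb hzW))
      have hσU : Set.MapsTo σ V U := fun x hx => hbU (hWb (hσV x hx).1)
      have hπ2 := hWg z2 hz2W (hgW z2 hz2T hz2W)
      have hs0 : (0:ℝ) < √((s:ℝ) / 2) := Real.sqrt_pos.2 (by positivity)
      have hcomp : ∀ x, Psi (fun x => (q (σ x) * Complex.exp (∑ i, starRingEnd ℂ (e i z0) * (e i (σ x) - e i z0))) ^ s * δ (σ x))
          (fun i x => ((√(s / 2) : ℝ) : ℂ) * e i (σ x)) x = Ξ (σ x) * Real.exp (-(s / 2 * ∑ i, ‖e i z0‖ ^ 2)) := fun x =>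
        Psi_str q e δ z0 (σ x) s
      obtain ⟨x, ⟨Z, hZV, hZG, hZD, hxZ⟩, hx⟩ := ih K (by omega) V hV (fun i x => G i (σ x)) (fun i => (hG i).comp hσ hσU)
        (fun x => (q (σ x) * Complex.exp (∑ i, starRingEnd ℂ (e i z0) * (e i (σ x) - e i z0))) ^ s * δ (σ x))
        (by
          have h1 : DifferentiableOn ℂ (fun z => (q z * Complex.exp (∑ i, starRingEnd ℂ (e i z0) * (e i z - e i z0))) ^ s * δ z) U :=
            ((hq.mul (DifferentiableOn.cexp (DifferentiableOn.fun_sum fun i _ => ((he i).sub_const _).const_mul _))).pow s).mul hδd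
          exact h1.comp hσ hσU)
        (fun i x => ((√(s / 2) : ℝ) : ℂ) * e i (σ x)) (fun i => ((he i).comp hσ hσU).const_mul _)
        (fun x hx y hy hxy => by
          have h1 : σ x = σ y := hinj _ (hσU hx) _ (hσU hy) fun i => mul_left_cancel₀ (by exact_mod_cast hs0.ne') (hxy i)
          rw [← (hσV x hx).2.2, ← (hσV y hy).2.2, h1])
        (π z2) ⟨{x | x ∈ V ∧ σ x ∈ T}, fun x hx => hx.1, fun x hx i => Ker_zero hx.2 i, by
          rintro x ⟨hx, hxT⟩ r hr
          have hc : ∀ᶠ z in nhds (σ x), dist (π z) (π (σ x)) < r ∧ z ∈ W :=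
            (hπ.continuousAt.eventually (ball_mem_nhds (π (σ x)) hr)).and (hW.mem_nhds (hσV x hx).1)
          obtain ⟨δ, hδ, hδ2⟩ := Metric.eventually_nhds_iff.1 hc
          obtain ⟨z', hz', hne, hlt⟩ := Ker_DI U G _ hxT δ hδ
          have h1 := hδ2 hlt
          have h2 := hWg z' h1.2 (hgW z' hz' h1.2)
          refine ⟨π z', ⟨h2.1, ?_⟩, ?_, ?_⟩
          · show σ (π z') ∈ T
            rw [h2.2]; exact hz'
          · intro h; apply hne; rw [← h2.2, h]
          · have := h1.1; rwa [(hσV x hx).2.2] at this, hπ2.1, by show σ (π z2) ∈ T; rw [hπ2.2]; exact hz2T⟩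
        (by
          show (q (σ (π z2)) * _) ^ s * δ (σ (π z2)) ≠ 0
          rw [hπ2.2]
          exact mul_ne_zero (pow_ne_zero _ (mul_ne_zero hq2 (Complex.exp_ne_zero _))) hδ2)
      rw [hcomp, hcomp, hπ2.2, mul_lt_mul_iff_left₀ (Real.exp_pos _)] at hx
      have hσx : σ x ∈ T := by
        refine ⟨σ '' Z, ?_, ?_, ?_, ⟨x, hxZ, rfl⟩⟩
        · rintro _ ⟨y, hy, rfl⟩; exact hσU (hZV hy)
        · rintro _ ⟨y, hy, rfl⟩ i; exact hZG y hy i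
        · rintro _ ⟨y, hy, rfl⟩ r hr
          have hc := (hσ.continuousOn.continuousAt (hV.mem_nhds (hZV hy))).eventually (ball_mem_nhds _ hr)
          obtain ⟨δ, hδ, hδ2⟩ := Metric.eventually_nhds_iff.1 hc
          obtain ⟨y', hy', hne, hlt⟩ := hZD y hy δ hδ
          refine ⟨σ y', ⟨y', hy', rfl⟩, fun h => hne ?_, hδ2 hlt⟩
          rw [← (hσV y' (hZV hy')).2.2, ← (hσV y (hZV hy)).2.2, h]
      have := hz2' _ hσx (ball_subset_closedBall (hWb (hσV x (hZV hxZ)).1))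
      linarith

theorem real_const {f : ℂ → ℂ} {c : ℂ} {s : ℝ} (hf : DifferentiableOn ℂ f (ball c s)) (him : ∀ z ∈ ball c s, (f z).im = 0) :
    ∀ z ∈ ball c s, f z = f c := by
  intro z hz
  have hs : 0 < s := dist_nonneg.trans_lt hz
  rcases (hf.analyticOnNhd isOpen_ball).is_constant_or_isOpen (convex_ball c s).isPreconnected with ⟨w, hw⟩ | ho
  · rw [hw z hz, hw c (mem_ball_self hs)]
  · exfalso
    have h1 := ho (ball c s) le_rfl isOpen_ball
    obtain ⟨r, hr, hb⟩ := Metric.isOpen_iff.1 h1 (f z) ⟨z, hz, rfl⟩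
    obtain ⟨y, hy, hy2⟩ := hb (show f z + ((r / 2 : ℝ) : ℂ) * Complex.I ∈ ball (f z) r by
      rw [mem_ball, dist_eq_norm, add_sub_cancel_left, norm_mul, Complex.norm_I, Complex.norm_real, Real.norm_of_nonneg (by positivity)]
      linarith)
    have h2 := him y hy
    rw [hy2, Complex.add_im, him z hz] at h2
    simp at h2; linarith

theorem conj_const {f : ℂ → ℂ} {c : ℂ} {s : ℝ} (hf : DifferentiableOn ℂ f (ball c s)) (hf2 : DifferentiableOn ℂ (fun z => starRingEnd ℂ (f z)) (ball c s)) :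
    ∀ z ∈ ball c s, f z = f c := by
  intro z hz
  have h1 := real_const (hf.add hf2) (fun z _ => by simp) z hz
  have h2 := real_const ((hf.sub hf2).const_mul Complex.I) (fun z _ => by simp) z hz
  simp only [Pi.add_apply, Pi.sub_apply] at h1 h2
  have h3 := mul_left_cancel₀ Complex.I_ne_zero h2
  linear_combination (h1 + h3) / 2

def HP {n N : ℕ} (h : Fin N → (Fin n → ℂ) → ℂ) (Ω : Set (Fin n → ℂ)) : Set (Fin n → ℂ) :=
  {x | ∃ φ : ℂ → (Fin n → ℂ), DifferentiableOn ℂ φ (ball (0:ℂ) 1) ∧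
            (∀ z ∈ ball (0:ℂ) 1, φ z ∈ Ω) ∧
            (∃ z ∈ ball (0:ℂ) 1, ∃ w ∈ ball (0:ℂ) 1, φ z ≠ φ w) ∧
            (∀ j, DifferentiableOn ℂ (fun z => h j (φ z)) (ball (0:ℂ) 1)) ∧ ∃ t ∈ ball (0:ℂ) 1, φ t = x}

theorem HP_ker {n N : ℕ} {h : Fin N → (Fin n → ℂ) → ℂ} {Ω : Set (Fin n → ℂ)} {z : Fin n → ℂ} {r : ℝ}
    {F G : Fin N → (Fin n → ℂ) → ℂ} (hF : ∀ j, DifferentiableOn ℂ (F j) (ball z r))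
    (hG : ∀ j, DifferentiableOn ℂ (G j) (ball z r)) (hFG : ∀ j, ∀ w ∈ ball z r, h j w = F j w + starRingEnd ℂ (G j w))
    {x : Fin n → ℂ} (hx : x ∈ HP h Ω) (hxz : x ∈ ball z r) : x ∈ Ker (ball z r) (fun j w => G j w - G j x) := by
  obtain ⟨φ, hφ, hφ2, ⟨a, ha, b, hb, hab⟩, hφ3, t, ht, rfl⟩ := hx
  have hc : ∀ᶠ s in nhds t, φ s ∈ ball z r ∧ s ∈ ball (0:ℂ) 1 :=
    ((hφ.continuousOn.continuousAt (isOpen_ball.mem_nhds ht)).eventually (isOpen_ball.mem_nhds hxz)).and (isOpen_ball.mem_nhds ht)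
  obtain ⟨s, hs, hsb⟩ := Metric.eventually_nhds_iff.1 hc
  have hsub : ball t s ⊆ ball 0 1 := fun x hx => (hsb hx).2
  have hmaps : Set.MapsTo φ (ball t s) (ball z r) := fun x hx => (hsb hx).1
  refine ⟨φ '' ball t s, ?_, ?_, ?_, ⟨t, mem_ball_self hs, rfl⟩⟩
  · rintro _ ⟨x, hx, rfl⟩; exact hmaps hx
  · rintro _ ⟨x, hx, rfl⟩ j
    refine sub_eq_zero.2 (conj_const (f := fun s => G j (φ s)) ((hG j).comp (hφ.mono hsub) hmaps) ?_ x hx)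
    refine (((hφ3 j).mono hsub).sub ((hF j).comp (hφ.mono hsub) hmaps)).congr fun y hy => ?_
    show _ = h j (φ y) - F j (φ y)
    rw [hFG j _ (hmaps hy)]; ring
  · rintro _ ⟨x, hx, rfl⟩ ρ hρ
    by_contra! hcon
    have hcx := hφ.continuousOn.continuousAt (isOpen_ball.mem_nhds (hsub hx))
    have hev : φ =ᶠ[nhds x] fun _ => φ x := by
      filter_upwards [isOpen_ball.mem_nhds hx, hcx.eventually (ball_mem_nhds _ hρ)] with y hy hy2
      by_contra hne
      exact absurd (mem_ball.1 hy2) (not_lt.2 (hcon _ ⟨y, hy, rfl⟩ hne))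
    have := (hφ.analyticOnNhd isOpen_ball).eqOn_of_preconnected_of_eventuallyEq analyticOnNhd_const (convex_ball (0:ℂ) 1).isPreconnected (hsub hx) hev
    exact hab ((this ha).trans (this hb).symm)

theorem ker_HP {n N : ℕ} {h : Fin N → (Fin n → ℂ) → ℂ} {Ω : Set (Fin n → ℂ)} {z : Fin n → ℂ} {r : ℝ} (hb : ball z r ⊆ Ω)
    {F G : Fin N → (Fin n → ℂ) → ℂ} (hF : ∀ j, DifferentiableOn ℂ (F j) (ball z r))
    (hG : ∀ j, DifferentiableOn ℂ (G j) (ball z r)) (hFG : ∀ j, ∀ w ∈ ball z r, h j w = F j w + starRingEnd ℂ (G j w))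
    {x : Fin n → ℂ} (c : Fin N → ℂ) (hx : x ∈ Ker (ball z r) (fun j w => G j w - c j)) : x ∈ closure (HP h Ω) := by
  rw [Metric.mem_closure_iff]
  intro ε hε
  obtain ⟨s, hs, hsb⟩ := Metric.isOpen_iff.1 (isOpen_ball.inter isOpen_ball) x ⟨Ker_sub hx, mem_ball_self hε⟩
  have hsz : ball x s ⊆ ball z r := fun w hw => (hsb hw).1
  obtain ⟨φ, h1, h2, h3, h4⟩ := hdisc_of_perf (h := h) (Ω := ball x s) subset_rfl (fun j => (hF j).mono hsz) (fun j => (hG j).mono hsz)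
    (fun j w hw => hFG j w (hsz hw)) c (Ker (ball z r) (fun j w => G j w - c j) ∩ ball x s) Set.inter_subset_right ⟨x, hx, mem_ball_self hs⟩
    (DI_inter (Ker_DI _ _) isOpen_ball) (fun w hw j => sub_eq_zero.1 (Ker_zero hw.1 j))
  refine ⟨φ 0, ⟨φ, h1, fun w hw => hb (hsz (h2 w hw)), h3, h4, 0, by simp, rfl⟩, ?_⟩
  have := (hsb (h2 0 (by simp))).2
  rwa [mem_ball, dist_comm] at this

theorem T4 {n N : ℕ} {Ω : Set (Fin n → ℂ)} (hbd : Bornology.IsBounded Ω) (hop : IsOpen Ω)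
    {h : Fin N → (Fin n → ℂ) → ℂ} (hcont : ∀ j, ContinuousOn (h j) (closure Ω)) (hph : ∀ j, Pluriharmonic (h j) Ω)
    {t0 : Fin n → ℂ} (ht0 : t0 ∈ HP h Ω) : (Fin.append t0 (fun j => h j t0) : Fin (n + N) → ℂ) ∈ polyHull (graphSet h (frontier Ω)) := by
  have hcl : IsCompact (closure Ω) := hbd.isCompact_closure
  refine hull_of (graph_compact (hcl.of_isClosed_subset isClosed_frontier frontier_subset_closure) fun j => (hcont j).mono frontier_subset_closure) fun p C hC hCb => ?_
  by_contra! hlt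
  set qh : (Fin n → ℂ) → ℂ := fun z => MvPolynomial.eval (Fin.append z (fun j => h j z)) p with hqh
  have hqc : ContinuousOn qh (closure Ω) := (MvPolynomial.continuous_eval p).comp_continuousOn (graph_cont hcont)
  have hTΩ : HP h Ω ⊆ Ω := by rintro x ⟨φ, -, h2, -, -, t, ht, rfl⟩; exact h2 t ht
  obtain ⟨R, hR⟩ := hcl.exists_bound_of_continuousOn (f := fun z : Fin n → ℂ => ∑ i, ‖z i‖ ^ 2) (by fun_prop)
  obtain ⟨ε, hε, hεC⟩ : ∃ ε > 0, C * Real.exp (ε * R) < ‖qh t0‖ := by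
    have h1 : Continuous fun ε : ℝ => C * Real.exp (ε * R) := by fun_prop
    obtain ⟨ε, h2, h3⟩ := (Filter.Eventually.and (nhdsWithin_le_nhds ((h1.tendsto 0).eventually_lt_const (show _ < ‖qh t0‖ by simpa using hlt)))
      (self_mem_nhdsWithin (a := (0:ℝ)) (s := Set.Ioi 0))).exists
    exact ⟨ε, h3, h2⟩
  set e : Fin n → (Fin n → ℂ) → ℂ := fun i z => ((√ε : ℝ) : ℂ) * z i with he
  have hed : ∀ i, Differentiable ℂ (e i) := fun i => by rw [he]; fun_prop
  have hsq : ∀ w : ℂ, ‖((√ε : ℝ) : ℂ) * w‖ ^ 2 = ε * ‖w‖ ^ 2 := fun w => by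
    rw [norm_mul, mul_pow, Complex.norm_real, Real.norm_eq_abs, sq_abs, Real.sq_sqrt hε.le]
  set S := closure (HP h Ω) with hS
  have hSΩ : S ⊆ closure Ω := closure_mono hTΩ
  have hSc : IsCompact S := hcl.of_isClosed_subset isClosed_closure hSΩ
  have hPc : ContinuousOn (Psi qh e) (closure Ω) := Psi_cont hqc fun i => (hed i).continuous.continuousOn
  obtain ⟨z1, hz1S, hz1⟩ := hSc.exists_isMaxOn ⟨t0, subset_closure ht0⟩ (hPc.mono hSΩ)
  have hz1' : ∀ z ∈ S, Psi qh e z ≤ Psi qh e z1 := fun z hz => hz1 hz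
  have hexp : ∀ z, ∑ i, ‖e i z‖ ^ 2 = ε * ∑ i, ‖z i‖ ^ 2 := fun z => by rw [Finset.mul_sum]; exact Finset.sum_congr rfl fun i _ => hsq _
  have hge : ‖qh t0‖ ≤ Psi qh e z1 := by
    refine le_trans ?_ (hz1' t0 (subset_closure ht0))
    exact le_mul_of_one_le_right (norm_nonneg _) (Real.one_le_exp (Finset.sum_nonneg fun i _ => by positivity))
  have hpos : 0 < Psi qh e z1 := lt_of_lt_of_le (hC.trans_lt hlt) hge
  have hz1Ω : z1 ∈ Ω := by
    by_contra hcon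
    have hf : z1 ∈ frontier Ω := by rw [hop.frontier_eq]; exact ⟨hSΩ hz1S, hcon⟩
    have h1 : ‖qh z1‖ ≤ C := hCb _ ⟨z1, hf, rfl⟩
    have h2 : Psi qh e z1 ≤ C * Real.exp (ε * R) := by
      refine mul_le_mul h1 (Real.exp_le_exp.2 ?_) (Real.exp_pos _).le hC
      rw [hexp]
      exact mul_le_mul_of_nonneg_left ((le_abs_self _).trans (hR z1 (hSΩ hz1S))) hε.le
    linarith
  obtain ⟨r, hr, hb, F, G, hF, hG, hFG⟩ := local_ph hop hph hz1Ω
  set D : (Fin n → ℂ) → ℝ := fun z => ∑ i, ‖e i z - e i z1‖ ^ 2 with hD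
  have hDge : ∀ z, ε * dist z z1 ^ 2 ≤ D z := fun z => by
    have h1 : D z = ε * ∑ i, ‖(z - z1) i‖ ^ 2 := by
      rw [hD, Finset.mul_sum]; refine Finset.sum_congr rfl fun i _ => ?_
      rw [he]; simp only; rw [← mul_sub, hsq]; rfl
    rw [h1, dist_eq_norm]
    exact mul_le_mul_of_nonneg_left (sum_sq_ge _) hε.le
  set w : (Fin n → ℂ) → ℝ := fun z => Psi qh e z * Real.exp (-D z / 2) with hw
  have hDc : Continuous D := by rw [hD]; fun_prop
  have hwc : ContinuousOn w (closure Ω) := hPc.mul (by fun_prop)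
  set ρ := r / 2 with hρ
  have hρ0 : 0 < ρ := by positivity
  set θ := Psi qh e z1 * Real.exp (-(ε * ρ ^ 2) / 2) with hθ
  have hev : ∀ᶠ z in nhdsWithin z1 (HP h Ω), θ < w z ∧ z ∈ ball z1 ρ := by
    refine Filter.Eventually.and ?_ (nhdsWithin_le_nhds (ball_mem_nhds z1 hρ0))
    refine Filter.Tendsto.eventually_const_lt ?_ ((hwc z1 (hSΩ hz1S)).mono (hTΩ.trans subset_closure))
    have h1 : w z1 = Psi qh e z1 := by simp [hw, hD]
    rw [h1, hθ]
    have : Real.exp (-(ε * ρ ^ 2) / 2) < 1 := Real.exp_lt_one_iff.2 (by have : 0 < ε * ρ ^ 2 := by positivity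
                                                                        linarith)
    nlinarith
  have : (nhdsWithin z1 (HP h Ω)).NeBot := mem_closure_iff_nhdsWithin_neBot.1 hz1S
  obtain ⟨z', ⟨hz'w, hz'b⟩, hz'T⟩ := (hev.and self_mem_nhdsWithin).exists
  have hρr : closedBall z1 ρ ⊆ ball z1 r := closedBall_subset_ball (by linarith)
  set G' : Fin N → (Fin n → ℂ) → ℂ := fun j z => G j z - G j z' with hG'
  have hG'd : ∀ j, DifferentiableOn ℂ (G' j) (ball z1 r) := fun j => (hG j).sub_const _
  set T := Ker (ball z1 r) G' with hT
  have hTS : T ⊆ S := fun z hz => ker_HP hb hF hG hFG _ hz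
  have hz'K : z' ∈ T := HP_ker hF hG hFG hz'T (hρr (ball_subset_closedBall hz'b))
  have hcT : IsCompact (T ∩ closedBall z1 ρ) := by
    have : T ∩ closedBall z1 ρ = closure T ∩ closedBall z1 ρ :=
      Set.Subset.antisymm (Set.inter_subset_inter_left _ subset_closure)
        fun z hz => ⟨Ker_closed isOpen_ball (fun j => (hG'd j).continuousOn) hz.1 (hρr hz.2), hz.2⟩
    rw [this]
    exact (isCompact_closedBall _ _).inter_left isClosed_closure
  obtain ⟨z2, ⟨hz2T, hz2b⟩, hz2⟩ := hcT.exists_isMaxOn ⟨z', hz'K, ball_subset_closedBall hz'b⟩ (hwc.mono fun z hz => hSΩ (hTS hz.1))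
  have hz2' : ∀ z ∈ T, z ∈ closedBall z1 ρ → w z ≤ w z2 := fun z h1 h2 => hz2 ⟨h1, h2⟩
  have hw2 : θ < w z2 := hz'w.trans_le (hz2' z' hz'K (ball_subset_closedBall hz'b))
  have hz2ball : z2 ∈ ball z1 ρ := by
    by_contra hcon
    have hsp : dist z2 z1 = ρ := le_antisymm hz2b (not_lt.1 hcon)
    have h1 := hDge z2
    rw [hsp] at h1
    have : w z2 ≤ θ := mul_le_mul (hz1' z2 (hTS hz2T)) (Real.exp_le_exp.2 (by linarith)) (Real.exp_pos _).le hpos.le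
    linarith
  set q : (Fin n → ℂ) → ℂ := fun z => MvPolynomial.eval (Fin.append z (fun j => F j z + starRingEnd ℂ (G j z'))) p with hq
  have hqd : DifferentiableOn ℂ q (ball z1 ρ) := by
    refine (poly_diff p).comp_differentiableOn ?_
    rw [differentiableOn_pi]
    intro i
    refine Fin.addCases (fun i => ?_) (fun i => ?_) i
    · simp only [Fin.append_left]; fun_prop
    · simp only [Fin.append_right]; exact ((hF i).mono (ball_subset_closedBall.trans hρr)).add_const _
  have hqq : ∀ z ∈ T, q z = qh z := fun z hz => by
    have : ∀ j, h j z = F j z + starRingEnd ℂ (G j z') := fun j => by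
      rw [hFG j z (Ker_sub hz), sub_eq_zero.1 (Ker_zero hz j)]
    simp only [hq, hqh, this]
  have hKT : Ker (ball z1 ρ) G' ⊆ T := by
    rintro z ⟨Z, h1, h2, h3⟩
    exact ⟨Z, h1.trans (ball_subset_closedBall.trans hρr), h2, h3⟩
  have hw2q : qh z2 ≠ 0 := fun h0 => by
    have h1 : w z2 = 0 := by simp [hw, Psi, h0]
    have : 0 < θ := by positivity
    linarith
  have hps : ∀ z ∈ T, Psi (fun z => (q z * Complex.exp (∑ i, starRingEnd ℂ (e i z1) * (e i z - e i z1))) ^ 1 * 1)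
      (fun i z => ((√((1:ℕ) / 2) : ℝ) : ℂ) * e i z) z = w z * Real.exp (-((1:ℕ) / 2 * ∑ i, ‖e i z1‖ ^ 2)) := fun z hz => by
    rw [Psi_str q e (fun _ => 1) z1 z 1, hw]
    simp only [Psi, hqq z hz]
    simp [hD]
  obtain ⟨z, hz, hlt⟩ := Qmax N n n (Fin n → ℂ) (by simp) (ball z1 ρ) isOpen_ball G' (fun j => (hG'd j).mono (ball_subset_closedBall.trans hρr))
    (fun z => (q z * Complex.exp (∑ i, starRingEnd ℂ (e i z1) * (e i z - e i z1))) ^ 1 * 1)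
    (((hqd.mul (DifferentiableOn.cexp (DifferentiableOn.fun_sum fun i _ => ((hed i).differentiableOn.sub_const _).const_mul _))).pow 1).mul_const _)
    (fun i z => ((√((1:ℕ) / 2) : ℝ) : ℂ) * e i z) (fun i => (hed i).differentiableOn.const_mul _)
    (fun x _ y _ hxy => by
      ext i
      refine mul_left_cancel₀ (a := ((√ε : ℝ) : ℂ)) (by exact_mod_cast (Real.sqrt_pos.2 hε).ne') (mul_left_cancel₀ ?_ (hxy i))
      exact_mod_cast (Real.sqrt_pos.2 (by norm_num)).ne')
    z2 ⟨T ∩ ball z1 ρ, Set.inter_subset_right, fun w hw j => Ker_zero hw.1 j, DI_inter (Ker_DI _ _) isOpen_ball, hz2T, hz2ball⟩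
    (mul_ne_zero (pow_ne_zero _ (mul_ne_zero (by rw [hqq z2 hz2T]; exact hw2q) (Complex.exp_ne_zero _))) one_ne_zero)
  rw [hps z (hKT hz), hps z2 hz2T, mul_lt_mul_iff_left₀ (Real.exp_pos _)] at hlt
  have := hz2' z (hKT hz) (ball_subset_closedBall (Ker_sub hz))
  linarith

theorem T5 {n N : ℕ} {Ω : Set (Fin n → ℂ)} (hbd : Bornology.IsBounded Ω) (hop : IsOpen Ω)
    {h : Fin N → (Fin n → ℂ) → ℂ}
    (h4 : genAlg (zhGens (closure Ω) h) =
          {f : C(closure Ω, ℂ) |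
            f.comp ⟨Set.inclusion (frontier_subset_closure (s := Ω)),
              continuous_inclusion (frontier_subset_closure (s := Ω))⟩ ∈
              genAlg (zhGens (frontier Ω) h)}) : ¬ HDisc h Ω := by
  have : CompactSpace (closure Ω) := isCompact_iff_compactSpace.1 hbd.isCompact_closure
  rintro ⟨φ, hφ, hφΩ, ⟨a, ha, b, hb, hab⟩, hφh⟩
  classical
  set cp : C(closure Ω, ℂ) → ℂ → ℂ := fun g t => if ht : φ t ∈ closure Ω then g ⟨φ t, ht⟩ else 0 with hcp
  have hφc : ∀ t ∈ ball (0:ℂ) 1, φ t ∈ closure Ω := fun t ht => subset_closure (hφΩ t ht)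
  have hcpv : ∀ g, ∀ t (ht : t ∈ ball (0:ℂ) 1), cp g t = g ⟨φ t, hφc t ht⟩ := fun g t ht => dif_pos (hφc t ht)
  have h1 : ∀ g ∈ Algebra.adjoin ℂ (zhGens (closure Ω) h), DifferentiableOn ℂ (cp g) (ball 0 1) := by
    intro g hg
    induction hg using Algebra.adjoin_induction with
    | mem g hg =>
      rcases hg with ⟨i, hi⟩ | ⟨j, hj⟩
      · exact (differentiableOn_pi.1 hφ i).congr fun t ht => by rw [hcpv g t ht, hi]
      · exact (hφh j).congr fun t ht => by rw [hcpv g t ht, hj]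
    | algebraMap c => exact (differentiableOn_const c).congr fun t ht => by rw [hcpv _ t ht]; rfl
    | add x y _ _ hx hy => exact (hx.add hy).congr fun t ht => by simp only [Pi.add_apply]; rw [hcpv _ t ht, hcpv _ t ht, hcpv _ t ht]; rfl
    | mul x y _ _ hx hy => exact (hx.mul hy).congr fun t ht => by simp only [Pi.mul_apply]; rw [hcpv _ t ht, hcpv _ t ht, hcpv _ t ht]; rfl
  obtain ⟨δ, hδ, hδb⟩ := Metric.isOpen_iff.1 hop (φ a) (hφΩ a ha)
  set s := min δ (dist (φ b) (φ a)) with hs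
  have hs0 : 0 < s := lt_min hδ (dist_pos.2 hab.symm)
  set f : C(closure Ω, ℂ) := ⟨fun z => ((max 0 (1 - dist z.1 (φ a) / s) : ℝ) : ℂ), by fun_prop⟩ with hf
  have hz : ∀ z : closure Ω, s ≤ dist z.1 (φ a) → f z = 0 := fun z hz => by
    have : 1 - dist z.1 (φ a) / s ≤ 0 := by rw [sub_nonpos, one_le_div hs0]; exact hz
    simp only [hf, ContinuousMap.coe_mk, max_eq_left this, Complex.ofReal_zero]
  have hfm : f ∈ genAlg (zhGens (closure Ω) h) := by
    rw [h4, Set.mem_setOf_eq]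
    have : f.comp ⟨Set.inclusion (frontier_subset_closure (s := Ω)), continuous_inclusion (frontier_subset_closure (s := Ω))⟩ = 0 := by
      ext z
      refine hz _ ?_
      by_contra! hcon
      have h2 : z.1 ∈ Ω := hδb (hcon.trans_le (min_le_left _ _))
      have h3 : z.1 ∈ closure Ω \ Ω := hop.frontier_eq ▸ z.2
      exact h3.2 h2
    rw [this]
    exact subset_closure (zero_mem _)
  obtain ⟨u, hu, hul⟩ := mem_closure_iff_seq_limit.1 hfm
  have hT : TendstoUniformlyOn (fun k => cp (u k)) (cp f) Filter.atTop (ball 0 1) := by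
    rw [Metric.tendstoUniformlyOn_iff]
    intro ε hε
    have h5 : TendstoUniformly (fun k z => u k z) f Filter.atTop := ContinuousMap.tendsto_iff_tendstoUniformly.1 hul
    filter_upwards [Metric.tendstoUniformly_iff.1 h5 ε hε] with k hk t ht
    rw [hcpv _ t ht, hcpv _ t ht]
    exact hk _
  have hd : DifferentiableOn ℂ (cp f) (ball 0 1) := hT.tendstoLocallyUniformlyOn.differentiableOn (Filter.Eventually.of_forall fun k => h1 _ (hu k)) isOpen_ball
  have hc := real_const hd (fun t ht => by rw [hcpv f t ht]; simp [hf])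
  have h6 := (hc a ha).trans (hc b hb).symm
  rw [hcpv f a ha, hcpv f b hb, hz ⟨φ b, hφc b hb⟩ (min_le_right _ _)] at h6
  simp [hf] at h6

section SW
variable {Y : Type*} [TopologicalSpace Y] [CompactSpace Y]

theorem SWc (S : Subalgebra ℂ C(Y, ℂ)) (hS : IsClosed (S : Set C(Y, ℂ)))
    (hsep : ∀ x y : Y, x ≠ y → ∃ f ∈ S, star f ∈ S ∧ f x ≠ f y) : S = ⊤ := by
  let A : StarSubalgebra ℂ C(Y, ℂ) :=
    { carrier := {f | f ∈ S ∧ star f ∈ S}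
      mul_mem' := fun {a b} ha hb => ⟨mul_mem ha.1 hb.1, by rw [star_mul]; exact mul_mem hb.2 ha.2⟩
      one_mem' := ⟨one_mem _, by rw [star_one]; exact one_mem _⟩
      add_mem' := fun {a b} ha hb => ⟨add_mem ha.1 hb.1, by rw [star_add]; exact add_mem ha.2 hb.2⟩
      zero_mem' := ⟨zero_mem _, by rw [star_zero]; exact zero_mem _⟩
      algebraMap_mem' := fun c => ⟨S.algebraMap_mem c, by
        rw [← algebraMap_star_comm]; exact S.algebraMap_mem _⟩
      star_mem' := fun {a} ha => ⟨ha.2, by rw [star_star]; exact ha.1⟩ }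
  have h1 := ContinuousMap.starSubalgebra_topologicalClosure_eq_top_of_separatesPoints A (by
    intro x y hxy
    obtain ⟨f, hf, hf', hn⟩ := hsep x y hxy
    exact ⟨f, ⟨f, ⟨hf, hf'⟩, rfl⟩, hn⟩)
  rw [eq_top_iff]
  intro f _
  have h2 : f ∈ A.topologicalClosure := by rw [h1]; trivial
  have h3 : f ∈ closure (A : Set C(Y, ℂ)) := h2
  exact closure_minimal (fun g hg => hg.1) hS h3

theorem count_inv [Countable Y] (S : Subalgebra ℂ C(Y, ℂ)) (hS : IsClosed (S : Set C(Y, ℂ)))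
    (f : C(Y, ℂ)) (hf : f ∈ S) (h0 : ∀ y, f y ≠ 0) : ∃ g ∈ S, ∀ y, g y * f y = 1 := by
  haveI := hS
  have h1 := Subalgebra.spectrum_eq_of_isPreconnected_compl S (⟨f, hf⟩ : S) (by
    rw [ContinuousMap.spectrum_eq_range]
    exact ((Set.countable_range f).isConnected_compl_of_one_lt_rank (by simp)).isPreconnected)
  have h2 : (0:ℂ) ∉ spectrum ℂ (⟨f, hf⟩ : S) := by
    rw [h1, ContinuousMap.spectrum_eq_range]
    rintro ⟨y, hy⟩
    exact h0 y hy
  rw [spectrum.zero_notMem_iff] at h2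
  obtain ⟨g, hg⟩ := h2.exists_left_inv
  refine ⟨g.1, g.2, fun y => ?_⟩
  have := congrArg (fun a : S => a.1 y) hg
  simpa using this

theorem countable_SW [Countable Y] (S : Subalgebra ℂ C(Y, ℂ)) (hS : IsClosed (S : Set C(Y, ℂ)))
    (hsep : ∀ x y : Y, x ≠ y → ∃ f ∈ S, f x ≠ f y) : S = ⊤ := by
  refine SWc S hS fun x y hxy => ?_
  obtain ⟨f, hf, hn⟩ := hsep x y hxy
  have hd : 0 < ‖f y - f x‖ := norm_pos_iff.2 (sub_ne_zero.2 (Ne.symm hn))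
  obtain ⟨ρ, hρ1, hρ0, hρ2⟩ := ((Set.countable_range fun w => ‖f w - f x‖).dense_compl ℝ).exists_between hd
  set g : C(Y, ℂ) := ⟨fun w => (f w - f x) / ρ, by fun_prop⟩ with hg
  have hgS : g ∈ S := by
    have : g = (algebraMap ℂ C(Y, ℂ) (ρ:ℂ)⁻¹) * (f - algebraMap ℂ C(Y, ℂ) (f x)) := by
      ext w; simp [hg, div_eq_inv_mul]
    rw [this]
    exact mul_mem (S.algebraMap_mem _) (sub_mem hf (S.algebraMap_mem _))
  have hg1 : ∀ w, ‖g w‖ ≠ 1 := fun w hw => hρ1 ⟨w, by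
    have : ‖f w - f x‖ / ρ = 1 := by rw [← hw, hg]; simp [abs_of_pos hρ0]
    rwa [div_eq_one_iff_eq hρ0.ne'] at this⟩
  set V : Set Y := {w | ‖g w‖ < 1} with hV
  have hVc : IsClopen V := ⟨by
    have : V = {w | ‖g w‖ ≤ 1} := by
      ext w; exact ⟨fun h => (le_of_lt h : ‖g w‖ ≤ 1), fun h => lt_of_le_of_ne h (hg1 w)⟩
    rw [this]; exact isClosed_le (by fun_prop) continuous_const, isOpen_lt (by fun_prop) continuous_const⟩
  set u : C(Y, ℂ) := ⟨V.indicator 1, hVc.continuous_indicator continuous_one⟩ with hu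
  have huS : u ∈ S := by
    -- uniform gap
    have hgap : ∃ q < 1, 0 < q ∧ ∀ w, ‖g w‖ ≤ q ∨ 1 / q ≤ ‖g w‖ := by
      have hc : IsCompact (Set.range fun w => ‖g w‖) := isCompact_range (by fun_prop)
      have h1 : (1:ℝ) ∈ (Set.range fun w => ‖g w‖)ᶜ := by rintro ⟨w, hw⟩; exact hg1 w hw
      obtain ⟨e, he, heb⟩ := Metric.isOpen_iff.1 hc.isClosed.isOpen_compl 1 h1
      refine ⟨1 / (1 + min e 1), by rw [div_lt_one (by positivity)]; simp [he], by positivity, fun w => ?_⟩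
      by_contra! hcon
      refine heb (a := ‖g w‖) ?_ ⟨w, rfl⟩
      rw [mem_ball, Real.dist_eq, abs_lt]
      have he1 : 0 < min e 1 := by positivity
      have := min_le_left e 1
      constructor
      · have h2 : 1 - min e 1 ≤ 1 / (1 + min e 1) := by
          rw [le_div_iff₀ (by positivity)]; nlinarith [min_le_right e 1]
        linarith [hcon.1]
      · have := hcon.2
        rw [one_div_one_div] at this
        linarith
    obtain ⟨q, hq1, hq0, hq⟩ := hgap
    rw [← SetLike.mem_coe, ← hS.closure_eq, Metric.mem_closure_iff]
    intro ε hε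
    obtain ⟨k, hk⟩ := exists_pow_lt_of_lt_one (show (0:ℝ) < min (1/2) (ε / 4) by positivity) hq1
    have hk2 : q ^ k < 1/2 := hk.trans_le (min_le_left _ _)
    have hk3 : q ^ k < ε/4 := hk.trans_le (min_le_right _ _)
    have key : ∀ w, (‖g w‖ < 1 ∧ ‖g w ^ k‖ ≤ q ^ k) ∨ (¬ ‖g w‖ < 1 ∧ 1 ≤ q ^ k * ‖g w ^ k‖) := by
      intro w
      rw [norm_pow]
      rcases hq w with h | h
      · exact .inl ⟨h.trans_lt hq1, pow_le_pow_left₀ (norm_nonneg _) h k⟩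
      · right
        have : 1 < 1 / q := by rw [one_lt_div hq0]; exact hq1
        refine ⟨by linarith, ?_⟩
        rw [← mul_pow]
        apply one_le_pow₀
        rw [div_le_iff₀ hq0] at h
        linarith
    obtain ⟨v, hvS, hv⟩ := count_inv S hS (1 - g ^ k) (sub_mem (one_mem _) (pow_mem hgS k)) (fun w h0 => by
      have h1 : g w ^ k = 1 := by
        have : 1 - g w ^ k = 0 := by simpa using h0
        linear_combination -this
      rcases key w with h | h <;> rw [h1] at h <;> simp at h <;> linarith)
    refine ⟨v, hvS, ?_⟩
    rw [dist_eq_norm]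
    refine lt_of_le_of_lt ((ContinuousMap.norm_le _ (C := ε/2) (by positivity)).2 fun w => ?_) (by linarith)
    have hvw : v w * (1 - g w ^ k) = 1 := by simpa using hv w
    have hn : ‖v w‖ * ‖1 - g w ^ k‖ = 1 := by rw [← norm_mul, hvw, norm_one]
    rcases key w with ⟨h, h2⟩ | ⟨h, h2⟩
    · have h3 : u w = 1 := Set.indicator_of_mem (s := V) h 1
      rw [ContinuousMap.sub_apply, h3]
      have h4 : 1 - v w = - (v w * g w ^ k) := by linear_combination -hvw
      rw [h4, norm_neg, norm_mul]
      have h5 : 1/2 ≤ ‖1 - g w ^ k‖ := by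
        have := norm_sub_norm_le (1:ℂ) (g w ^ k)
        rw [norm_one] at this
        linarith
      have h6 : ‖v w‖ ≤ 2 := by nlinarith [norm_nonneg (v w)]
      nlinarith [norm_nonneg (v w), norm_nonneg (g w ^ k)]
    · have h3 : u w = 0 := Set.indicator_of_notMem (s := V) h 1
      rw [ContinuousMap.sub_apply, h3, zero_sub, norm_neg]
      have h5 : ‖g w ^ k‖ - 1 ≤ ‖1 - g w ^ k‖ := by
        have := norm_sub_norm_le (g w ^ k) 1
        rwa [norm_one, norm_sub_rev] at this
      have hqk : 0 < q ^ k := by positivity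
      have h6 : ‖v w‖ * (‖g w ^ k‖ - 1) ≤ 1 := by
        exact (mul_le_mul_of_nonneg_left h5 (norm_nonneg _)).trans hn.le
      have h7 : ‖v w‖ * (1 - q ^ k) ≤ q ^ k := by nlinarith [norm_nonneg (v w)]
      nlinarith [norm_nonneg (v w)]
  have hst : star u = u := by
    ext w
    simp only [ContinuousMap.star_apply, hu, ContinuousMap.coe_mk, Set.indicator]
    split_ifs <;> simp
  refine ⟨u, huS, by rw [hst]; exact huS, ?_⟩
  have hx : u x = 1 := Set.indicator_of_mem (s := V) (by simp [hV, hg]) 1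
  have hy : u y = 0 := Set.indicator_of_notMem (s := V) (by
    simp only [hV, hg, Set.mem_setOf_eq, ContinuousMap.coe_mk, norm_div, Complex.norm_real, Real.norm_eq_abs, abs_of_pos hρ0, not_lt]
    rw [one_le_div hρ0]; exact hρ2.le) 1
  rw [hx, hy]
  exact one_ne_zero
end SW

theorem fib_dense {Y : Type*} [TopologicalSpace Y] [CompactSpace Y] {N : ℕ}
    (S : Subalgebra ℂ C(Y, ℂ)) (hS : IsClosed (S : Set C(Y, ℂ)))
    (g : Fin N → C(Y, ℂ)) (hg : ∀ j, g j ∈ S) (hgs : ∀ j, star (g j) ∈ S)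
    (hsep : ∀ x y : Y, x ≠ y → ∃ f ∈ S, f x ≠ f y)
    (hfib : ∀ y0 : Y, {y : Y | ∀ j, g j y = g j y0}.Countable) : S = ⊤ := by
  set γ : Y → (Fin N → ℂ) := fun y j => g j y with hγ
  have hγc : Continuous γ := by fun_prop
  set W : Set (Fin N → ℂ) := Set.range γ with hW
  have hWc : IsCompact W := isCompact_range hγc
  haveI : CompactSpace W := isCompact_iff_compactSpace.1 hWc
  set γW : C(Y, W) := ⟨fun y => ⟨γ y, y, rfl⟩, by fun_prop⟩ with hγW
  have hcomp : ∀ φ : C(W, ℂ), φ.comp γW ∈ S := by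
    set H : C(W, ℂ) →ₐ[ℂ] C(Y, ℂ) := ContinuousMap.compRightAlgHom ℂ ℂ γW with hH
    have hHc : Continuous H := ContinuousMap.continuous_precomp γW
    have := SWc (S.comap H) (hS.preimage hHc) (fun a b hab => by
      have hne : a.1 ≠ b.1 := fun h => hab (Subtype.ext h)
      obtain ⟨j, hj⟩ := Function.ne_iff.1 hne
      refine ⟨⟨fun w => w.1 j, (continuous_apply j).comp continuous_subtype_val⟩, ?_, ?_, hj⟩
      · exact hg j
      · exact hgs j)
    intro φ
    have h2 : φ ∈ S.comap H := by rw [this]; trivial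
    exact h2
  rw [eq_top_iff]
  intro u _
  rw [← SetLike.mem_coe, ← hS.closure_eq, Metric.mem_closure_iff]
  intro ε hε
  have hloc : ∀ y0 : Y, ∃ p ∈ S, ∃ δ > 0, ∀ y, dist (γ y) (γ y0) < δ → ‖u y - p y‖ < ε / 2 := by
    intro y0
    set Z : Set Y := {y : Y | ∀ j, g j y = g j y0} with hZ
    have hZc : IsClosed Z := by
      rw [hZ, Set.setOf_forall]
      exact isClosed_iInter fun j => isClosed_eq (g j).continuous continuous_const
    haveI : CompactSpace Z := isCompact_iff_compactSpace.1 hZc.isCompact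
    haveI : Countable Z := (hfib y0).to_subtype
    set ι : C(Z, Y) := ⟨Subtype.val, continuous_subtype_val⟩ with hι
    have h1 := countable_SW (S.map (ContinuousMap.compRightAlgHom ℂ ℂ ι)).topologicalClosure
      (Subalgebra.isClosed_topologicalClosure _) (fun a b hab => by
        obtain ⟨f, hf, hn⟩ := hsep a.1 b.1 (fun h => hab (Subtype.ext h))
        exact ⟨f.comp ι, Subalgebra.le_topologicalClosure _ ⟨f, hf, rfl⟩, hn⟩)
    have h2 : u.comp ι ∈ closure ((S.map (ContinuousMap.compRightAlgHom ℂ ℂ ι) : Subalgebra ℂ C(Z, ℂ)) : Set C(Z, ℂ)) := by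
      rw [← Subalgebra.topologicalClosure_coe, h1]; trivial
    obtain ⟨_, ⟨p, hp, rfl⟩, hd⟩ := Metric.mem_closure_iff.1 h2 (ε / 2) (by positivity)
    refine ⟨p, hp, ?_⟩
    have hK : IsCompact (γ '' {y | ε / 2 ≤ ‖u y - p y‖}) :=
      (isClosed_le continuous_const (by fun_prop)).isCompact.image hγc
    have hn : γ y0 ∈ (γ '' {y | ε / 2 ≤ ‖u y - p y‖})ᶜ := by
      rintro ⟨y, hy, hyy⟩
      have hyZ : y ∈ Z := fun j => congrFun hyy j
      have h3 := (ContinuousMap.dist_apply_le_dist (f := u.comp ι) (g := ContinuousMap.compRightAlgHom ℂ ℂ ι p) ⟨y, hyZ⟩).trans_lt hd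
      rw [dist_eq_norm] at h3
      exact absurd hy (not_le.2 h3)
    obtain ⟨δ, hδ, hδb⟩ := Metric.isOpen_iff.1 hK.isClosed.isOpen_compl _ hn
    refine ⟨δ, hδ, fun y hy => ?_⟩
    by_contra! hcon
    exact hδb hy ⟨y, hcon, rfl⟩
  choose p hpS δ hδ hp using hloc
  obtain ⟨t, ht⟩ := isCompact_univ.elim_finite_subcover (fun y0 : Y => {y | dist (γ y) (γ y0) < δ y0})
    (fun y0 => isOpen_lt (by fun_prop) continuous_const) (fun y _ => Set.mem_iUnion.2 ⟨y, by simpa using hδ y⟩)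
  set φ : Y → (Fin N → ℂ) → ℝ := fun i w => max 0 (δ i - dist w (γ i)) with hφ
  have hφ0 : ∀ i w, 0 ≤ φ i w := fun i w => le_max_left _ _
  have hφc : ∀ i, Continuous (φ i) := fun i => by fun_prop
  have hpos : ∀ w : W, 0 < ∑ i ∈ t, φ i w := by
    rintro ⟨_, y, rfl⟩
    have := ht (Set.mem_univ y)
    simp only [Set.mem_iUnion, Set.mem_setOf_eq] at this
    obtain ⟨i, hi, hd⟩ := this
    exact Finset.sum_pos' (fun i _ => hφ0 i _) ⟨i, hi, lt_max_of_lt_right (by simpa using hd)⟩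
  set ψ : Y → C(W, ℂ) := fun i => ⟨fun w => ((φ i w / ∑ i ∈ t, φ i w : ℝ) : ℂ), by
    refine Complex.continuous_ofReal.comp (Continuous.div ((hφc i).comp continuous_subtype_val) (continuous_finsetSum _ fun i _ => (hφc i).comp continuous_subtype_val) fun w => (hpos w).ne')⟩ with hψ
  refine ⟨∑ i ∈ t, (ψ i).comp γW * p i, sum_mem fun i _ => mul_mem (hcomp _) (hpS i), ?_⟩
  rw [dist_eq_norm]
  refine lt_of_le_of_lt ((ContinuousMap.norm_le _ (C := ε/2) (by positivity)).2 fun y => ?_) (by linarith)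
  have hs := hpos (γW y)
  set σ := ∑ i ∈ t, φ i (γW y) with hσ
  have e1 : (u - ∑ i ∈ t, (ψ i).comp γW * p i) y = ∑ i ∈ t, ((φ i (γ y) / σ : ℝ) : ℂ) * (u y - p i y) := by
    have h1 : ∑ i ∈ t, ((φ i (γ y) / σ : ℝ) : ℂ) = 1 := by
      rw [← Complex.ofReal_sum, ← Finset.sum_div]
      exact_mod_cast div_self hs.ne'
    simp only [mul_sub, Finset.sum_sub_distrib, ← Finset.sum_mul, h1, one_mul]
    rw [ContinuousMap.sub_apply, ContinuousMap.sum_apply]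
    rfl
  rw [e1]
  have h1 : ∑ i ∈ t, (φ i (γ y) / σ) * (ε / 2) = ε / 2 := by
    rw [← Finset.sum_mul, ← Finset.sum_div]
    have : (∑ i ∈ t, φ i (γ y)) / σ = 1 := div_self hs.ne'
    rw [this, one_mul]
  rw [← h1]
  refine (norm_sum_le _ _).trans (Finset.sum_le_sum fun i _ => ?_)
  rw [norm_mul, Complex.norm_real, Real.norm_eq_abs, abs_of_nonneg (div_nonneg (hφ0 _ _) hs.le)]
  by_cases hd : dist (γ y) (γ i) < δ i
  · exact mul_le_mul_of_nonneg_left (hp i y hd).le (div_nonneg (hφ0 _ _) hs.le)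
  · have : φ i (γ y) = 0 := max_eq_left (by linarith)
    simp [this]

section loc
variable {n N : ℕ} {h : Fin N → (Fin n → ℂ) → ℂ} {Ω : Set (Fin n → ℂ)} {z : Fin n → ℂ} {R : ℝ}
    {F G : Fin N → (Fin n → ℂ) → ℂ}

theorem fib_count (h3 : ¬ HDisc h Ω) (hb : ball z R ⊆ Ω)
    (hF : ∀ j, DifferentiableOn ℂ (F j) (ball z R)) (hG : ∀ j, DifferentiableOn ℂ (G j) (ball z R))
    (hFG : ∀ j, ∀ w ∈ ball z R, h j w = F j w + starRingEnd ℂ (G j w))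
    {B : Set (Fin n → ℂ)} (hB : IsCompact B) (hBb : B ⊆ ball z R) (c : Fin N → ℂ) :
    IsClosed {w | w ∈ B ∧ ∀ j, G j w = c j} ∧ {w | w ∈ B ∧ ∀ j, G j w = c j}.Countable := by
  have hcl : IsClosed {w | w ∈ B ∧ ∀ j, G j w = c j} := by
    have : {w | w ∈ B ∧ ∀ j, G j w = c j} = B ∩ (fun w j => G j w) ⁻¹' {c} := by
      ext w; simp [funext_iff]
    rw [this]
    refine ContinuousOn.preimage_isClosed_of_isClosed ?_ hB.isClosed isClosed_singleton
    exact continuousOn_pi.2 fun j => (hG j).continuousOn.mono hBb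
  refine ⟨hcl, ?_⟩
  by_contra hcon
  obtain ⟨D, hD, hne, hDs⟩ := exists_perfect_nonempty_of_isClosed_of_not_countable hcl hcon
  refine h3 (hdisc_of_perf hb hF hG hFG c D (fun w hw => hBb (hDs hw).1) hne (fun w hw r hr => ?_) fun w hw => (hDs hw).2)
  obtain ⟨w', hw', hn⟩ := accPt_iff_nhds.1 (hD.acc w hw) (ball w r) (ball_mem_nhds w hr)
  exact ⟨w', hw'.2, hn, hw'.1⟩

theorem hol_PA {f : (Fin n → ℂ) → ℂ} {M : ℝ} (hf : DifferentiableOn ℂ f (ball z R)) (hR : 0 < R)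
    (hM : ∀ w ∈ ball z R, ‖f w‖ ≤ M) {Y : Set (Fin (n + N) → ℂ)} [CompactSpace Y]
    (hY : ∀ x ∈ Y, dist (pr1 x) z ≤ R / (8 * Real.exp 1)) (g : C(Y, ℂ)) (hg : ∀ x : Y, g x = f (pr1 x.1)) : g ∈ PA Y := by
  rw [mem_PA]
  intro ε hε
  have hM0 : 0 ≤ M := (norm_nonneg _).trans (hM z (mem_ball_self hR))
  obtain ⟨K, hK⟩ := exists_pow_lt_of_lt_one (show (0:ℝ) < ε / (M * 2 + 1) by positivity) (show (1/2 : ℝ) < 1 by norm_num)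
  refine ⟨MvPolynomial.rename (Fin.castAdd N) (∑ k ∈ Finset.range K, tayP f z k), fun x => ?_⟩
  rw [MvPolynomial.eval_rename, hg]
  have h1 := taylor_unif hf hR hM K (hY x.1 x.2)
  refine lt_of_le_of_lt h1 ?_
  rw [lt_div_iff₀ (by positivity)] at hK
  nlinarith [show (0:ℝ) < (1/2)^K by positivity]

theorem loc_dense (h3 : ¬ HDisc h Ω) (hR : 0 < R) (hb : ball z R ⊆ Ω)
    (hF : ∀ j, DifferentiableOn ℂ (F j) (ball z R)) (hG : ∀ j, DifferentiableOn ℂ (G j) (ball z R))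
    (hFG : ∀ j, ∀ w ∈ ball z R, h j w = F j w + starRingEnd ℂ (G j w))
    {M : ℝ} (hFM : ∀ j, ∀ w ∈ ball z R, ‖F j w‖ ≤ M) (hGM : ∀ j, ∀ w ∈ ball z R, ‖G j w‖ ≤ M)
    {B : Set (Fin n → ℂ)} (hB : IsCompact B) (hBb : ∀ x ∈ B, dist x z ≤ R / (8 * Real.exp 1))
    [CompactSpace (graphSet h B)] : PA (graphSet h B) = ⊤ := by
  have he : 1 < Real.exp 1 := by simp
  have hBR : B ⊆ ball z R := fun x hx => by
    refine (hBb x hx).trans_lt (div_lt_self hR (by linarith))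
  have hYR : ∀ x : graphSet h B, pr1 x.1 ∈ ball z R := fun x => hBR (mem_graph.1 x.2).1
  have hYb : ∀ x ∈ graphSet h B, dist (pr1 x) z ≤ R / (8 * Real.exp 1) := fun x hx => hBb _ (mem_graph.1 hx).1
  have hpc : Continuous (fun x : graphSet h B => pr1 x.1) := pr1_diff.continuous.comp continuous_subtype_val
  have hcl : IsClosed (PA (graphSet h B) : Set C(graphSet h B, ℂ)) := Subalgebra.isClosed_topologicalClosure _
  have hco : ∀ f : (Fin n → ℂ) → ℂ, DifferentiableOn ℂ f (ball z R) → Continuous (fun x : graphSet h B => f (pr1 x.1)) :=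
    fun f hf => hf.continuousOn.comp_continuous hpc hYR
  set gF : Fin N → C(graphSet h B, ℂ) := fun j => ⟨fun x => F j (pr1 x.1), hco _ (hF j)⟩ with hgF
  set gG : Fin N → C(graphSet h B, ℂ) := fun j => ⟨fun x => G j (pr1 x.1), hco _ (hG j)⟩ with hgG
  have mF : ∀ j, gF j ∈ PA (graphSet h B) := fun j => hol_PA (hF j) hR (hFM j) hYb _ fun x => rfl
  have mG : ∀ j, gG j ∈ PA (graphSet h B) := fun j => hol_PA (hG j) hR (hGM j) hYb _ fun x => rfl
  refine fib_dense _ hcl gG mG (fun j => ?_) (fun x y hxy => ?_) fun x0 => ?_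
  · have : star (gG j) = (evA (graphSet h B) (MvPolynomial.X (Fin.natAdd n j))).1 - gF j := by
      ext x
      rw [ContinuousMap.sub_apply, evA_apply, MvPolynomial.eval_X]
      have h1 := (mem_graph.1 x.2).2 j
      rw [hFG j _ (hYR x)] at h1
      have h2 : x.1 (Fin.natAdd n j) = F j (pr1 x.1) + starRingEnd ℂ (G j (pr1 x.1)) := h1
      rw [h2]
      simp [hgF, hgG]
    rw [this]
    exact sub_mem (Subtype.property _) (mF j)
  · have hne : x.1 ≠ y.1 := fun h => hxy (Subtype.ext h)
    obtain ⟨i, hi⟩ := Function.ne_iff.1 hne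
    refine ⟨(evA (graphSet h B) (MvPolynomial.X i)).1, Subtype.property _, ?_⟩
    rw [evA_apply, evA_apply, MvPolynomial.eval_X, MvPolynomial.eval_X]
    exact hi
  · have h1 := (fib_count h3 hb hF hG hFG hB hBR (fun j => G j (pr1 x0.1))).2
    refine (h1.preimage_of_injOn (f := fun x : graphSet h B => pr1 x.1) ?_).mono ?_
    · exact fun x _ y _ hxy => Subtype.ext (graph_inj x.2 y.2 hxy)
    · exact fun x hx => ⟨(mem_graph.1 x.2).1, hx⟩
end loc

section FC
variable {Q : Type*} [NormedCommRing Q] [NormedAlgebra ℂ Q] [CompleteSpace Q]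

theorem prod_bound {m : ℕ} (a : Fin m → Q) {r : ℝ} (hr : 0 < r) (h : ∀ i, ∀ L : WeakDual.characterSpace ℂ Q, ‖L (a i)‖ < r) :
    ∃ M > 0, ∀ (k : ℕ) (s : Fin k → Fin m), ‖∏ j, a (s j)‖ ≤ M * r ^ k := by
  choose M hM hb using fun i => pow_bound (a i) hr (h i)
  refine ⟨(‖(1:Q)‖ + 1) * ∏ i, M i, mul_pos (by positivity) (Finset.prod_pos fun i _ => hM i), fun k s => ?_⟩
  have h1 : ∏ j, a (s j) = ∏ i, a i ^ (Finset.univ.filter fun j => s j = i).card := by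
    rw [← Finset.prod_fiberwise' Finset.univ s a]
    simp
  have h2 : ∑ i, (Finset.univ.filter fun j => s j = i).card = k := by
    have := Finset.card_eq_sum_card_fiberwise (f := s) (s := Finset.univ) (t := Finset.univ) (fun _ _ => by simp)
    rw [← this]; simp
  have h3 : ∀ (t : Finset (Fin m)) (e : Fin m → ℕ), ‖∏ i ∈ t, a i ^ e i‖ ≤ (‖(1:Q)‖ + 1) * ∏ i ∈ t, (M i * r ^ e i) := by
    intro t e
    induction t using Finset.induction_on with
    | empty => simp
    | insert i t hi ih =>
      rw [Finset.prod_insert hi, Finset.prod_insert hi]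
      refine (norm_mul_le _ _).trans ?_
      have := mul_le_mul (hb i (e i)) ih (norm_nonneg _) (mul_nonneg (hM i).le (by positivity))
      linarith
  rw [h1]
  refine (h3 _ _).trans (le_of_eq ?_)
  rw [Finset.prod_mul_distrib, Finset.prod_pow_eq_pow_sum, h2, mul_assoc]

theorem holo_calc {m : ℕ} (θ : MvPolynomial (Fin m) ℂ →ₐ[ℂ] Q) {y0 : Fin m → ℂ} {R M : ℝ} {L : (Fin m → ℂ) → ℂ}
    (hL : DifferentiableOn ℂ L (ball y0 R)) (hR : 0 < R) (hM : ∀ w ∈ ball y0 R, ‖L w‖ ≤ M)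
    (hθ : ∀ Λ : WeakDual.characterSpace ℂ Q, ∃ y, (∀ p, Λ (θ p) = MvPolynomial.eval y p) ∧ dist y y0 < R / (8 * Real.exp 1 * (m + 1))) :
    ∃ g : Q, (∀ ε > 0, ∃ q, ‖θ q - g‖ < ε ∧ ∀ w, dist w y0 ≤ R / (8 * Real.exp 1) → ‖L w - MvPolynomial.eval w q‖ < ε) ∧
      ∀ Λ : WeakDual.characterSpace ℂ Q, ∀ y, (∀ p, Λ (θ p) = MvPolynomial.eval y p) → dist y y0 ≤ R / (8 * Real.exp 1) → Λ g = L y := by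
  have he : 1 < Real.exp 1 := by simp
  have hM0 : 0 ≤ M := (norm_nonneg _).trans (hM y0 (mem_ball_self hR))
  set r := R / (8 * Real.exp 1 * (m + 1)) with hr
  have hr0 : 0 < r := by positivity
  obtain ⟨C, hC, hb⟩ := prod_bound (fun i => θ (MvPolynomial.X i - MvPolynomial.C (y0 i))) hr0 (fun i Λ => by
    obtain ⟨y, hy, hd⟩ := hθ Λ
    rw [hy]
    simp only [map_sub, MvPolynomial.eval_X, MvPolynomial.eval_C]
    rw [← dist_eq_norm]
    exact (dist_le_pi_dist y y0 i).trans_lt hd)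
  have hbd : ∀ k, ‖θ (tayP L y0 k)‖ ≤ M * C * (1/2) ^ k := by
    intro k
    rw [tayP, map_sum]
    refine (norm_sum_le _ _).trans ((Finset.sum_le_card_nsmul _ _ (M * (4 * Real.exp 1 / R) ^ k * (C * r ^ k)) fun s _ => ?_).trans ?_)
    · rw [map_mul, map_prod]
      have : MvPolynomial.C ((k.factorial : ℂ)⁻¹ * iteratedFDeriv ℂ k L y0 (fun j => Pi.single (s j) 1)) = algebraMap ℂ (MvPolynomial (Fin m) ℂ) ((k.factorial : ℂ)⁻¹ * iteratedFDeriv ℂ k L y0 (fun j => Pi.single (s j) 1)) := rfl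
      rw [this, AlgHom.commutes, ← Algebra.smul_def]
      refine (norm_smul_le _ _).trans ?_
      exact mul_le_mul (tayP_coeff hL hR hM k s) (hb k s) (norm_nonneg _) (by positivity)
    · rw [nsmul_eq_mul, Finset.card_univ, Fintype.card_fun, Fintype.card_fin, Fintype.card_fin]
      push_cast
      have e1 : (m:ℝ) ^ k * (M * (4 * Real.exp 1 / R) ^ k * (C * r ^ k)) = M * C * (m * (4 * Real.exp 1 / R) * r) ^ k := by
        rw [mul_pow, mul_pow]; ring
      rw [e1]
      have e2 : m * (4 * Real.exp 1 / R) * r = (m / (m + 1)) * (1/2) := by rw [hr]; field_simp; ring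
      have e3 : (m / (m + 1) : ℝ) ≤ 1 := by rw [div_le_one (by positivity)]; linarith
      have e4 : (0:ℝ) ≤ m / (m + 1) := by positivity
      rw [e2]
      gcongr
      linarith
  have hsum : Summable fun k => θ (tayP L y0 k) :=
    Summable.of_norm_bounded ((summable_geometric_of_lt_one (by norm_num) (by norm_num : (1/2:ℝ) < 1)).mul_left (M * C)) hbd
  have ht := hsum.hasSum.tendsto_sum_nat
  refine ⟨∑' k, θ (tayP L y0 k), fun ε hε => ?_, fun Λ y hy hd => ?_⟩
  · have h1 : Filter.Tendsto (fun K : ℕ => M * 2 * (1/2 : ℝ) ^ K) Filter.atTop (nhds 0) := by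
      have := (tendsto_pow_atTop_nhds_zero_of_lt_one (by norm_num) (by norm_num : (1/2:ℝ) < 1)).const_mul (M * 2)
      rwa [mul_zero] at this
    obtain ⟨K, hK1, hK2⟩ := ((Metric.tendsto_nhds.1 ht ε hε).and (h1.eventually_lt_const hε)).exists
    refine ⟨∑ k ∈ Finset.range K, tayP L y0 k, by rwa [map_sum, ← dist_eq_norm], fun w hw => (taylor_unif hL hR hM K hw).trans_lt hK2⟩
  · have h1 : Filter.Tendsto (fun K : ℕ => M * 2 * (1/2 : ℝ) ^ K) Filter.atTop (nhds 0) := by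
      have := (tendsto_pow_atTop_nhds_zero_of_lt_one (by norm_num) (by norm_num : (1/2:ℝ) < 1)).const_mul (M * 2)
      rwa [mul_zero] at this
    have h2 : Filter.Tendsto (fun K : ℕ => Λ (∑ k ∈ Finset.range K, θ (tayP L y0 k))) Filter.atTop (nhds (Λ (∑' k, θ (tayP L y0 k)))) :=
      ((map_continuous Λ).tendsto _).comp ht
    have h3 : Filter.Tendsto (fun K : ℕ => Λ (∑ k ∈ Finset.range K, θ (tayP L y0 k))) Filter.atTop (nhds (L y)) := by
      rw [tendsto_iff_norm_sub_tendsto_zero]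
      refine squeeze_zero (fun _ => norm_nonneg _) (fun K => ?_) h1
      rw [← map_sum, hy, norm_sub_rev]
      exact taylor_unif hL hR hM K hd
    exact tendsto_nhds_unique h2 h3

theorem bernQ (g : Q) (hg : ∀ Λ : WeakDual.characterSpace ℂ Q, ∃ x : ℝ, 0 ≤ x ∧ x ≤ 1/10 ∧ Λ g = x) {ε : ℝ} (hε : 0 < ε) :
    ∃ b : Polynomial ℂ, ‖Polynomial.aeval g b‖ < ε ∧ ∀ x : ℝ, 0 ≤ x → x ≤ 1 → ‖b.eval (x:ℂ) - (max 0 (x - 1/2) : ℝ)‖ < ε := by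
  obtain ⟨M1, hM1, hb1⟩ := pow_bound g (show (0:ℝ) < 11/100 by norm_num) (fun Λ => by
    obtain ⟨x, h0, h1, hx⟩ := hg Λ
    rw [hx, Complex.norm_real, Real.norm_eq_abs, abs_of_nonneg h0]; linarith)
  obtain ⟨M2, hM2, hb2⟩ := pow_bound (1 - g) (show (0:ℝ) < 101/100 by norm_num) (fun Λ => by
    obtain ⟨x, h0, h1, hx⟩ := hg Λ
    have : Λ (1 - g) = ((1 - x : ℝ) : ℂ) := by rw [map_sub, hx, map_one]; push_cast; ring
    rw [this, Complex.norm_real, Real.norm_eq_abs, abs_of_nonneg (by linarith)]; linarith)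
  set w : C(unitInterval, ℝ) := ⟨fun x => max 0 (x.1 - 1/2), by fun_prop⟩ with hw
  have ht := (bernsteinApproximation_uniform w).comp (Filter.tendsto_atTop_mono (fun m : ℕ => (by omega : m ≤ 2 * m)) Filter.tendsto_id)
  have h1 : Filter.Tendsto (fun m : ℕ => M1 * M2 * (1/2 : ℝ) ^ m) Filter.atTop (nhds 0) := by
    have := (tendsto_pow_atTop_nhds_zero_of_lt_one (by norm_num) (by norm_num : (1/2:ℝ) < 1)).const_mul (M1 * M2)
    rwa [mul_zero] at this
  obtain ⟨m, hm1, hm2⟩ := ((Metric.tendsto_nhds.1 ht ε hε).and (h1.eventually_lt_const hε)).exists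
  refine ⟨∑ k : Fin (2 * m + 1), Polynomial.C ((w (bernstein.z k) : ℝ) : ℂ) * bernsteinPolynomial ℂ (2 * m) k, ?_, fun x h0 h1 => ?_⟩
  · rw [map_sum]
    refine lt_of_le_of_lt ?_ hm2
    refine (norm_sum_le _ _).trans ?_
    have hterm : ∀ k : Fin (2 * m + 1), ‖Polynomial.aeval g (Polynomial.C ((w (bernstein.z k) : ℝ) : ℂ) * bernsteinPolynomial ℂ (2 * m) k)‖ ≤
        ((2 * m).choose k : ℝ) * (M1 * M2 * ((11/100) ^ m * (101/100) ^ m)) := by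
      intro k
      have e1 : Polynomial.aeval g (Polynomial.C ((w (bernstein.z k) : ℝ) : ℂ) * bernsteinPolynomial ℂ (2 * m) k) =
          (((w (bernstein.z k) * (2 * m).choose k : ℝ) : ℂ)) • (g ^ k.1 * (1 - g) ^ (2 * m - k.1)) := by
        rw [bernsteinPolynomial, Algebra.smul_def]
        simp [mul_assoc]
      rw [e1]
      refine (norm_smul_le _ _).trans ?_
      rw [Complex.norm_real, Real.norm_eq_abs]
      by_cases hk : m ≤ k.1
      · have hw1 : |w (bernstein.z k)| ≤ 1 := by
          have := (bernstein.z k).2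
          rw [hw, ContinuousMap.coe_mk, abs_of_nonneg (le_max_left _ _)]
          exact max_le (by norm_num) (by linarith [this.2])
        rw [abs_mul, Nat.abs_cast]
        have n1 : ‖g ^ k.1 * (1 - g) ^ (2 * m - k.1)‖ ≤ M1 * M2 * ((11/100) ^ m * (101/100) ^ m) := by
          refine (norm_mul_le _ _).trans ?_
          have a1 : ‖g ^ k.1‖ ≤ M1 * (11/100) ^ m := (hb1 _).trans (mul_le_mul_of_nonneg_left (pow_le_pow_of_le_one (by norm_num) (by norm_num) hk) hM1.le)
          have a2 : ‖(1 - g) ^ (2 * m - k.1)‖ ≤ M2 * (101/100) ^ m := (hb2 _).trans (mul_le_mul_of_nonneg_left (pow_le_pow_right₀ (by norm_num) (by omega)) hM2.le)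
          calc _ ≤ (M1 * (11/100) ^ m) * (M2 * (101/100) ^ m) := mul_le_mul a1 a2 (norm_nonneg _) (by positivity)
            _ = _ := by ring
        have hch : (0:ℝ) ≤ (2 * m).choose k := by positivity
        refine mul_le_mul ?_ n1 (norm_nonneg _) hch
        nlinarith
      · have hw0 : w (bernstein.z k) = 0 := by
          rw [hw, ContinuousMap.coe_mk]
          refine max_eq_left ?_
          have hm0 : (0:ℝ) < m := by
            have : 0 < m := by omega
            exact_mod_cast this
          have hkm : (k.1 : ℝ) ≤ m := by exact_mod_cast (by omega : k.1 ≤ m)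
          have : ((bernstein.z k : unitInterval) : ℝ) = (k.1 : ℝ) / ((2 * m : ℕ) : ℝ) := rfl
          rw [this, sub_nonpos, div_le_iff₀ (by push_cast; positivity)]
          push_cast
          linarith
        rw [hw0]; simp; positivity
    refine (Finset.sum_le_sum fun k _ => hterm k).trans (le_of_eq_of_le (b := (2:ℝ) ^ (2 * m) * (M1 * M2 * ((11/100) ^ m * (101/100) ^ m))) ?_ ?_)
    · rw [← Finset.sum_mul]
      congr 1
      rw [Fin.sum_univ_eq_sum_range (fun k => ((2 * m).choose k : ℝ))]
      exact_mod_cast Nat.sum_range_choose (2 * m)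
    · have : (2:ℝ) ^ (2 * m) * (M1 * M2 * ((11/100) ^ m * (101/100) ^ m)) = M1 * M2 * (4 * (11/100 * (101/100))) ^ m := by
        rw [pow_mul, mul_pow, mul_pow]; norm_num; ring
      rw [this]
      gcongr
      norm_num
  · have h2 := (ContinuousMap.dist_apply_le_dist (f := bernsteinApproximation (2 * m) w) (g := w) ⟨x, h0, h1⟩).trans_lt hm1
    rw [bernsteinApproximation.apply, dist_eq_norm] at h2
    rw [← Complex.norm_real] at h2
    refine lt_of_eq_of_lt (congrArg norm ?_) h2
    push_cast
    congr 1
    · rw [Polynomial.eval_finset_sum]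
      refine Finset.sum_congr rfl fun k _ => ?_
      rw [bernstein_apply, bernsteinPolynomial]
      simp
      ring

theorem calc_small {m : ℕ} (θ : MvPolynomial (Fin m) ℂ →ₐ[ℂ] Q) {y0 : Fin m → ℂ} {R M : ℝ} {L : (Fin m → ℂ) → ℂ}
    (hL : DifferentiableOn ℂ L (ball y0 R)) (hR : 0 < R) (hM : ∀ w ∈ ball y0 R, ‖L w‖ ≤ M)
    (hθ : ∀ Λ : WeakDual.characterSpace ℂ Q, ∃ y, (∀ p, Λ (θ p) = MvPolynomial.eval y p) ∧ dist y y0 < R / (8 * Real.exp 1 * (m + 1)) ∧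
      ∃ x : ℝ, 0 ≤ x ∧ x ≤ 1/10 ∧ L y = x) {ε : ℝ} (hε0 : 0 < ε) :
    ∃ B : MvPolynomial (Fin m) ℂ, ‖θ B‖ < ε ∧ ∀ y, dist y y0 ≤ R / (8 * Real.exp 1) → ∀ x : ℝ, 0 ≤ x → x ≤ 1 → L y = x →
      ‖((max 0 (x - 1/2) : ℝ) : ℂ) - MvPolynomial.eval y B‖ ≤ 2 * ε := by
  have he : 1 < Real.exp 1 := by simp
  obtain ⟨g, hg1, hg2⟩ := holo_calc θ hL hR hM (fun Λ => by
    obtain ⟨y, hp, hy, -⟩ := hθ Λ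
    exact ⟨y, hp, hy⟩)
  have hgc : ∀ Λ : WeakDual.characterSpace ℂ Q, ∃ x : ℝ, 0 ≤ x ∧ x ≤ 1/10 ∧ Λ g = x := by
    intro Λ
    obtain ⟨y, hp, hy, x, hx0, hx1, hx⟩ := hθ Λ
    refine ⟨x, hx0, hx1, (hg2 Λ y hp (hy.le.trans ?_)).trans hx⟩
    refine div_le_div_of_nonneg_left hR.le (by positivity) ?_
    exact le_mul_of_one_le_right (by positivity) (by linarith [(m.cast_nonneg : (0:ℝ) ≤ m)])
  obtain ⟨b, hb1, hb2⟩ := bernQ g hgc hε0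
  have hbc : Continuous fun a : Q => ‖Polynomial.aeval a b‖ := by
    have : Continuous fun a : Q => Polynomial.aeval a b := by
      simp only [Polynomial.aeval_def, Polynomial.eval₂_eq_sum, Polynomial.sum_def]
      fun_prop
    exact this.norm
  obtain ⟨δ1, hδ1, hδ1b⟩ := Metric.mem_nhds_iff.1 (hbc.continuousAt.preimage_mem_nhds (Iio_mem_nhds hb1))
  have huc := (isCompact_closedBall (0:ℂ) 2).uniformContinuousOn_of_continuous (f := fun x => b.eval x) b.continuous.continuousOn
  obtain ⟨δ2, hδ2, hδ2b⟩ := Metric.uniformContinuousOn_iff.1 huc ε hε0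
  obtain ⟨q, hq1, hq2⟩ := hg1 (min δ1 (min δ2 1)) (by positivity)
  have hq1' : ‖Polynomial.aeval (θ q) b‖ < ε := hδ1b (show θ q ∈ ball g δ1 by
    rw [mem_ball, dist_eq_norm]; exact hq1.trans_le (min_le_left _ _))
  refine ⟨Polynomial.aeval q b, by rw [← Polynomial.aeval_algHom_apply]; exact hq1', fun y hd x hx0 hx1 hx => ?_⟩
  have hBv : MvPolynomial.eval y (Polynomial.aeval q b) = b.eval (MvPolynomial.eval y q) := by
    have h5 := Polynomial.aeval_algHom_apply (MvPolynomial.aeval y : MvPolynomial (Fin m) ℂ →ₐ[ℂ] ℂ) q b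
    simp only [MvPolynomial.aeval_eq_eval] at h5
    simpa [Polynomial.aeval_def, Polynomial.eval₂_eq_eval_map] using h5.symm
  have h9 := hq2 y hd
  have n1 : ‖L y‖ ≤ 1 := by rw [hx, Complex.norm_real, Real.norm_eq_abs, abs_of_nonneg hx0]; exact hx1
  have n2 : ‖MvPolynomial.eval y q‖ ≤ 2 := by
    have := norm_sub_norm_le (MvPolynomial.eval y q) (L y)
    rw [norm_sub_rev] at this
    have := h9.trans_le ((min_le_right _ _).trans (min_le_right _ _))
    linarith
  have n3 := hδ2b (L y) (by simpa using by linarith) (MvPolynomial.eval y q) (by simpa using n2)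
    (by rw [dist_eq_norm]; exact h9.trans_le ((min_le_right _ _).trans (min_le_left _ _)))
  rw [dist_eq_norm] at n3
  have n4 := hb2 x hx0 hx1
  rw [← hx] at n4
  rw [hBv]
  have e1 : ((max 0 (x - 1/2) : ℝ) : ℂ) - b.eval (MvPolynomial.eval y q) =
      (b.eval (L y) - b.eval (MvPolynomial.eval y q)) - (b.eval (L y) - (max 0 (x - 1/2) : ℝ)) := by ring
  rw [e1]
  exact (norm_sub_le _ _).trans (by linarith)
end FC

noncomputable def evAh {m : ℕ} (Y : Set (Fin m → ℂ)) [CompactSpace Y] : MvPolynomial (Fin m) ℂ →ₐ[ℂ] PA Y :=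
  (evP Y).codRestrict (PA Y) fun p => (evA Y p).2

theorem evAh_apply {m : ℕ} (Y : Set (Fin m → ℂ)) [CompactSpace Y] (p : MvPolynomial (Fin m) ℂ) (y : Y) :
    (evAh Y p).1 y = MvPolynomial.eval y.1 p := evA_apply Y p y

theorem PA_mult {m : ℕ} {Y : Set (Fin m → ℂ)} (hY : IsCompact Y) [CompactSpace Y] (hh : polyHull Y ⊆ Y)
    {y0 : Fin m → ℂ} {R M : ℝ} {L : (Fin m → ℂ) → ℂ}
    (hL : DifferentiableOn ℂ L (ball y0 R)) (hR : 0 < R) (hM : ∀ w ∈ ball y0 R, ‖L w‖ ≤ M)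
    (P : PA Y) {r1 r2 : ℝ} (h1 : 0 < r1) (h2 : r1 < r2)
    (hann : ∀ y : Y, P.1 y ∈ Ann r1 r2 → dist y.1 y0 < R / (8 * Real.exp 1 * (m + 1)) ∧ ∃ x : ℝ, 0 ≤ x ∧ x ≤ 1/10 ∧ L y.1 = x)
    (hin : ∀ y : Y, ‖P.1 y‖ ≤ r2 → dist y.1 y0 ≤ R / (8 * Real.exp 1) ∧ ∃ x : ℝ, 0 ≤ x ∧ x ≤ 1 ∧ L y.1 = x)
    (Ψ : C(Y, ℂ)) (hΨ : ∀ y : Y, Ψ y = ((kap r1 r2 (P.1 y) * max 0 ((L y.1).re - 1/2) : ℝ) : ℂ))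
    (f : C(Y, ℂ)) (hf : f ∈ PA Y) : Ψ * f ∈ PA Y := by
  have hcl : IsClosed (PA Y : Set C(Y, ℂ)) := Subalgebra.isClosed_topologicalClosure _
  obtain ⟨C, hC, hcore⟩ := core1 (PA Y) h1 h2 P
  rw [← SetLike.mem_coe, ← hcl.closure_eq, Metric.mem_closure_iff]
  intro e he
  set D := (C + 2) * (‖f‖ + 1) with hD
  have hD0 : 0 < D := by positivity
  set ε := e / (2 * D) with hε
  have hε0 : 0 < ε := by positivity
  obtain ⟨B, hB1, hB2⟩ := calc_small ((qm P (Ann r1 r2)).comp (evAh Y)) hL hR hM (fun Λ => by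
    obtain ⟨y, hy, hb⟩ := char_QA hY hh P (Ann r1 r2) Λ
    exact ⟨y, fun p => (hb _).trans (evAh_apply Y p y), hann y hy⟩) hε0
  have hB3 : ‖qm P (Ann r1 r2) (evAh Y B)‖ < ε := hB1
  have hn : ‖qm P (Ann r1 r2) (evAh Y B * ⟨f, hf⟩)‖ < ε * (‖f‖ + 1) := by
    rw [map_mul]
    refine (norm_mul_le _ _).trans_lt ?_
    have h7 : ‖qm P (Ann r1 r2) (⟨f, hf⟩ : PA Y)‖ ≤ ‖f‖ := qm_norm_le P (Ann r1 r2) _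
    exact mul_lt_mul'' hB3 (lt_of_le_of_lt h7 (lt_add_one _)) (norm_nonneg _) (norm_nonneg _)
  obtain ⟨Φ, hΦ⟩ := hcore _ _ hn
  refine ⟨Φ.1, Φ.2, ?_⟩
  clear hB1 hB3 hn hcore
  rw [dist_eq_norm]
  refine lt_of_le_of_lt ((ContinuousMap.norm_le _ (C := e/2) (by positivity)).2 fun y => ?_) (by linarith)
  have hΦy := hΦ y
  have hmul : (evAh Y B * ⟨f, hf⟩ : PA Y).1 y = MvPolynomial.eval y.1 B * f y := by
    rw [← evAh_apply Y B y]; rfl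
  rw [hmul] at hΦy
  have hfy : ‖f y‖ ≤ ‖f‖ := f.norm_coe_le_norm y
  have key : ‖Ψ y * f y - (kap r1 r2 (P.1 y) : ℂ) * (MvPolynomial.eval y.1 B * f y)‖ ≤ 2 * ε * (‖f‖ + 1) := by
    by_cases hP : ‖P.1 y‖ ≤ r2
    · obtain ⟨hd, x, hx0, hx1, hx⟩ := hin y hP
      have n5 := hB2 y.1 hd x hx0 hx1 hx
      have hre : (L y.1).re = x := by rw [hx]; simp
      rw [hΨ, hre]
      have k0 := kap_nonneg h2 (P.1 y)
      have k1 := kap_le_one h2 (P.1 y)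
      have e1 : ((kap r1 r2 (P.1 y) * max 0 (x - 1/2) : ℝ) : ℂ) * f y - (kap r1 r2 (P.1 y) : ℂ) * (MvPolynomial.eval y.1 B * f y)
          = (kap r1 r2 (P.1 y) : ℂ) * (((max 0 (x - 1/2) : ℝ) : ℂ) - MvPolynomial.eval y.1 B) * f y := by
        push_cast; ring
      rw [e1, norm_mul, norm_mul, Complex.norm_real, Real.norm_eq_abs, abs_of_nonneg k0]
      exact mul_le_mul ((mul_le_of_le_one_left (norm_nonneg _) k1).trans n5) (by linarith) (norm_nonneg _) (by positivity)
    · rw [hΨ, kap_zero (not_le.1 hP).le]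
      simp
      positivity
  have e2 : (Ψ * f - Φ.1) y = (Ψ y * f y - (kap r1 r2 (P.1 y) : ℂ) * (MvPolynomial.eval y.1 B * f y)) + ((kap r1 r2 (P.1 y) : ℂ) * (MvPolynomial.eval y.1 B * f y) - Φ.1 y) := by
    rw [ContinuousMap.sub_apply, ContinuousMap.mul_apply]; ring
  rw [e2]
  refine (norm_add_le _ _).trans ((add_le_add key hΦy).trans (le_of_eq ?_))
  rw [hε, hD]
  field_simp
  ring

theorem gap_radii {s : Set ℝ} (hs : IsClosed s) (hc : s.Countable) : ∃ r1 r2 : ℝ, 1/10 < r1 ∧ r1 < r2 ∧ r2 < 1/2 ∧ ∀ t ∈ s, ¬ (r1 ≤ t ∧ t ≤ r2) := by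
  obtain ⟨r1, h1, h2, h3⟩ := (hc.dense_compl ℝ).exists_between (show (1/10:ℝ) < 1/2 by norm_num)
  obtain ⟨e, he, heb⟩ := Metric.isOpen_iff.1 hs.isOpen_compl r1 h1
  have hm : 0 < min e (1/2 - r1) := lt_min he (by linarith)
  refine ⟨r1, r1 + min e (1/2 - r1) / 2, h2, by linarith, by linarith [min_le_right e (1/2 - r1)], fun t ht h => ?_⟩
  refine heb (a := t) ?_ ht
  rw [mem_ball, Real.dist_eq, abs_lt]
  constructor <;> linarith [min_le_left e (1/2 - r1)]

theorem geo2 {m : ℕ} {Y : Set (Fin m → ℂ)} (hY : IsCompact Y) [CompactSpace Y] (hh : polyHull Y ⊆ Y)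
    {y : Fin m → ℂ} (hy : y ∈ Y) {d1 ε : ℝ} (hd1 : 0 < d1) (hε : 0 < ε)
    (Q : MvPolynomial (Fin m) ℂ) (hQy : MvPolynomial.eval y Q = 0)
    (hQ : ∀ x ∈ Y, dist x y ≤ d1 → (MvPolynomial.eval x Q).re ≤ -ε * dist x y ^ 2)
    {U : Set (Fin m → ℂ)} (hU : IsOpen U) (hyU : y ∈ U) {L0 : (Fin m → ℂ) → ℂ} (hL0 : DifferentiableOn ℂ L0 U)
    (hreal : ∀ x ∈ Y, dist x y ≤ d1 → ∃ t : ℝ, 0 ≤ t ∧ t ≤ 1 ∧ L0 x = t) (hL1 : L0 y = 1)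
    (hcount : {x | x ∈ Y ∧ dist x y ≤ d1 ∧ L0 x = 1}.Countable)
    (hdense : ∀ (u : C(Y, ℂ)) (e : ℝ), 0 < e → ∃ p : MvPolynomial (Fin m) ℂ, ∀ x : Y, dist x.1 y ≤ d1 → ‖u x - MvPolynomial.eval x.1 p‖ < e) :
    ∃ Ψ : C(Y, ℂ), Ψ ⟨y, hy⟩ ≠ 0 ∧ ∀ f, Ψ * f ∈ PA Y := by
  have he : 1 < Real.exp 1 := by simp
  obtain ⟨r, hr, M, hM, hbU, hbM, -⟩ := bdd_ball hU hL0 hyU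
  set R := 4 * r with hR
  have hR0 : 0 < R := by positivity
  have hm1 : (1:ℝ) ≤ m + 1 := by linarith [(m.cast_nonneg : (0:ℝ) ≤ m)]
  set r0 := R / (8 * Real.exp 1 * (m + 1)) with hr0
  have hr00 : 0 < r0 := by positivity
  have hr01 : r0 ≤ R / (8 * Real.exp 1) := div_le_div_of_nonneg_left hR0.le (by positivity) (le_mul_of_one_le_right (by positivity) hm1)
  have hr02 : R / (8 * Real.exp 1) < R := div_lt_self hR0 (by linarith)
  set d0 := min d1 r0 with hd0
  obtain ⟨Φ, hΦ1, hΦ2⟩ := peak hY hh hy hd1 hε Q hQy hQ (show 0 < d0 from lt_min hd1 hr00) (show (0:ℝ) < 1/10 by norm_num)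
  set p : (Fin m → ℂ) → ℂ := fun x => MvPolynomial.eval x (1 - Φ) with hp
  have hpc : Continuous p := MvPolynomial.continuous_eval _
  have hpx : ∀ x, p x = 1 - MvPolynomial.eval x Φ := fun x => by simp [hp]
  have hpy : ‖p y‖ < 1/10 := by rw [hpx, norm_sub_rev]; exact hΦ1
  have hloc : ∀ x ∈ Y, ‖p x‖ ≤ 1/2 → dist x y < d0 := by
    intro x hx hpx2
    by_contra! hcon
    have h1 := hΦ2 x hx hcon
    have h2 := norm_sub_norm_le (1:ℂ) (MvPolynomial.eval x Φ)
    rw [norm_one, ← hpx] at h2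
    linarith
  have hL0c : ContinuousOn L0 (ball y R) := (hL0.mono hbU).continuousOn
  have hballd : ∀ x, dist x y < d0 → x ∈ ball y R := fun x hx => hx.trans_le ((min_le_right _ _).trans (hr01.trans hr02.le))
  -- fibre
  set Z := {x | x ∈ Y ∧ ‖p x‖ ≤ 1/2 ∧ L0 x = 1} with hZ
  have hW : IsCompact (Y ∩ {x | ‖p x‖ ≤ 1/2}) := hY.inter_right (isClosed_le hpc.norm continuous_const)
  have hWb : Y ∩ {x | ‖p x‖ ≤ 1/2} ⊆ ball y R := fun x hx => hballd x (hloc x hx.1 hx.2)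
  have hZc : IsCompact Z := by
    have : Z = (Y ∩ {x | ‖p x‖ ≤ 1/2}) ∩ L0 ⁻¹' {1} := by
      ext x; exact ⟨fun h => ⟨⟨h.1, h.2.1⟩, h.2.2⟩, fun h => ⟨h.1.1, h.1.2, h.2⟩⟩
    rw [this]
    exact hW.of_isClosed_subset (ContinuousOn.preimage_isClosed_of_isClosed (hL0c.mono hWb) hW.isClosed isClosed_singleton) Set.inter_subset_left
  have hZn : Z.Countable := hcount.mono fun x (hx : x ∈ Y ∧ ‖p x‖ ≤ 1/2 ∧ L0 x = 1) => show x ∈ Y ∧ dist x y ≤ d1 ∧ L0 x = 1 from ⟨hx.1, ((hloc x hx.1 hx.2.1).le.trans (min_le_left _ _)), hx.2.2⟩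
  obtain ⟨r1, r2, hr1, hr12, hr2, hgap⟩ := gap_radii (hZc.image hpc.norm).isClosed (hZn.image fun x => ‖p x‖)
  set A := Y ∩ {x | r1 ≤ ‖p x‖ ∧ ‖p x‖ ≤ r2} with hA
  have hAc : IsCompact A := hY.inter_right ((isClosed_le continuous_const hpc.norm).inter (isClosed_le hpc.norm continuous_const))
  have hAW : A ⊆ Y ∩ {x | ‖p x‖ ≤ 1/2} := fun x hx => ⟨hx.1, show ‖p x‖ ≤ 1/2 by linarith [hx.2.2]⟩
  have hq : ∃ q : ℝ, 0 ≤ q ∧ q < 1 ∧ ∀ x ∈ A, (L0 x).re ≤ q := by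
    rcases A.eq_empty_or_nonempty with h0 | h0
    · exact ⟨0, le_rfl, one_pos, fun x hx => by rw [h0] at hx; exact hx.elim⟩
    · obtain ⟨a, ha, hmax⟩ := hAc.exists_isMaxOn h0 (Complex.continuous_re.comp_continuousOn (hL0c.mono (hAW.trans hWb)))
      obtain ⟨t, ht0, ht1, ht⟩ := hreal a ha.1 ((hloc a ha.1 (hAW ha).2).le.trans (min_le_left _ _))
      refine ⟨t, ht0, lt_of_le_of_ne ht1 ?_, fun x hx => ?_⟩
      · rintro rfl
        exact hgap _ ⟨a, ⟨ha.1, (hAW ha).2, by simpa using ht⟩, rfl⟩ ha.2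
      · have := hmax hx
        simp only [Set.mem_setOf_eq, Function.comp, ht, Complex.ofReal_re] at this
        exact this
  obtain ⟨q, hq0, hq1, hqA⟩ := hq
  obtain ⟨l, hl⟩ := exists_pow_lt_of_lt_one (show (0:ℝ) < 1/10 by norm_num) hq1
  set L : (Fin m → ℂ) → ℂ := fun x => L0 x ^ l with hL
  have hLd : DifferentiableOn ℂ L (ball y R) := (hL0.mono hbU).pow l
  have hLM : ∀ w ∈ ball y R, ‖L w‖ ≤ M ^ l := fun w hw => by
    simp only [hL, norm_pow]; exact pow_le_pow_left₀ (norm_nonneg _) (hbM w hw) l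
  have hLin : ∀ x ∈ Y, dist x y ≤ d1 → ∃ t : ℝ, 0 ≤ t ∧ t ≤ 1 ∧ L x = t := fun x hx hd => by
    obtain ⟨t, ht0, ht1, ht⟩ := hreal x hx hd
    exact ⟨t ^ l, by positivity, pow_le_one₀ ht0 ht1, by simp [hL, ht]⟩
  set P : PA Y := evA Y (1 - Φ) with hP
  have hPx : ∀ x : Y, P.1 x = p x.1 := fun x => evA_apply Y _ x
  have hΨc : Continuous fun x : Y => ((kap r1 r2 (P.1 x) * max 0 ((L x.1).re - 1/2) : ℝ) : ℂ) := by
    rw [continuous_iff_continuousAt]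
    intro x
    by_cases hx : ‖p x.1‖ < 1/2
    · have h1 : ContinuousAt L x.1 := hLd.continuousOn.continuousAt (isOpen_ball.mem_nhds (hballd _ (hloc x.1 x.2 hx.le)))
      have h2 : ContinuousAt (fun x : Y => L x.1) x := h1.comp continuous_subtype_val.continuousAt
      have h3 : Continuous fun x : Y => kap r1 r2 (P.1 x) := (kap_cont r1 r2).comp P.1.continuous
      have h4 : ContinuousAt (fun x : Y => (L x.1).re) x := Complex.continuous_re.continuousAt.comp h2
      exact Complex.continuous_ofReal.continuousAt.comp (h3.continuousAt.mul (continuousAt_const.max (h4.sub continuousAt_const)))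
    · have h5 : ∀ᶠ x' : Y in nhds x, r2 < ‖p x'.1‖ :=
        (hpc.norm.comp continuous_subtype_val).continuousAt.eventually_const_lt (show r2 < ‖p x.1‖ by linarith [not_lt.1 hx])
      refine (continuousAt_const (y := (0:ℂ))).congr ?_
      filter_upwards [h5] with x' hx'
      rw [kap_zero (by rw [hPx]; exact hx'.le)]
      simp
  set Ψ : C(Y, ℂ) := ⟨_, hΨc⟩ with hΨ
  have hΨv : ∀ x : Y, Ψ x = ((kap r1 r2 (P.1 x) * max 0 ((L x.1).re - 1/2) : ℝ) : ℂ) := fun x => rfl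
  refine ⟨Ψ, ?_, ?_⟩
  · rw [hΨv, kap_one hr12 (by rw [hPx]; exact (hpy.trans hr1).le)]
    simp only [hL, hL1]
    norm_num
  · have hmult := PA_mult hY hh hLd hR0 hLM P (show 0 < r1 by linarith) hr12 (fun x hx => by
      have hxA : x.1 ∈ A := ⟨x.2, show r1 ≤ ‖p x.1‖ ∧ ‖p x.1‖ ≤ r2 by rw [← hPx]; exact hx⟩
      have hd := hloc x.1 x.2 (hAW hxA).2
      refine ⟨hd.trans_le (min_le_right _ _), ?_⟩
      obtain ⟨t, ht0, ht1, ht⟩ := hreal x.1 x.2 (hd.le.trans (min_le_left _ _))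
      refine ⟨t ^ l, by positivity, ?_, by simp [hL, ht]⟩
      have := hqA x.1 hxA
      rw [ht, Complex.ofReal_re] at this
      exact (pow_le_pow_left₀ ht0 this l).trans hl.le) (fun x hx => by
      have hd := hloc x.1 x.2 (by rw [← hPx]; linarith)
      exact ⟨hd.le.trans ((min_le_right _ _).trans hr01), hLin x.1 x.2 (hd.le.trans (min_le_left _ _))⟩) Ψ hΨv
    intro f
    have hcl : IsClosed (PA Y : Set C(Y, ℂ)) := Subalgebra.isClosed_topologicalClosure _
    rw [← SetLike.mem_coe, ← hcl.closure_eq, Metric.mem_closure_iff]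
    intro e he
    obtain ⟨s, hs⟩ := hdense f (e / 2) (by positivity)
    refine ⟨_, hmult _ (evA Y s).2, ?_⟩
    rw [dist_eq_norm]
    refine lt_of_le_of_lt ((ContinuousMap.norm_le _ (C := e/2) (by positivity)).2 fun x => ?_) (by linarith)
    rw [← mul_sub, ContinuousMap.mul_apply, norm_mul, ContinuousMap.sub_apply, evA_apply]
    by_cases hx : ‖p x.1‖ ≤ 1/2
    · have hd := (hloc x.1 x.2 hx).le.trans (min_le_left _ _)
      obtain ⟨t, ht0, ht1, ht⟩ := hLin x.1 x.2 hd
      have h1 : ‖Ψ x‖ ≤ 1 := by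
        rw [hΨv, ht, Complex.ofReal_re, Complex.norm_real, Real.norm_eq_abs,
          abs_of_nonneg (mul_nonneg (kap_nonneg hr12 _) (le_max_left _ _))]
        exact mul_le_one₀ (kap_le_one hr12 _) (le_max_left _ _) (max_le (by norm_num) (by linarith))
      exact (mul_le_of_le_one_left (norm_nonneg _) h1).trans (hs x hd).le
    · have h1 : Ψ x = 0 := by
        rw [hΨv, kap_zero (by rw [hPx]; linarith [not_le.1 hx])]; simp
      rw [h1]; simp; positivity

theorem geo {n N : ℕ} {Ω : Set (Fin n → ℂ)} (hop : IsOpen Ω) {h : Fin N → (Fin n → ℂ) → ℂ}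
    (hph : ∀ j, Pluriharmonic (h j) Ω) (h3 : ¬ HDisc h Ω) {E : Set (Fin n → ℂ)} (hE : IsCompact E)
    (hc : ∀ j, ContinuousOn (h j) E) [CompactSpace (graphSet h E)] (hh : polyHull (graphSet h E) ⊆ graphSet h E)
    {z1 : Fin n → ℂ} (hz1 : z1 ∈ E) (hz1Ω : z1 ∈ Ω) :
    ∃ y : graphSet h E, ∃ Ψ : C(graphSet h E, ℂ), Ψ y ≠ 0 ∧ ∀ f, Ψ * f ∈ PA (graphSet h E) := by
  have he : 1 < Real.exp 1 := by simp
  obtain ⟨r, hr, hbΩ, F, G, hF, hG, hFG⟩ := local_ph hop hph hz1Ω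
  have hd : DifferentiableOn ℂ (fun w => ((fun j => F j w, fun j => G j w) : (Fin N → ℂ) × (Fin N → ℂ))) (ball z1 r) :=
    (differentiableOn_pi.2 hF).prodMk (differentiableOn_pi.2 hG)
  obtain ⟨r', hr', M, hM, hbr, hbM, -⟩ := bdd_ball isOpen_ball hd (mem_ball_self hr)
  set R := 4 * r' with hR
  have hR0 : 0 < R := by positivity
  have hFM : ∀ j, ∀ w ∈ ball z1 R, ‖F j w‖ ≤ M := fun j w hw =>
    (norm_le_pi_norm (fun j => F j w) j).trans ((norm_fst_le _).trans (hbM w hw))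
  have hGM : ∀ j, ∀ w ∈ ball z1 R, ‖G j w‖ ≤ M := fun j w hw =>
    (norm_le_pi_norm (fun j => G j w) j).trans ((norm_snd_le _).trans (hbM w hw))
  replace hF := fun j => (hF j).mono hbr
  replace hG := fun j => (hG j).mono hbr
  replace hFG : ∀ j, ∀ w ∈ ball z1 R, h j w = F j w + starRingEnd ℂ (G j w) := fun j w hw => hFG j w (hbr hw)
  have hb : ball z1 R ⊆ Ω := hbr.trans hbΩ
  set ρ := R / (8 * Real.exp 1) with hρ
  have hρ0 : 0 < ρ := by positivity
  have hρR : ρ < R := div_lt_self hR0 (by linarith)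
  set B := E ∩ closedBall z1 ρ with hB
  have hBc : IsCompact B := hE.inter_right isClosed_closedBall
  have hBR : B ⊆ ball z1 R := fun x hx => lt_of_le_of_lt hx.2 hρR
  have hYc := graph_compact hE hc
  have hYBc : IsCompact (graphSet h B) := graph_compact hBc fun j => (hc j).mono Set.inter_subset_left
  haveI : CompactSpace (graphSet h B) := isCompact_iff_compactSpace.1 hYBc
  have hPA : PA (graphSet h B) = ⊤ := loc_dense h3 hR0 hb hF hG hFG hFM hGM hBc fun x hx => hx.2
  set y : Fin (n + N) → ℂ := Fin.append z1 (fun j => h j z1) with hy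
  have hyY : y ∈ graphSet h E := ⟨z1, hz1, rfl⟩
  have hpy : pr1 y = z1 := pr1_append _ _
  have hloc : ∀ x ∈ graphSet h E, dist x y ≤ ρ → x ∈ graphSet h B := fun x hx hxy => by
    rw [mem_graph] at hx ⊢
    refine ⟨⟨hx.1, ?_⟩, hx.2⟩
    rw [mem_closedBall, ← hpy]
    exact (pr1_dist x y).trans hxy
  have hsub : graphSet h B ⊆ graphSet h E := Set.image_mono Set.inter_subset_left
  -- local approximation
  have happ : ∀ (u : C(graphSet h B, ℂ)) (e : ℝ), 0 < e → ∃ p : MvPolynomial (Fin (n + N)) ℂ,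
      ∀ x : graphSet h B, ‖u x - MvPolynomial.eval x.1 p‖ < e := fun u e he =>
    mem_PA.1 (show u ∈ PA (graphSet h B) by rw [hPA]; trivial) e he
  obtain ⟨Q0, hQ0⟩ := happ ⟨fun x => ((-(dist x.1 y ^ 2) : ℝ) : ℂ), by fun_prop⟩ (ρ ^ 2 / 4) (by positivity)
  have hre : ∀ x : graphSet h B, |(-(dist x.1 y ^ 2)) - (MvPolynomial.eval x.1 Q0).re| < ρ ^ 2 / 4 := fun x => by
    have h1 := (Complex.abs_re_le_norm _).trans_lt (hQ0 x)
    simpa only [ContinuousMap.coe_mk, Complex.sub_re, Complex.ofReal_re] using h1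
  obtain ⟨y', hy', hyy, ε, hε, Q, hQy, hQ⟩ := pert hYc hyY hρ0 Q0 (fun x hx hxy => by
    have h1 := abs_lt.1 (hre ⟨x, hloc x hx hxy.le⟩)
    have h2 := abs_lt.1 (hre ⟨y, hloc y hyY (by simpa using hρ0.le)⟩)
    simp only [dist_self, hxy] at h1 h2
    nlinarith [h1.1, h1.2, h2.1, h2.2, sq_pos_of_pos hρ0])
  set d1 := ρ - dist y' y with hd1
  have hd10 : 0 < d1 := by linarith
  have htr : ∀ x, dist x y' ≤ d1 → dist x y ≤ ρ := fun x hx => by linarith [dist_triangle x y' y]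
  have hYb : ∀ x ∈ graphSet h E, dist x y' ≤ d1 → x ∈ graphSet h B := fun x hx hxy => hloc x hx (htr x hxy)
  set c := fun j => G j (pr1 y') with hcd
  set U : Set (Fin (n + N) → ℂ) := pr1 ⁻¹' (ball z1 R) with hU
  have hUo : IsOpen U := isOpen_ball.preimage pr1_diff.continuous
  have hBU : ∀ x ∈ graphSet h B, pr1 x ∈ ball z1 R := fun x hx => hBR (mem_graph.1 hx).1
  have hy'B : y' ∈ graphSet h B := hYb y' hy' (by simpa using hd10.le)
  set Mc : ℝ := N * (2 * M) ^ 2 + 1 with hMc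
  have hMc0 : 0 < Mc := by positivity
  set L0 : (Fin (n + N) → ℂ) → ℂ := fun x => 1 - (∑ j, (pr2 x j - F j (pr1 x) - starRingEnd ℂ (c j)) * (G j (pr1 x) - c j)) / (Mc : ℂ) with hL
  have hmaps : Set.MapsTo (pr1 : (Fin (n + N) → ℂ) → _) U (ball z1 R) := fun x hx => hx
  have hLd : DifferentiableOn ℂ L0 U := by
    have hS : DifferentiableOn ℂ (fun x => ∑ j, (pr2 x j - F j (pr1 x) - starRingEnd ℂ (c j)) * (G j (pr1 x) - c j)) U := by
     refine DifferentiableOn.fun_sum fun j _ => ?_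
     exact DifferentiableOn.mul (((pr2_diff j).differentiableOn.sub ((hF j).comp pr1_diff.differentiableOn hmaps)).sub_const _)
      (((hG j).comp pr1_diff.differentiableOn hmaps).sub_const _)
    simp only [hL, div_eq_mul_inv]
    exact (hS.mul_const _).const_sub _
  have hLv : ∀ x ∈ graphSet h B, L0 x = ((1 - (∑ j, ‖G j (pr1 x) - c j‖ ^ 2) / Mc : ℝ) : ℂ) := by
    intro x hx
    simp only [hL]
    push_cast
    congr 2
    refine Finset.sum_congr rfl fun j _ => ?_
    rw [(mem_graph.1 hx).2 j, hFG j _ (hBU x hx), ← Complex.conj_mul', map_sub]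
    ring
  have hsum : ∀ x ∈ graphSet h B, ∑ j, ‖G j (pr1 x) - c j‖ ^ 2 ≤ Mc := by
    intro x hx
    have h1 : ∀ j ∈ Finset.univ, ‖G j (pr1 x) - c j‖ ^ 2 ≤ (2 * M) ^ 2 := fun j _ => by
      refine pow_le_pow_left₀ (norm_nonneg _) ((norm_sub_le _ _).trans ?_) 2
      linarith [hGM j _ (hBU x hx), hGM j _ (hBU y' hy'B)]
    have h2 := Finset.sum_le_card_nsmul _ _ _ h1
    simp only [Finset.card_univ, Fintype.card_fin, nsmul_eq_mul] at h2
    linarith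
  have key := geo2 (U := U) (L0 := L0) (d1 := d1) hYc hh hy' hd10 hε Q hQy (fun x hx hxy => hQ x hx (htr x hxy)) hUo (hBU y' hy'B) hLd
    (fun x hx hxy => ⟨_, by
      have := (div_le_one hMc0).2 (hsum x (hYb x hx hxy))
      linarith, by
      have : 0 ≤ (∑ j, ‖G j (pr1 x) - c j‖ ^ 2) / Mc := by positivity
      linarith, hLv x (hYb x hx hxy)⟩) (by rw [hLv y' hy'B]; simp [hcd]) ?_ ?_
  · obtain ⟨Ψ, h1, h2⟩ := key
    exact ⟨⟨y', hy'⟩, Ψ, h1, h2⟩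
  · have h1 := (fib_count h3 hb hF hG hFG hBc hBR c).2
    have h2 : ∀ x ∈ {x | x ∈ graphSet h E ∧ dist x y' ≤ d1 ∧ L0 x = 1}, pr1 x ∈ {w | w ∈ B ∧ ∀ j, G j w = c j} := by
      rintro x ⟨hx, hxy, hx1⟩
      have hxB := hYb x hx hxy
      refine ⟨(mem_graph.1 hxB).1, fun j => ?_⟩
      rw [hLv x hxB] at hx1
      have h4 : 1 - (∑ j, ‖G j (pr1 x) - c j‖ ^ 2) / Mc = 1 := by exact_mod_cast hx1
      have h5 : ∑ j, ‖G j (pr1 x) - c j‖ ^ 2 = 0 := by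
        have : (∑ j, ‖G j (pr1 x) - c j‖ ^ 2) / Mc = 0 := by linarith
        exact (div_eq_zero_iff.1 this).resolve_right hMc0.ne'
      rw [Finset.sum_eq_zero_iff_of_nonneg (fun j _ => by positivity)] at h5
      exact sub_eq_zero.1 (by simpa using h5 j (Finset.mem_univ j))
    exact Set.MapsTo.countable_of_injOn (f := pr1) h2 (fun x hx w hw hxw => graph_inj hx.1 hw.1 hxw) h1
  · intro u e he
    obtain ⟨p, hp⟩ := happ (u.comp ⟨Set.inclusion hsub, continuous_inclusion hsub⟩) e he
    exact ⟨p, fun x hx => hp ⟨x.1, hYb x.1 x.2 hx⟩⟩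

def multI {m : ℕ} (Y : Set (Fin m → ℂ)) [CompactSpace Y] : Ideal C(Y, ℂ) where
  carrier := {f | ∀ u, f * u ∈ PA Y}
  add_mem' {f g} hf hg u := by rw [add_mul]; exact (PA Y).add_mem (hf u) (hg u)
  zero_mem' u := by rw [zero_mul]; exact (PA Y).zero_mem
  smul_mem' c f hf u := by rw [smul_eq_mul, mul_comm c f, mul_assoc]; exact hf _

theorem multI_closed {m : ℕ} (Y : Set (Fin m → ℂ)) [CompactSpace Y] : IsClosed (multI Y : Set C(Y, ℂ)) := by
  have hcl : IsClosed (PA Y : Set C(Y, ℂ)) := Subalgebra.isClosed_topologicalClosure _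
  have : (multI Y : Set C(Y, ℂ)) = ⋂ u : C(Y, ℂ), (fun f => f * u) ⁻¹' (PA Y : Set C(Y, ℂ)) := by
    ext f; simp only [Set.mem_iInter, Set.mem_preimage, SetLike.mem_coe]; exact Iff.rfl
  rw [this]
  exact isClosed_iInter fun u => hcl.preimage (by fun_prop)

theorem glob {m : ℕ} {Y S : Set (Fin m → ℂ)} [CompactSpace Y] (hY : IsCompact Y) (hh : polyHull Y ⊆ Y)
    (hS : ∀ M : Set (Fin m → ℂ), ∀ hMc : IsCompact M, M ⊆ Y → polyHull M ⊆ M → (∃ x ∈ M, x ∉ S) →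
      haveI : CompactSpace M := isCompact_iff_compactSpace.1 hMc
      ∃ y : M, ∃ Ψ : C(M, ℂ), Ψ y ≠ 0 ∧ ∀ f, Ψ * f ∈ PA M)
    (f : C(Y, ℂ)) (hf : ∀ ε > 0, ∃ p : MvPolynomial (Fin m) ℂ, ∀ x : Y, x.1 ∈ S → ‖f x - MvPolynomial.eval x.1 p‖ < ε) :
    f ∈ PA Y := by
  have hcl : IsClosed (PA Y : Set C(Y, ℂ)) := Subalgebra.isClosed_topologicalClosure _
  set M' : Set Y := (ContinuousMap.setOfIdeal (multI Y))ᶜ with hM'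
  have hM'c : IsClosed M' := (ContinuousMap.setOfIdeal_open (multI Y)).isClosed_compl
  have hvan : ∀ g : C(Y, ℂ), (∀ x ∈ M', g x = 0) → g ∈ multI Y := fun g hg => by
    rw [← ContinuousMap.idealOfSet_ofIdeal_isClosed (multI_closed Y), ContinuousMap.mem_idealOfSet]
    exact fun x hx => hg x hx
  have hmem : ∀ x : Y, x ∈ M' ↔ ∀ g ∈ multI Y, g x = 0 := fun x => by
    rw [hM', Set.mem_compl_iff, ContinuousMap.notMem_setOfIdeal]
  set M : Set (Fin m → ℂ) := Subtype.val '' M' with hM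
  have hMc : IsCompact M := (hM'c.isCompact).image continuous_subtype_val
  haveI : CompactSpace M := isCompact_iff_compactSpace.1 hMc
  have hMY : M ⊆ Y := by rintro _ ⟨x, -, rfl⟩; exact x.2
  have hMM : ∀ x : Y, x.1 ∈ M ↔ x ∈ M' := fun x => by
    constructor
    · rintro ⟨x', hx', hxx⟩; rwa [← Subtype.ext hxx]
    · exact fun hx => ⟨x, hx, rfl⟩
  -- approximation on M suffices
  have hi : ∀ g : C(Y, ℂ), (∀ ε > 0, ∃ p : MvPolynomial (Fin m) ℂ, ∀ x : Y, x.1 ∈ M → ‖g x - MvPolynomial.eval x.1 p‖ < ε) →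
      g ∈ PA Y := by
    intro g hg
    rw [← SetLike.mem_coe, ← hcl.closure_eq, Metric.mem_closure_iff]
    intro e he
    obtain ⟨p, hp⟩ := hg (e / 2) (by positivity)
    set k : C(Y, ℂ) := g - (evA Y p).1 with hk
    have hkx : ∀ x, k x = g x - MvPolynomial.eval x.1 p := fun x => by
      rw [hk, ContinuousMap.sub_apply, evA_apply]
    have hpos : ∀ x, 0 < max ‖k x‖ (e / 2) := fun x => lt_max_of_lt_right (by positivity)
    set k2 : C(Y, ℂ) := ⟨fun x => k x * ((e / 2 / max ‖k x‖ (e / 2) : ℝ) : ℂ), by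
      refine k.continuous.mul (Complex.continuous_ofReal.comp ?_)
      exact continuous_const.div (k.continuous.norm.max continuous_const) fun x => (hpos x).ne'⟩ with hk2
    have hk2x : ∀ x, k2 x = k x * ((e / 2 / max ‖k x‖ (e / 2) : ℝ) : ℂ) := fun x => rfl
    have h1 : k - k2 ∈ multI Y := hvan _ fun x hx => by
      have := hp x ((hMM x).2 hx)
      rw [← hkx] at this
      rw [ContinuousMap.sub_apply, hk2x, max_eq_right this.le, div_self (by positivity)]
      simp
    have h2 : k - k2 ∈ PA Y := by simpa using h1 1
    refine ⟨(evA Y p).1 + (k - k2), (PA Y).add_mem (evA Y p).2 h2, ?_⟩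
    have h3 : g - ((evA Y p).1 + (k - k2)) = k2 := by rw [hk]; abel
    rw [dist_eq_norm, h3]
    refine lt_of_le_of_lt ((ContinuousMap.norm_le _ (C := e/2) (by positivity)).2 fun x => ?_) (by linarith)
    rw [hk2x, norm_mul, Complex.norm_real, Real.norm_eq_abs, abs_of_nonneg (div_nonneg (by positivity) (hpos x).le),
      ← mul_div_assoc, div_le_iff₀ (hpos x), mul_comm]
    exact mul_le_mul_of_nonneg_left (le_max_left _ _) (by positivity)
  -- polynomial convexity
  have hMh : polyHull M ⊆ M := by
    intro x hx
    have hxY : x ∈ Y := hh (hull_of hY fun p C hC h => hull_le hx p hC fun w hw => h w (hMY hw))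
    by_contra hxM
    have h1 : (⟨x, hxY⟩ : Y) ∉ M' := fun h => hxM ⟨_, h, rfl⟩
    rw [hmem] at h1
    push Not at h1
    obtain ⟨g, hg, hgx⟩ := h1
    have h2 := hg (ContinuousMap.const Y (g ⟨x, hxY⟩)⁻¹)
    obtain ⟨p, hp⟩ := mem_PA.1 h2 (1/3) (by norm_num)
    have h3 := hull_le hx p (C := 1/3) (by norm_num) fun w hw => by
      have h4 := hp ⟨w, hMY hw⟩
      have h5 : g ⟨w, hMY hw⟩ = 0 := (hmem _).1 ((hMM ⟨w, hMY hw⟩).1 hw) g hg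
      rw [ContinuousMap.mul_apply, h5, zero_mul, zero_sub, norm_neg] at h4
      exact h4.le
    have h6 := hp ⟨x, hxY⟩
    rw [ContinuousMap.mul_apply, ContinuousMap.const_apply, mul_inv_cancel₀ hgx] at h6
    have h7 := norm_sub_norm_le (1:ℂ) (MvPolynomial.eval x p)
    rw [norm_one] at h7
    linarith
  have hMS : M ⊆ S := by
    by_contra hcon
    obtain ⟨x, hxM, hxS⟩ := Set.not_subset.1 hcon
    obtain ⟨y, Ψ, hΨ, hΨm⟩ := hS M hMc hMY hMh ⟨x, hxM, hxS⟩
    have hemb : Topology.IsClosedEmbedding (Set.inclusion hMY) :=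
      (continuous_inclusion hMY).isClosedEmbedding (Set.inclusion_injective hMY)
    obtain ⟨g, hg⟩ := ContinuousMap.exists_extension hemb Ψ
    have hgx : ∀ x : M, g ⟨x.1, hMY x.2⟩ = Ψ x := fun x => by rw [← hg]; rfl
    have hgI : g ∈ multI Y := fun u => by
      refine hi _ fun ε hε => ?_
      obtain ⟨p, hp⟩ := mem_PA.1 (hΨm (u.comp ⟨Set.inclusion hMY, continuous_inclusion hMY⟩)) ε hε
      refine ⟨p, fun x hx => ?_⟩
      have := hp ⟨x.1, hx⟩
      rw [ContinuousMap.mul_apply, ← hgx] at this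
      exact this
    exact hΨ (by rw [← hgx]; exact (hmem _).1 ((hMM ⟨y.1, hMY y.2⟩).1 y.2) g hgI)
  exact hi f fun ε hε => by
    obtain ⟨p, hp⟩ := hf ε hε
    exact ⟨p, fun x hx => hp x (hMS hx)⟩

theorem genAlg_iff {n N : ℕ} {h : Fin N → (Fin n → ℂ) → ℂ} {E : Set (Fin n → ℂ)} (hE : IsCompact E)
    (hc : ∀ j, ContinuousOn (h j) E) (g : C(E, ℂ)) :
    g ∈ genAlg (zhGens E h) ↔ ∀ ε > 0, ∃ p : MvPolynomial (Fin (n + N)) ℂ, ∀ z : E,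
      ‖g z - MvPolynomial.eval (Fin.append z.1 (fun j => h j z.1)) p‖ < ε := by
  haveI : CompactSpace E := isCompact_iff_compactSpace.1 hE
  set γ : Fin (n + N) → C(E, ℂ) := fun i => ⟨fun z => (Fin.append z.1 (fun j => h j z.1) : Fin (n + N) → ℂ) i,
    (continuous_apply i).comp (continuousOn_iff_continuous_domRestrict.1 (graph_cont hc))⟩ with hγ
  have hγe : ∀ (p : MvPolynomial (Fin (n + N)) ℂ) (z : E), MvPolynomial.aeval γ p z = MvPolynomial.eval (Fin.append z.1 (fun j => h j z.1)) p := by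
    intro p z
    induction p using MvPolynomial.induction_on with
    | C a => simp
    | add p q hp hq => simp [hp, hq]
    | mul_X p i hp => rw [map_mul, map_mul, ContinuousMap.mul_apply, hp, MvPolynomial.aeval_X, MvPolynomial.eval_X]; rfl
  have hgen : zhGens E h = Set.range γ := by
    ext g
    constructor
    · rintro (⟨i, hi⟩ | ⟨j, hj⟩)
      · exact ⟨Fin.castAdd N i, by ext z; simp [hγ, hi]⟩
      · exact ⟨Fin.natAdd n j, by ext z; simp [hγ, hj]⟩
    · rintro ⟨i, rfl⟩
      refine Fin.addCases (fun i => ?_) (fun j => ?_) i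
      · exact Or.inl ⟨i, fun z => by simp [hγ]⟩
      · exact Or.inr ⟨j, fun z => by simp [hγ]⟩
  rw [genAlg, hgen, Algebra.adjoin_range_eq_range_aeval, Metric.mem_closure_iff]
  refine forall₂_congr fun ε hε => ?_
  constructor
  · rintro ⟨_, ⟨p, rfl⟩, hp⟩
    refine ⟨p, fun z => ?_⟩
    have h1 := (ContinuousMap.dist_lt_iff hε).1 hp z
    rw [dist_eq_norm] at h1
    rw [← hγe]; exact h1
  · rintro ⟨p, hp⟩
    refine ⟨MvPolynomial.aeval γ p, ⟨p, rfl⟩, (ContinuousMap.dist_lt_iff hε).2 fun z => ?_⟩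
    rw [dist_eq_norm, hγe]; exact hp z

theorem T6 {n N : ℕ} {Ω : Set (Fin n → ℂ)} (hbd : Bornology.IsBounded Ω) (hop : IsOpen Ω)
    (hC1 : C1Boundary Ω) (hpc : polyHull (closure Ω) = closure Ω)
    {h : Fin N → (Fin n → ℂ) → ℂ} (hcont : ∀ j, ContinuousOn (h j) (closure Ω)) (hph : ∀ j, Pluriharmonic (h j) Ω)
    (h3 : ¬ HDisc h Ω) : genAlg (zhGens (closure Ω) h) =
          {f : C(closure Ω, ℂ) |
            f.comp ⟨Set.inclusion (frontier_subset_closure (s := Ω)),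
              continuous_inclusion (frontier_subset_closure (s := Ω))⟩ ∈
              genAlg (zhGens (frontier Ω) h)} := by
  have hcl : IsCompact (closure Ω) := hbd.isCompact_closure
  have hfc : IsCompact (frontier Ω) := hcl.of_isClosed_subset isClosed_frontier frontier_subset_closure
  have hcf : ∀ j, ContinuousOn (h j) (frontier Ω) := fun j => (hcont j).mono frontier_subset_closure
  have hYc : IsCompact (graphSet h (closure Ω)) := graph_compact hcl hcont
  haveI : CompactSpace (graphSet h (closure Ω)) := isCompact_iff_compactSpace.1 hYc
  ext f
  rw [Set.mem_setOf_eq, genAlg_iff hcl hcont, genAlg_iff hfc hcf]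
  constructor
  · intro hf ε hε
    obtain ⟨p, hp⟩ := hf ε hε
    exact ⟨p, fun z => hp ⟨z.1, frontier_subset_closure z.2⟩⟩
  · intro hf
    have hpr : ∀ x : graphSet h (closure Ω), pr1 x.1 ∈ closure Ω := fun x => (mem_graph.1 x.2).1
    set g : C(graphSet h (closure Ω), ℂ) := ⟨fun x => f ⟨pr1 x.1, hpr x⟩,
      f.continuous.comp ((pr1_diff.continuous.comp continuous_subtype_val).subtype_mk _)⟩ with hg
    have hap : ∀ x ∈ graphSet h (closure Ω), (Fin.append (pr1 x) (fun j => h j (pr1 x)) : Fin (n + N) → ℂ) = x := fun x hx => by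
      conv_rhs => rw [← append_pr x]
      exact congrArg (Fin.append (pr1 x)) (funext fun j => ((mem_graph.1 hx).2 j).symm)
    have key : g ∈ PA (graphSet h (closure Ω)) := by
      refine glob (S := graphSet h (frontier Ω)) hYc (T2 hbd hop hC1 hpc hcont hph) ?_ g ?_
      · intro M hMc hMY hMh hx
        obtain ⟨E, hE, rfl⟩ : ∃ E, IsCompact E ∧ M = graphSet h E := by
          refine ⟨pr1 '' M, hMc.image pr1_diff.continuous, ?_⟩
          ext x
          constructor
          · exact fun hx => mem_graph.2 ⟨⟨x, hx, rfl⟩, (mem_graph.1 (hMY hx)).2⟩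
          · intro hx
            obtain ⟨x', hx', hxx⟩ := (mem_graph.1 hx).1
            rwa [graph_inj hx (hMY hx') hxx.symm]
        obtain ⟨x, hxE, hxS⟩ := hx
        have hEΩ : E ⊆ closure Ω := fun z hz => by
          have := (mem_graph.1 (hMY ⟨z, hz, rfl⟩)).1
          rwa [pr1_append] at this
        have hx1 := mem_graph.1 hxE
        have hxΩ : pr1 x ∈ Ω := by
          by_contra hcon
          exact hxS (mem_graph.2 ⟨by rw [hop.frontier_eq]; exact ⟨hEΩ hx1.1, hcon⟩, hx1.2⟩)
        haveI : CompactSpace (graphSet h E) := isCompact_iff_compactSpace.1 hMc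
        exact geo hop hph h3 hE (fun j => (hcont j).mono hEΩ) hMh hx1.1 hxΩ
      · intro ε hε
        obtain ⟨p, hp⟩ := hf ε hε
        refine ⟨p, fun x hx => ?_⟩
        have := hp ⟨pr1 x.1, (mem_graph.1 hx).1⟩
        rw [hap x.1 x.2] at this
        exact this
    intro ε hε
    obtain ⟨p, hp⟩ := mem_PA.1 key ε hε
    refine ⟨p, fun z => ?_⟩
    have := hp ⟨_, z.1, z.2, rfl⟩
    simp only [hg, ContinuousMap.coe_mk, pr1_append] at this
    exact this

theorem stmt0 {n N : ℕ} (Ω : Set (Fin n → ℂ)) (hne : Ω.Nonempty)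
    (hbd : Bornology.IsBounded Ω) (hconn : IsConnected Ω) (hop : IsOpen Ω)
    (hC1 : C1Boundary Ω) (hpc : polyHull (closure Ω) = closure Ω)
    (h : Fin N → (Fin n → ℂ) → ℂ)
    (hcont : ∀ j, ContinuousOn (h j) (closure Ω))
    (hph : ∀ j, Pluriharmonic (h j) Ω) :
    List.TFAE
      [ polyHull (graphSet h (frontier Ω)) = graphSet h (frontier Ω),
        NoAnalyticDisk (polyHull (graphSet h (frontier Ω)) \ graphSet h (frontier Ω)),
        ¬ ∃ φ : ℂ → (Fin n → ℂ), DifferentiableOn ℂ φ (ball (0:ℂ) 1) ∧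
            (∀ z ∈ ball (0:ℂ) 1, φ z ∈ Ω) ∧
            (∃ z ∈ ball (0:ℂ) 1, ∃ w ∈ ball (0:ℂ) 1, φ z ≠ φ w) ∧
            (∀ j, DifferentiableOn ℂ (fun z => h j (φ z)) (ball (0:ℂ) 1)),
        genAlg (zhGens (closure Ω) h) =
          {f : C(closure Ω, ℂ) |
            f.comp ⟨Set.inclusion (frontier_subset_closure (s := Ω)),
              continuous_inclusion (frontier_subset_closure (s := Ω))⟩ ∈
              genAlg (zhGens (frontier Ω) h)} ] := by
  have hcl : IsCompact (closure Ω) := hbd.isCompact_closure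
  have hfc : IsCompact (frontier Ω) := hcl.of_isClosed_subset isClosed_frontier frontier_subset_closure
  have hcf : ∀ j, ContinuousOn (h j) (frontier Ω) := fun j => (hcont j).mono frontier_subset_closure
  have hKc : IsCompact (graphSet h (frontier Ω)) := graph_compact hfc hcf
  have hYc : IsCompact (graphSet h (closure Ω)) := graph_compact hcl hcont
  tfae_have 1 → 2 := by
    intro h1 φ _ hφ z hz
    have := hφ z hz
    rw [h1, Set.diff_self] at this
    exact this.elim
  tfae_have 2 → 3 := by
    rintro h2 ⟨φ, hφ, hφΩ, ⟨a, ha, b, hb, hab⟩, hφh⟩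
    have := h2 (fun t => Fin.append (φ t) (fun j => h j (φ t))) ?_ ?_ a ha b hb
    · apply hab
      have h3 := congrArg pr1 this
      simpa only [pr1_append] using h3
    · rw [differentiableOn_pi]
      intro i
      refine Fin.addCases (fun i => ?_) (fun j => ?_) i
      · simp only [Fin.append_left]; exact differentiableOn_pi.1 hφ i
      · simp only [Fin.append_right]; exact hφh j
    · intro t ht
      refine ⟨T4 hbd hop hcont hph ⟨φ, hφ, hφΩ, ⟨a, ha, b, hb, hab⟩, hφh, t, ht, rfl⟩, fun hmem => ?_⟩
      have h3 := (mem_graph.1 hmem).1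
      rw [pr1_append, hop.frontier_eq] at h3
      exact h3.2 (hφΩ t ht)
  tfae_have 3 → 1 := by
    intro h3
    refine Set.Subset.antisymm (T3 hop hph hKc ?_ h3) (subset_hull hKc)
    intro x hx
    refine T2 hbd hop hC1 hpc hcont hph (hull_of hYc fun p C hC hb => hull_le hx p hC fun w hw => hb w ?_)
    exact Set.image_mono frontier_subset_closure hw
  tfae_have 3 → 4 := fun h3 => T6 hbd hop hC1 hpc hcont hph h3
  tfae_have 4 → 3 := fun h4 => T5 hbd hop h4
  tfae_finish
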